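/- Let m ≥ 1, θ > 1, and let f : ℝ^m → ℝ be locally Lipschitz continuous. If for some λ₁ ∈ ℝ there exists φ ∈ C²(ℝ^m) which is a subsolution of (EP)_{λ₁}, then for every λ₂ ≤ λ₁ the ergodic problem (EP)_{λ₂} admits a C² solution; in particular (EP) (with varying λ) has infinitely many solutions. -/

import Mathlib

open Filter

noncomputable def lap {m : ℕ} (φ : EuclideanSpace ℝ (Fin m) → ℝ)
    (y : EuclideanSpace ℝ (Fin m)) : ℝ :=
  ∑ i : Fin m, iteratedFDeriv ℝ 2 φ y ![EuclideanSpace.single i 1, EuclideanSpace.single i 1]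

def IsSubsolution {m : ℕ} (θ : ℝ) (f : EuclideanSpace ℝ (Fin m) → ℝ) (lam : ℝ)
    (φ : EuclideanSpace ℝ (Fin m) → ℝ) : Prop :=
  ContDiff ℝ 2 φ ∧
    ∀ y, -(1/2) * lap φ y + (1/θ) * ‖gradient φ y‖ ^ θ ≤ f y - lam

def IsSupersolution {m : ℕ} (θ : ℝ) (f : EuclideanSpace ℝ (Fin m) → ℝ) (lam : ℝ)
    (φ : EuclideanSpace ℝ (Fin m) → ℝ) : Prop :=
  ContDiff ℝ 2 φ ∧
    ∀ y, -(1/2) * lap φ y + (1/θ) * ‖gradient φ y‖ ^ θ ≥ f y - lam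

def IsSolution {m : ℕ} (θ : ℝ) (f : EuclideanSpace ℝ (Fin m) → ℝ) (lam : ℝ)
    (φ : EuclideanSpace ℝ (Fin m) → ℝ) : Prop :=
  ContDiff ℝ 2 φ ∧
    ∀ y, -(1/2) * lap φ y + (1/θ) * ‖gradient φ y‖ ^ θ = f y - lam

noncomputable def lambdaStar {m : ℕ} (θ : ℝ) (f : EuclideanSpace ℝ (Fin m) → ℝ) : ℝ :=
  sSup {lam : ℝ | ∃ φ, IsSubsolution θ f lam φ}

def H0 {m : ℕ} (f : EuclideanSpace ℝ (Fin m) → ℝ) (α f₀ : ℝ) : Prop :=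
  LocallyLipschitz f ∧ BddBelow (Set.range f) ∧
    ∀ y, DifferentiableAt ℝ f y →
      (1 ≤ α → ‖gradient f y‖ ≤ f₀ * (1 + ‖y‖ ^ (α - 1))) ∧
      (α < 1 → ‖gradient f y‖ ≤ f₀)

def H1 {m : ℕ} (f : EuclideanSpace ℝ (Fin m) → ℝ) (α f₀ : ℝ) : Prop :=
  ∀ y, f₀⁻¹ * (‖y‖ ^ α + 1) ≤ f y ∧ f y ≤ f₀ * (‖y‖ ^ α + 1)

def MemPhi {m : ℕ} (γ : ℝ) (v : EuclideanSpace ℝ (Fin m) → ℝ) : Prop :=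
  ContDiff ℝ 2 v ∧ ∃ c > 1, ∀ y, c⁻¹ * ‖y‖ ^ γ - c ≤ v y ∧ v y ≤ c * (1 + ‖y‖ ^ γ)

def Coercive {m : ℕ} (f : EuclideanSpace ℝ (Fin m) → ℝ) : Prop :=
  Tendsto f (cocompact (EuclideanSpace ℝ (Fin m))) atTop



/-! ### Preliminaries -/

open Filter Topology MeasureTheory Set

/-- Euclidean space of dimension `m`. -/
abbrev Eu (m : ℕ) := EuclideanSpace ℝ (Fin m)

section Prelim
variable {m : ℕ}

lemma norm_grad_eq (u : Eu m → ℝ) (x : Eu m) : ‖gradient u x‖ = ‖fderiv ℝ u x‖ := by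
  unfold gradient
  simp

lemma lap_eq (u : Eu m → ℝ) (x : Eu m) :
    lap u x = ∑ i : Fin m, fderiv ℝ (fderiv ℝ u) x (EuclideanSpace.single i 1)
      (EuclideanSpace.single i 1) := by
  unfold lap
  refine Finset.sum_congr rfl fun i _ => ?_
  rw [iteratedFDeriv_two_apply]
  simp

lemma lap_eq_basis (u : Eu m → ℝ) (x : Eu m) {ι : Type*} [Fintype ι]
    (b : OrthonormalBasis ι ℝ (Eu m)) :
    lap u x = ∑ i, fderiv ℝ (fderiv ℝ u) x (b i) (b i) := by
  have h1 := congrFun (InnerProductSpace.laplacian_eq_iteratedFDeriv_orthonormalBasis u b) x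
  have h2 := congrFun (InnerProductSpace.laplacian_eq_iteratedFDeriv_orthonormalBasis u
    (EuclideanSpace.basisFun (Fin m) ℝ)) x
  have h3 : lap u x = ∑ i, iteratedFDeriv ℝ 2 u x
      ![EuclideanSpace.basisFun (Fin m) ℝ i, EuclideanSpace.basisFun (Fin m) ℝ i] := by
    unfold lap; simp
  rw [h3]
  rw [h2] at h1
  rw [h1]
  refine Finset.sum_congr rfl fun i _ => ?_
  rw [iteratedFDeriv_two_apply]
  simp

lemma second_order_necessary {G G' : ℝ → ℝ} {c : ℝ}
    (h1 : ∀ᶠ t in 𝓝 (0:ℝ), HasDerivAt G (G' t) t) (h2 : HasDerivAt G' c 0)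
    (hmax : IsLocalMax G 0) : G' 0 = 0 ∧ c ≤ 0 := by
  have e1 : deriv G =ᶠ[𝓝 0] G' := h1.mono fun t ht => ht.deriv
  have e0 : G' 0 = 0 := hmax.hasDerivAt_eq_zero h1.self_of_nhds
  refine ⟨e0, ?_⟩
  by_contra hc
  push Not at hc
  have e2 : deriv (deriv G) 0 = c := by
    rw [e1.deriv_eq, h2.deriv]
  have hmin : IsLocalMin G 0 := by
    apply isLocalMin_of_deriv_deriv_pos
    · rw [e2]; exact hc
    · rw [e1.self_of_nhds, e0]
    · exact h1.self_of_nhds.continuousAt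
  have hconst : G =ᶠ[𝓝 0] fun _ => G 0 := by
    filter_upwards [hmax, hmin] with t a b
    exact le_antisymm a b
  have e3 : deriv G =ᶠ[𝓝 0] deriv (fun _ => G 0) := hconst.deriv
  have e4 : deriv (deriv G) 0 = 0 := by
    rw [e3.deriv_eq]; simp
  rw [e2] at e4
  linarith

lemma line_deriv1 {u : Eu m → ℝ} (hu : ContDiff ℝ 2 u) (x ξ : Eu m) (t : ℝ) :
    HasDerivAt (fun t : ℝ => u (x + t • ξ)) (fderiv ℝ u (x + t • ξ) ξ) t := by
  have h1 : HasFDerivAt u (fderiv ℝ u (x + t • ξ)) (x + t • ξ) :=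
    (hu.differentiable (by norm_num) _).hasFDerivAt
  have h2 : HasDerivAt (fun t : ℝ => x + t • ξ) ξ t := by
    simpa using ((hasDerivAt_id t).smul_const ξ).const_add x
  exact h1.comp_hasDerivAt t h2

lemma contDiff_fderiv {u : Eu m → ℝ} (hu : ContDiff ℝ 2 u) : ContDiff ℝ 1 (fderiv ℝ u) :=
  hu.fderiv_right (by norm_num)

lemma line_deriv2 {u : Eu m → ℝ} (hu : ContDiff ℝ 2 u) (x ξ : Eu m) :
    HasDerivAt (fun t : ℝ => fderiv ℝ u (x + t • ξ) ξ)
      (fderiv ℝ (fderiv ℝ u) x ξ ξ) 0 := by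
  have h1 : HasFDerivAt (fderiv ℝ u) (fderiv ℝ (fderiv ℝ u) x) (x + (0:ℝ) • ξ) := by
    simpa using ((contDiff_fderiv hu).differentiable (by norm_num) x).hasFDerivAt
  have h2 : HasDerivAt (fun t : ℝ => x + t • ξ) ξ 0 := by
    simpa using ((hasDerivAt_id (0:ℝ)).smul_const ξ).const_add x
  have h3 : HasDerivAt (fun t : ℝ => fderiv ℝ u (x + t • ξ)) (fderiv ℝ (fderiv ℝ u) x ξ) 0 :=
    h1.comp_hasDerivAt (0:ℝ) h2
  simpa using h3.clm_apply (hasDerivAt_const (0:ℝ) ξ)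

/-- Doubling lemma: first and second order conditions along a line in the product space. -/
lemma doubling_line {u v : Eu m → ℝ} (hu : ContDiff ℝ 2 u) (hv : ContDiff ℝ 2 v)
    (x y ξ η : Eu m) {G G' : ℝ → ℝ} {c : ℝ}
    (h1 : ∀ᶠ t in 𝓝 (0:ℝ), HasDerivAt G (G' t) t) (h2 : HasDerivAt G' c 0)
    (hmax : IsLocalMax (fun t : ℝ => u (x + t • ξ) - v (y + t • η) - G t) 0) :
    fderiv ℝ u x ξ - fderiv ℝ v y η = G' 0 ∧
      fderiv ℝ (fderiv ℝ u) x ξ ξ - fderiv ℝ (fderiv ℝ v) y η η ≤ c := by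
  have k := second_order_necessary
    (G := fun t : ℝ => u (x + t • ξ) - v (y + t • η) - G t)
    (G' := fun t : ℝ => fderiv ℝ u (x + t • ξ) ξ - fderiv ℝ v (y + t • η) η - G' t)
    (c := fderiv ℝ (fderiv ℝ u) x ξ ξ - fderiv ℝ (fderiv ℝ v) y η η - c)
    (h1.mono fun t ht => ((line_deriv1 hu x ξ t).sub (line_deriv1 hv y η t)).sub ht)
    (((line_deriv2 hu x ξ).sub (line_deriv2 hv y η)).sub h2) hmax
  obtain ⟨k1, k2⟩ := k
  simp only [zero_smul, add_zero] at k1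
  exact ⟨by linarith, by linarith⟩

/-- Maximum principle ingredient. -/
lemma max_point {u v : Eu m → ℝ} (hu : ContDiff ℝ 2 u) (hv : ContDiff ℝ 2 v) {x : Eu m}
    (hmax : IsLocalMax (fun y => u y - v y) x) :
    fderiv ℝ u x = fderiv ℝ v x ∧ lap u x ≤ lap v x := by
  have key : ∀ ξ : Eu m, fderiv ℝ u x ξ - fderiv ℝ v x ξ = 0 ∧
      fderiv ℝ (fderiv ℝ u) x ξ ξ - fderiv ℝ (fderiv ℝ v) x ξ ξ ≤ 0 := by
    intro ξ
    refine doubling_line hu hv x x ξ ξ (G := fun _ => 0) (G' := fun _ => 0) (c := 0)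
      (Eventually.of_forall fun t => hasDerivAt_const _ _) (hasDerivAt_const _ _) ?_
    have hc : Tendsto (fun t : ℝ => x + t • ξ) (𝓝 0) (𝓝 x) := by
      have : Continuous (fun t : ℝ => x + t • ξ) := by fun_prop
      simpa using this.tendsto 0
    have := hc.eventually hmax
    filter_upwards [this] with t ht
    simpa using ht
  constructor
  · ext ξ
    have := (key ξ).1
    linarith
  · rw [lap_eq, lap_eq]
    refine Finset.sum_le_sum fun i _ => ?_
    have := (key (EuclideanSpace.single i 1)).2
    linarith

end Prelim


open Filter Topology MeasureTheory Set

set_option linter.unusedSectionVars false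
set_option maxSynthPendingDepth 3

section Gauss
variable {m : ℕ} {F : Type*} [NormedAddCommGroup F] [NormedSpace ℝ F]

lemma integrable_gauss {b : ℝ} (hb : 0 < b) :
    Integrable (fun z : Eu m => Real.exp (-b * ‖z‖ ^ 2)) := by
  apply Integrable.of_integral_ne_zero
  rw [GaussianFourier.integral_rexp_neg_mul_sq_norm hb]
  positivity

/-- Kernels with Gaussian decay. -/
def GK (V : Eu m → F) : Prop :=
  Continuous V ∧ ∃ C : ℝ, ∀ z, ‖V z‖ ≤ C * Real.exp (-(1/4) * ‖z‖ ^ 2)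

lemma GK.integrable {V : Eu m → F} (hV : GK V) : Integrable V := by
  obtain ⟨hc, C, hC⟩ := hV
  exact ((integrable_gauss (m := m) (b := 1/4) (by norm_num)).const_mul C).mono'
    hc.aestronglyMeasurable (Eventually.of_forall hC)

/-- Averages against a kernel. -/
noncomputable def avg (V : Eu m → F) (h : Eu m → ℝ) (x : Eu m) (s : ℝ) : F :=
  ∫ z, h (x + s • z) • V z

lemma avg_integrable {V : Eu m → F} (hV : GK V) {h : Eu m → ℝ} (hc : Continuous h) {B : ℝ}
    (hB : ∀ x, |h x| ≤ B) (x : Eu m) (s : ℝ) :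
    Integrable (fun z => h (x + s • z) • V z) := by
  refine (hV.integrable.norm.const_mul B).mono' ?_ (Eventually.of_forall fun z => ?_)
  · exact ((hc.comp (by fun_prop)).smul hV.1).aestronglyMeasurable
  · rw [norm_smul]
    exact mul_le_mul_of_nonneg_right (hB _) (norm_nonneg _)

lemma avg_norm_le {V : Eu m → F} (hV : GK V) {h : Eu m → ℝ} {B : ℝ}
    (hB : ∀ x, |h x| ≤ B) (x : Eu m) (s : ℝ) :
    ‖avg V h x s‖ ≤ B * ∫ z, ‖V z‖ := by
  unfold avg
  rw [← integral_const_mul]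
  refine norm_integral_le_of_norm_le (hV.integrable.norm.const_mul B)
    (Eventually.of_forall fun z => ?_)
  rw [norm_smul]
  exact mul_le_mul_of_nonneg_right (hB _) (norm_nonneg _)

lemma avg_continuous {V : Eu m → F} (hV : GK V) {h : Eu m → ℝ} (hc : Continuous h) {B : ℝ}
    (hB : ∀ x, |h x| ≤ B) : Continuous (fun p : Eu m × ℝ => avg V h p.1 p.2) := by
  unfold avg
  refine continuous_of_dominated (bound := fun z => B * ‖V z‖) (fun p => ?_) (fun p => ?_)
    (hV.integrable.norm.const_mul B) (Eventually.of_forall fun z => ?_)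
  · exact ((hc.comp (by fun_prop)).smul hV.1).aestronglyMeasurable
  · refine Eventually.of_forall fun z => ?_
    rw [norm_smul]
    exact mul_le_mul_of_nonneg_right (hB _) (norm_nonneg _)
  · exact (hc.comp (by fun_prop)).smul continuous_const

lemma cocompact_eq_comap : cocompact (Eu m) = comap norm atTop := by
  rw [← Metric.cobounded_eq_cocompact, ← comap_norm_atTop]

instance cocompact_cg : (cocompact (Eu m)).IsCountablyGenerated := by
  rw [cocompact_eq_comap]; infer_instance

lemma tendsto_add_cocompact (a : Eu m) :
    Tendsto (fun x : Eu m => x + a) (cocompact _) (cocompact _) :=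
  (Homeomorph.addRight a).isClosedEmbedding.tendsto_cocompact

lemma avg_tendsto_zero {V : Eu m → F} (hV : GK V) {h : Eu m → ℝ} (hc : Continuous h) {B : ℝ}
    (hB : ∀ x, |h x| ≤ B) (h0 : Tendsto h (cocompact _) (𝓝 0)) (s : ℝ) :
    Tendsto (fun x => avg V h x s) (cocompact _) (𝓝 0) := by
  have : (0 : F) = ∫ z : Eu m, (0 : F) := by simp
  rw [this]
  unfold avg
  refine tendsto_integral_filter_of_dominated_convergence (fun z => B * ‖V z‖)
    (Eventually.of_forall fun x => ?_) (Eventually.of_forall fun x => ?_)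
    (hV.integrable.norm.const_mul B) (Eventually.of_forall fun z => ?_)
  · exact ((hc.comp (by fun_prop)).smul hV.1).aestronglyMeasurable
  · refine Eventually.of_forall fun z => ?_
    rw [norm_smul]
    exact mul_le_mul_of_nonneg_right (hB _) (norm_nonneg _)
  · have := (h0.comp (tendsto_add_cocompact (s • z))).smul_const (V z)
    simpa using this

lemma avg_add {V : Eu m → F} (hV : GK V) {h₁ h₂ : Eu m → ℝ} (hc₁ : Continuous h₁)
    (hc₂ : Continuous h₂) {B₁ B₂ : ℝ}
    (hB₁ : ∀ x, |h₁ x| ≤ B₁) (hB₂ : ∀ x, |h₂ x| ≤ B₂) (x : Eu m) (s : ℝ) :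
    avg V (fun y => h₁ y - h₂ y) x s = avg V h₁ x s - avg V h₂ x s := by
  unfold avg
  rw [← integral_sub (avg_integrable hV hc₁ hB₁ x s) (avg_integrable hV hc₂ hB₂ x s)]
  simp only [sub_smul]

lemma avg_eq_shift {V : Eu m → F} {h : Eu m → ℝ} {s : ℝ} (hs : 0 < s) (x : Eu m) :
    avg V h x s = ∫ w, h (s • w) • V (w - s⁻¹ • x) := by
  unfold avg
  rw [← integral_add_right_eq_self (fun w : Eu m => h (s • w) • V (w - s⁻¹ • x)) (s⁻¹ • x)]
  congr 1
  ext z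
  congr 2
  · rw [smul_add, smul_smul, mul_inv_cancel₀ hs.ne', one_smul, add_comm]
  · simp

lemma sq_shift (a b : Eu m) : ‖a‖ ^ 2 / 2 - ‖b‖ ^ 2 ≤ ‖a - b‖ ^ 2 := by
  have h1 : ‖a‖ ≤ ‖a - b‖ + ‖b‖ := by
    have := norm_add_le (a - b) b
    simpa using this
  have h0 := norm_nonneg a
  nlinarith [sq_nonneg (‖a - b‖ - ‖b‖)]

lemma avg_hasFDerivAt {V : Eu m → F} {V' : Eu m → (Eu m →L[ℝ] F)} (hV : GK V) (hV' : GK V')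
    (hd : ∀ z, HasFDerivAt V (-V' z) z) {h : Eu m → ℝ} (hc : Continuous h) {B : ℝ}
    (hB : ∀ x, |h x| ≤ B) {s : ℝ} (hs : 0 < s) (x : Eu m) :
    HasFDerivAt (fun x => avg V h x s) (s⁻¹ • avg V' h x s) x := by
  have hB0 : 0 ≤ B := (abs_nonneg _).trans (hB 0)
  obtain ⟨C, hC⟩ := hV'.2
  have key : ∀ y₀ : Eu m, HasFDerivAt (fun y => ∫ w, h (s • w) • V (w - y))
      (∫ w, h (s • w) • V' (w - y₀)) y₀ := by
    intro y₀
    refine hasFDerivAt_integral_of_dominated_of_fderiv_le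
      (F := fun y w => h (s • w) • V (w - y)) (F' := fun y w => h (s • w) • V' (w - y))
      (bound := fun w => B * (C * (Real.exp (1/4) * Real.exp (-(1/8) * ‖w - y₀‖ ^ 2))))
      (Metric.ball_mem_nhds y₀ one_pos)
      (Eventually.of_forall fun y => ?_) ?_ ?_ (Eventually.of_forall fun w y hy => ?_) ?_
      (Eventually.of_forall fun w y hy => ?_)
    · exact ((hc.comp (by fun_prop)).smul (hV.1.comp (by fun_prop))).aestronglyMeasurable
    · refine ((hV.integrable.comp_sub_right y₀).norm.const_mul B).mono' ?_
        (Eventually.of_forall fun z => ?_)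
      · exact ((hc.comp (by fun_prop)).smul (hV.1.comp (by fun_prop))).aestronglyMeasurable
      · rw [norm_smul]
        exact mul_le_mul_of_nonneg_right (hB _) (norm_nonneg _)
    · exact ((hc.comp (by fun_prop)).smul (hV'.1.comp (by fun_prop))).aestronglyMeasurable
    · rw [norm_smul]
      have hC0 : 0 ≤ C := by
        have := (norm_nonneg _).trans (hC 0)
        simpa using this
      refine mul_le_mul (hB _) ((hC _).trans ?_) (norm_nonneg _) hB0
      refine mul_le_mul_of_nonneg_left ?_ hC0
      rw [← Real.exp_add]
      apply Real.exp_le_exp.2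
      have h1 := sq_shift (w - y₀) (y - y₀)
      rw [sub_sub_sub_cancel_right] at h1
      have h2 : ‖y - y₀‖ < 1 := by simpa [dist_eq_norm] using hy
      have h3 : ‖y - y₀‖ ^ 2 ≤ 1 := by nlinarith [norm_nonneg (y - y₀)]
      linarith
    · exact ((((integrable_gauss (m := m) (b := 1/8) (by norm_num)).comp_sub_right y₀).const_mul
        _).const_mul _).const_mul _
    · have h1 : HasFDerivAt (fun y : Eu m => w - y) (-ContinuousLinearMap.id ℝ (Eu m)) y := by
        simpa using (hasFDerivAt_id y).const_sub w
      have h2 := (hd (w - y)).comp y h1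
      have h3 : (-V' (w - y)).comp (-ContinuousLinearMap.id ℝ (Eu m)) = V' (w - y) := by
        ext; simp
      rw [h3] at h2
      exact h2.const_smul (h (s • w))
  have h1 : HasFDerivAt (fun x : Eu m => s⁻¹ • x) (s⁻¹ • ContinuousLinearMap.id ℝ (Eu m)) x :=
    (hasFDerivAt_id x).const_smul s⁻¹
  have h2 := (key (s⁻¹ • x)).comp x h1
  have e1 : (fun x => avg V h x s) =
      (fun y => ∫ w, h (s • w) • V (w - y)) ∘ (fun x : Eu m => s⁻¹ • x) := by
    ext x; exact avg_eq_shift hs x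
  rw [e1, avg_eq_shift hs]
  have h3 : (∫ w, h (s • w) • V' (w - s⁻¹ • x)).comp (s⁻¹ • ContinuousLinearMap.id ℝ (Eu m)) =
      s⁻¹ • ∫ w, h (s • w) • V' (w - s⁻¹ • x) := by
    ext; simp
  rw [h3] at h2
  exact h2

end Gauss


open Filter Topology MeasureTheory Set
set_option linter.unusedSectionVars false
set_option maxSynthPendingDepth 3

section Kernels
variable {m : ℕ}

noncomputable def isl (m : ℕ) : Eu m →L[ℝ] Eu m →L[ℝ] ℝ := innerSL ℝ
lemma isl_apply (x y : Eu m) : isl m x y = inner ℝ x y := rfl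
lemma isl_norm (x : Eu m) : ‖isl m x‖ = ‖x‖ := innerSL_apply_norm (𝕜 := ℝ) x
lemma isl_norm_le : ‖isl m‖ ≤ 1 :=
  ContinuousLinearMap.opNorm_le_bound _ zero_le_one fun x => by rw [isl_norm, one_mul]

noncomputable def cW (m : ℕ) : ℝ := (∫ z : Eu m, Real.exp (-(1/2) * ‖z‖ ^ 2))⁻¹

lemma cW_pos : 0 < cW m := by
  unfold cW
  rw [GaussianFourier.integral_rexp_neg_mul_sq_norm (by norm_num)]
  positivity

noncomputable def W (z : Eu m) : ℝ := cW m * Real.exp (-(1/2) * ‖z‖ ^ 2)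
noncomputable def W1 (z : Eu m) : Eu m →L[ℝ] ℝ := W z • isl m z
noncomputable def W2 (z : Eu m) : Eu m →L[ℝ] Eu m →L[ℝ] ℝ :=
  W z • ((isl m z).smulRight (isl m z) - isl m)
noncomputable def W3 (z : Eu m) : ℝ := W z * (‖z‖ ^ 2 - m)

lemma W_pos (z : Eu m) : 0 < W z := mul_pos cW_pos (Real.exp_pos _)

lemma W_continuous : Continuous (W : Eu m → ℝ) := by
  unfold W; fun_prop

lemma gk_of {F : Type*} [NormedAddCommGroup F] {V : Eu m → F} (hc : Continuous V) {C : ℝ}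
    (hC : 0 ≤ C) (h : ∀ z, ‖V z‖ ≤ C * (1 + ‖z‖ ^ 2) * W z) : GK V := by
  refine ⟨hc, C * 4 * cW m, fun z => (h z).trans ?_⟩
  have h1 : 1 + ‖z‖ ^ 2 ≤ 4 * Real.exp (1/4 * ‖z‖ ^ 2) := by
    have := Real.add_one_le_exp (1/4 * ‖z‖ ^ 2)
    nlinarith
  have h2 : Real.exp (-(1/4) * ‖z‖ ^ 2) = Real.exp (1/4 * ‖z‖ ^ 2) *
      Real.exp (-(1/2) * ‖z‖ ^ 2) := by
    rw [← Real.exp_add]; congr 1; ring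
  rw [h2]
  have := cW_pos (m := m)
  calc C * (1 + ‖z‖ ^ 2) * W z ≤ C * (4 * Real.exp (1/4 * ‖z‖ ^ 2)) * W z := by
        have := (W_pos z).le
        gcongr
    _ = _ := by unfold W; ring

lemma gkW : GK (W : Eu m → ℝ) := by
  refine gk_of W_continuous zero_le_one fun z => ?_
  rw [Real.norm_of_nonneg (W_pos z).le]
  nlinarith [W_pos z, sq_nonneg ‖z‖, mul_nonneg (W_pos z).le (sq_nonneg ‖z‖)]

lemma gkW1 : GK (W1 : Eu m → _) := by
  refine gk_of (W_continuous.smul (isl m).continuous) zero_le_one fun z => ?_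
  unfold W1
  rw [norm_smul, isl_norm, Real.norm_of_nonneg (W_pos z).le]
  have : ‖z‖ ≤ 1 + ‖z‖ ^ 2 := by nlinarith [sq_nonneg (‖z‖ - 1), norm_nonneg z]
  nlinarith [W_pos z]

lemma gkW2 : GK (W2 : Eu m → _) := by
  refine gk_of ?_ zero_le_one fun z => ?_
  · refine W_continuous.smul (Continuous.sub ?_ continuous_const)
    have h := (ContinuousLinearMap.smulRightL ℝ (Eu m) (Eu m →L[ℝ] ℝ)).continuous₂
    exact h.comp ((isl m).continuous.prodMk (isl m).continuous)
  · unfold W2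
    rw [norm_smul, Real.norm_of_nonneg (W_pos z).le]
    have h1 : ‖(isl m z).smulRight (isl m z) - isl m‖ ≤ 1 + ‖z‖ ^ 2 := by
      refine (norm_sub_le _ _).trans ?_
      rw [ContinuousLinearMap.norm_smulRight_apply, isl_norm]
      have := isl_norm_le (m := m)
      nlinarith
    nlinarith [W_pos z]

lemma gkW3 : GK (W3 : Eu m → ℝ) := by
  refine gk_of (C := m + 1) ?_ (by positivity) fun z => ?_
  · exact W_continuous.mul (by fun_prop)
  · unfold W3
    rw [norm_mul, Real.norm_of_nonneg (W_pos z).le, Real.norm_eq_abs]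
    have h1 : |‖z‖ ^ 2 - (m:ℝ)| ≤ (m + 1) * (1 + ‖z‖ ^ 2) := by
      have : (0:ℝ) ≤ m := by positivity
      rw [abs_le]; constructor <;> nlinarith [sq_nonneg ‖z‖, mul_nonneg this (sq_nonneg ‖z‖)]
    nlinarith [W_pos z]

lemma integral_W : ∫ z : Eu m, W z = 1 := by
  unfold W
  rw [integral_const_mul]
  unfold cW
  apply inv_mul_cancel₀
  rw [GaussianFourier.integral_rexp_neg_mul_sq_norm (by norm_num)]
  positivity

lemma hasFDerivAt_W (z : Eu m) : HasFDerivAt W (-W1 z) z := by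
  have h1 : HasFDerivAt (fun z : Eu m => ‖z‖ ^ 2) (2 • isl m z) z :=
    (hasStrictFDerivAt_norm_sq z).hasFDerivAt
  have h2 := ((h1.const_mul (-(1/2))).exp).const_mul (cW m)
  have h3 : cW m • Real.exp (-(1/2) * ‖z‖ ^ 2) • (-(1/2) : ℝ) • (2 • isl m z) = -W1 z := by
    ext y
    simp [W1, W]
    ring
  rw [h3] at h2
  exact h2

lemma hasFDerivAt_W1 (z : Eu m) : HasFDerivAt W1 (-W2 z) z := by
  have h2 := (hasFDerivAt_W z).smul ((isl m).hasFDerivAt (x := z))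
  have h3 : W z • isl m + (-W1 z).smulRight (isl m z) = -W2 z := by
    ext a b
    simp [W1, W2]
    ring
  rw [h3] at h2
  exact h2

lemma integral_W2 : ∫ z : Eu m, W2 z = 0 := by
  have h := avg_hasFDerivAt gkW1 gkW2 hasFDerivAt_W1 (h := fun _ => 1) continuous_const (B := 1)
    (fun _ => by simp) one_pos (0 : Eu m)
  have h' : HasFDerivAt (𝕜 := ℝ) (fun x : Eu m => avg W1 (fun _ => 1) x 1) 0 (0 : Eu m) := by
    unfold avg
    exact hasFDerivAt_const _ _
  have := h.unique h'
  simpa [avg] using this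

lemma integral_W1 : ∫ z : Eu m, W1 z = 0 := by
  have h := avg_hasFDerivAt gkW gkW1 hasFDerivAt_W (h := fun _ => 1) continuous_const (B := 1)
    (fun _ => by simp) one_pos (0 : Eu m)
  have h' : HasFDerivAt (𝕜 := ℝ) (fun x : Eu m => avg W (fun _ => 1) x 1) 0 (0 : Eu m) := by
    unfold avg
    exact hasFDerivAt_const _ _
  have := h.unique h'
  simpa [avg] using this

/-- The trace functional on bilinear forms. -/
noncomputable def trc (m : ℕ) : (Eu m →L[ℝ] Eu m →L[ℝ] ℝ) →L[ℝ] ℝ :=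
  ∑ i : Fin m, (ContinuousLinearMap.apply ℝ ℝ (EuclideanSpace.single i 1 : Eu m)).comp
    (ContinuousLinearMap.apply ℝ (Eu m →L[ℝ] ℝ) (EuclideanSpace.single i 1 : Eu m))

lemma trc_apply (A : Eu m →L[ℝ] Eu m →L[ℝ] ℝ) :
    trc m A = ∑ i : Fin m, A (EuclideanSpace.single i 1) (EuclideanSpace.single i 1) := by
  simp [trc]

lemma lap_eq_trc (u : Eu m → ℝ) (x : Eu m) : lap u x = trc m (fderiv ℝ (fderiv ℝ u) x) := by
  rw [lap_eq, trc_apply]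

lemma trc_W2 (z : Eu m) : trc m (W2 z) = W3 z := by
  rw [trc_apply]
  unfold W2 W3
  simp only [_root_.smul_apply, _root_.sub_apply,
    ContinuousLinearMap.smulRight_apply, isl_apply, smul_eq_mul]
  rw [← Finset.mul_sum, Finset.sum_sub_distrib]
  congr 2
  · rw [EuclideanSpace.norm_sq_eq]
    refine Finset.sum_congr rfl fun i _ => ?_
    simp [EuclideanSpace.inner_single_right]
    ring
  · simp

lemma trc_avg {h : Eu m → ℝ} (hc : Continuous h) {B : ℝ}
    (hB : ∀ x, |h x| ≤ B) (x : Eu m) (s : ℝ) :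
    trc m (avg W2 h x s) = avg W3 h x s := by
  unfold avg
  rw [← (trc m).integral_comp_comm (avg_integrable gkW2 hc hB x s)]
  simp [trc_W2]

lemma avg_hasDerivAt {h : Eu m → ℝ} (hc : Continuous h) {B : ℝ}
    (hB : ∀ x, |h x| ≤ B) {s : ℝ} (hs : 0 < s) (x : Eu m) :
    HasDerivAt (fun s => avg W h x s) (s⁻¹ * avg W3 h x s) s := by
  have hB0 : 0 ≤ B := (abs_nonneg _).trans (hB 0)
  obtain ⟨C, hC⟩ := (gkW3 (m := m)).2
  have hC0 : 0 ≤ C := by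
    have := (norm_nonneg _).trans (hC 0)
    simpa using this
  have cv : ∀ V : Eu m → ℝ, ∀ s : ℝ, 0 < s →
      avg V h x s = ∫ w, (s ^ m)⁻¹ * (h (x + w) * V (s⁻¹ • w)) := by
    intro V s hs
    have := Measure.integral_comp_smul (volume : Measure (Eu m))
      (fun w => h (x + w) * V (s⁻¹ • w)) s
    rw [integral_const_mul]
    rw [abs_of_pos (by positivity)] at this
    simp only [smul_smul, inv_mul_cancel₀ hs.ne', one_smul, finrank_euclideanSpace,
      Fintype.card_fin, smul_eq_mul] at this
    rw [← this]
    rfl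
  have hn : Ioo (s/2) (2*s) ∈ 𝓝 s := Ioo_mem_nhds (by linarith) (by linarith)
  have hintg : ∀ s : ℝ, 0 < s → Integrable (fun w => (s ^ m)⁻¹ * (h (x + w) * W (s⁻¹ • w))) := by
    intro s hs
    refine Integrable.const_mul ?_ _
    have i1 : Integrable (fun w : Eu m => W (s⁻¹ • w)) :=
      (integrable_comp_smul_iff volume W (inv_ne_zero hs.ne')).2 gkW.integrable
    refine (i1.norm.const_mul B).mono' ?_ (Eventually.of_forall fun w => ?_)
    · exact ((hc.comp (by fun_prop)).mul
        (W_continuous.comp (by fun_prop))).aestronglyMeasurable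
    · rw [norm_mul]
      exact mul_le_mul_of_nonneg_right (hB _) (norm_nonneg _)
  have key := hasDerivAt_integral_of_dominated_loc_of_deriv_le (𝕜 := ℝ) (μ := (volume : Measure (Eu m)))
      (F := fun s w => (s ^ m)⁻¹ * (h (x + w) * W (s⁻¹ • w)))
      (F' := fun s w => s⁻¹ * ((s ^ m)⁻¹ * (h (x + w) * W3 (s⁻¹ • w))))
      (bound := fun w => (s/2)⁻¹ * (((s/2) ^ m)⁻¹ * (B * (C *
        Real.exp (-(1/4 * ((2*s)⁻¹)^2) * ‖w‖ ^ 2)))))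
      (x₀ := s) hn
      (Eventually.of_forall fun s => ?_) (hintg s hs) ?_
      (Eventually.of_forall fun w r hr => ?_) ?_ (Eventually.of_forall fun w r hr => ?_)
  · have := key.2
    have e : (fun s => avg W h x s) =ᶠ[𝓝 s]
        (fun s => ∫ w, (s ^ m)⁻¹ * (h (x + w) * W (s⁻¹ • w))) := by
      filter_upwards [Ioi_mem_nhds hs] with r hr
      exact cv _ r hr
    refine (this.congr_of_eventuallyEq e).congr_deriv ?_
    rw [integral_const_mul, ← cv _ s hs]
  · exact (continuous_const.mul ((hc.comp (by fun_prop)).mul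
        (W_continuous.comp (by fun_prop)))).aestronglyMeasurable
  · exact (continuous_const.mul (continuous_const.mul ((hc.comp (by fun_prop)).mul
        (gkW3.1.comp (by fun_prop))))).aestronglyMeasurable
  · have hr0 : 0 < r := lt_trans (by linarith) hr.1
    rw [norm_mul, norm_mul, norm_mul, norm_inv, norm_inv, norm_pow, Real.norm_of_nonneg hr0.le]
    have h1 := hr.1
    have h2 := hr.2
    have h3 : |h (x + w)| ≤ B := hB _
    have h4 : ‖W3 (r⁻¹ • w)‖ ≤ C * Real.exp (-(1/4 * ((2*s)⁻¹)^2) * ‖w‖ ^ 2) := by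
      refine (hC _).trans ?_
      refine mul_le_mul_of_nonneg_left (Real.exp_le_exp.2 ?_) hC0
      rw [norm_smul, norm_inv, Real.norm_of_nonneg hr0.le, mul_pow]
      have : (2*s)⁻¹ ≤ r⁻¹ := by gcongr
      have : ((2*s)⁻¹)^2 ≤ (r⁻¹)^2 := by gcongr
      nlinarith [mul_le_mul_of_nonneg_right this (sq_nonneg ‖w‖)]
    gcongr
    exact h3
  · refine (((((integrable_gauss ?_)).const_mul _).const_mul _).const_mul _).const_mul _
    positivity
  · have hr0 : 0 < r := lt_trans (by linarith) hr.1
    have d1 : HasDerivAt (fun r : ℝ => (r ^ m)⁻¹) (-(m * r⁻¹) * (r ^ m)⁻¹) r := by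
      have := (hasDerivAt_pow m r).fun_inv (by positivity)
      refine this.congr_deriv ?_
      rcases Nat.eq_zero_or_pos m with h0 | h0
      · subst h0; simp
      · obtain ⟨k, rfl⟩ : ∃ k, m = k + 1 := ⟨m - 1, by omega⟩
        simp
        field_simp
        ring
    have d2 : HasDerivAt (fun r : ℝ => r⁻¹ • w) ((-(r ^ 2)⁻¹) • w) r :=
      (hasDerivAt_inv hr0.ne').smul_const w
    have d3 := (hasFDerivAt_W (r⁻¹ • w)).comp_hasDerivAt r d2
    have d4 := d1.mul (d3.const_mul (h (x + w)))
    refine d4.congr_deriv ?_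
    simp [W1, W3, isl_apply, norm_smul, inner_smul_left, inner_smul_right,
      real_inner_self_eq_norm_sq, abs_of_pos hr0]
    field_simp
    ring

end Kernels


open Filter Topology MeasureTheory Set
set_option linter.unusedSectionVars false
set_option maxSynthPendingDepth 3

section Res
variable {m : ℕ} {F : Type*} [NormedAddCommGroup F] [NormedSpace ℝ F]

/-- Hölder continuity with exponent one half. -/
def Hol (B : ℝ) (h : Eu m → F) : Prop := ∀ x y, ‖h x - h y‖ ≤ B * √‖x - y‖

lemma Hol.continuous {B : ℝ} {h : Eu m → F} (hh : Hol B h) : Continuous h := by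
  rw [continuous_iff_continuousAt]
  intro x
  rw [ContinuousAt, tendsto_iff_norm_sub_tendsto_zero]
  refine squeeze_zero (fun _ => norm_nonneg _) (fun y => hh y x) ?_
  have : Continuous (fun y : Eu m => B * √‖y - x‖) := by fun_prop
  simpa using this.tendsto x

noncomputable def wt (κ j s : ℝ) : ℝ := 2 * (s ^ j * Real.exp (-κ * s ^ 2))

lemma wt_nonneg (κ j : ℝ) {s : ℝ} (hs : 0 < s) : 0 ≤ wt κ j s := by unfold wt; positivity

lemma wt_measurable (κ j : ℝ) : Measurable (wt κ j) := by unfold wt; fun_prop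

lemma wt_mul (κ j a : ℝ) {s : ℝ} (hs : 0 < s) : wt κ j s * s ^ a = wt κ (j + a) s := by
  unfold wt; rw [Real.rpow_add hs]; ring

lemma wt_integrable {κ j : ℝ} (hκ : 0 < κ) (hj : -1 < j) : IntegrableOn (wt κ j) (Ioi 0) :=
  (integrableOn_rpow_mul_exp_neg_mul_sq hκ hj).const_mul 2

noncomputable def J (κ j : ℝ) : ℝ := ∫ s in Ioi 0, wt κ j s

lemma J_nonneg (κ j : ℝ) : 0 ≤ J κ j :=
  setIntegral_nonneg measurableSet_Ioi fun _ hs => wt_nonneg κ j hs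

lemma J_zero (κ : ℝ) : J κ 0 = √(Real.pi / κ) := by
  unfold J wt
  simp only [Real.rpow_zero, one_mul]
  rw [integral_const_mul, integral_gaussian_Ioi]
  ring

noncomputable def res (κ j : ℝ) (V : Eu m → F) (h : Eu m → ℝ) (x : Eu m) : F :=
  ∫ s in Ioi (0:ℝ), wt κ j s • avg V h x s

section
variable {κ j a K : ℝ} {V : Eu m → F} {h : Eu m → ℝ} {B : ℝ}

lemma res_bound (hK : ∀ x, ∀ s > 0, ‖avg V h x s‖ ≤ K * s ^ a) (x : Eu m) {s : ℝ} (hs : 0 < s) :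
    ‖wt κ j s • avg V h x s‖ ≤ K * wt κ (j + a) s := by
  rw [norm_smul, Real.norm_of_nonneg (wt_nonneg κ j hs), ← wt_mul κ j a hs]
  calc _ ≤ wt κ j s * (K * s ^ a) := mul_le_mul_of_nonneg_left (hK x s hs) (wt_nonneg κ j hs)
    _ = _ := by ring

lemma res_meas (hV : GK V) (hc : Continuous h) (hB : ∀ x, |h x| ≤ B) (x : Eu m) :
    AEStronglyMeasurable (fun s => wt κ j s • avg V h x s) (volume.restrict (Ioi 0)) := by
  refine (wt_measurable κ j).aestronglyMeasurable.smul ?_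
  have : Continuous (fun s => avg V h x s) :=
    (avg_continuous hV hc hB).comp (continuous_const.prodMk continuous_id)
  exact this.aestronglyMeasurable

lemma res_integrable (hκ : 0 < κ) (hj : -1 < j + a) (hV : GK V) (hc : Continuous h)
    (hB : ∀ x, |h x| ≤ B) (hK : ∀ x, ∀ s > 0, ‖avg V h x s‖ ≤ K * s ^ a) (x : Eu m) :
    IntegrableOn (fun s => wt κ j s • avg V h x s) (Ioi 0) := by
  refine ((wt_integrable hκ hj).const_mul K).mono' (res_meas hV hc hB x) ?_
  refine (ae_restrict_mem measurableSet_Ioi).mono fun s hs => res_bound hK x hs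

lemma res_norm_le (hκ : 0 < κ) (hj : -1 < j + a)
    (hK : ∀ x, ∀ s > 0, ‖avg V h x s‖ ≤ K * s ^ a) (x : Eu m) :
    ‖res κ j V h x‖ ≤ K * J κ (j + a) := by
  unfold res J
  rw [← integral_const_mul]
  refine norm_integral_le_of_norm_le ((wt_integrable hκ hj).const_mul K) ?_
  exact (ae_restrict_mem measurableSet_Ioi).mono fun s hs => res_bound hK x hs

lemma res_continuous (hκ : 0 < κ) (hj : -1 < j + a) (hV : GK V) (hc : Continuous h)
    (hB : ∀ x, |h x| ≤ B) (hK : ∀ x, ∀ s > 0, ‖avg V h x s‖ ≤ K * s ^ a) :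
    Continuous (res κ j V h) := by
  unfold res
  refine continuous_of_dominated (bound := fun s => K * wt κ (j+a) s)
    (fun x => res_meas hV hc hB x) (fun x => ?_)
    ((wt_integrable hκ hj).const_mul K) (Eventually.of_forall fun s => ?_)
  · exact (ae_restrict_mem measurableSet_Ioi).mono fun s hs => res_bound hK x hs
  · exact continuous_const.smul
      ((avg_continuous hV hc hB).comp (continuous_id.prodMk continuous_const))

lemma avg_bound0 (hV : GK V) (hB : ∀ x, |h x| ≤ B) :
    ∀ x, ∀ s > 0, ‖avg V h x s‖ ≤ (B * ∫ z, ‖V z‖) * s ^ (0:ℝ) := by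
  intro x s _
  rw [Real.rpow_zero, mul_one]
  exact avg_norm_le hV hB x s

lemma res_tendsto_zero (hκ : 0 < κ) (hj : -1 < j) (hV : GK V) (hc : Continuous h)
    (hB : ∀ x, |h x| ≤ B) (h0 : Tendsto h (cocompact _) (𝓝 0)) :
    Tendsto (res κ j V h) (cocompact _) (𝓝 0) := by
  have : (0 : F) = ∫ s in Ioi (0:ℝ), (0 : F) := by simp
  rw [this]
  unfold res
  have hj' : -1 < j + 0 := by linarith
  refine tendsto_integral_filter_of_dominated_convergence
    (fun s => (B * ∫ z, ‖V z‖) * wt κ (j+0) s)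
    (Eventually.of_forall fun x => res_meas hV hc hB x) (Eventually.of_forall fun x => ?_)
    ((wt_integrable hκ hj').const_mul _) (Eventually.of_forall fun s => ?_)
  · exact (ae_restrict_mem measurableSet_Ioi).mono fun s hs =>
      res_bound (avg_bound0 hV hB) x hs
  · simpa using (avg_tendsto_zero hV hc hB h0 s).const_smul (wt κ j s)

lemma res_sub (hκ : 0 < κ) (hj : -1 < j) (hV : GK V) {h₁ h₂ : Eu m → ℝ} (hc₁ : Continuous h₁)
    (hc₂ : Continuous h₂) {B₁ B₂ : ℝ}
    (hB₁ : ∀ x, |h₁ x| ≤ B₁) (hB₂ : ∀ x, |h₂ x| ≤ B₂) (x : Eu m) :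
    res κ j V (fun y => h₁ y - h₂ y) x = res κ j V h₁ x - res κ j V h₂ x := by
  have hj' : -1 < j + 0 := by linarith
  unfold res
  rw [← integral_sub (res_integrable hκ hj' hV hc₁ hB₁ (avg_bound0 hV hB₁) x)
    (res_integrable hκ hj' hV hc₂ hB₂ (avg_bound0 hV hB₂) x)]
  congr 1
  ext s
  rw [avg_add hV hc₁ hc₂ hB₁ hB₂, smul_sub]

lemma res_hasFDerivAt (hκ : 0 < κ) (hj : -1 < j) (hj' : -1 < j - 1 + a)
    {V' : Eu m → (Eu m →L[ℝ] F)} (hV : GK V) (hV' : GK V')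
    (hd : ∀ z, HasFDerivAt V (-V' z) z) (hc : Continuous h)
    (hB : ∀ x, |h x| ≤ B) (hK : ∀ x, ∀ s > 0, ‖avg V' h x s‖ ≤ K * s ^ a) (x : Eu m) :
    HasFDerivAt (res κ j V h) (res κ (j - 1) V' h x) x := by
  unfold res
  have hj0 : -1 < j + 0 := by linarith
  refine hasFDerivAt_integral_of_dominated_of_fderiv_le
      (F := fun x s => wt κ j s • avg V h x s) (F' := fun x s => wt κ (j-1) s • avg V' h x s)
      (bound := fun s => K * wt κ (j - 1 + a) s) (univ_mem)
      (Eventually.of_forall fun y => res_meas hV hc hB y)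
      (res_integrable hκ hj0 hV hc hB (avg_bound0 hV hB) x)
      (res_meas hV' hc hB x) ?_ ((wt_integrable hκ hj').const_mul K) ?_
  · exact (ae_restrict_mem measurableSet_Ioi).mono fun s hs y _ => res_bound hK y hs
  · refine (ae_restrict_mem measurableSet_Ioi).mono fun s hs y _ => ?_
    have h1 := (avg_hasFDerivAt hV hV' hd hc hB hs y).const_smul (wt κ j s)
    have h2 : wt κ j s • s⁻¹ • avg V' h y s = wt κ (j-1) s • avg V' h y s := by
      rw [smul_smul, sub_eq_add_neg, ← wt_mul κ j (-1) hs, Real.rpow_neg_one]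
    rw [h2] at h1
    exact h1

lemma sqrt_integrable (hV : GK V) : Integrable (fun z => √‖z‖ * ‖V z‖) := by
  obtain ⟨hc, C, hC⟩ := hV
  have hC0 : 0 ≤ C := by
    have := (norm_nonneg _).trans (hC 0)
    simpa using this
  refine ((integrable_gauss (m := m) (b := 1/8) (by norm_num)).const_mul (8*C)).mono' ?_
    (Eventually.of_forall fun z => ?_)
  · exact Continuous.aestronglyMeasurable (by fun_prop)
  · rw [Real.norm_of_nonneg (by positivity)]
    have h1 : √‖z‖ ≤ 8 * Real.exp (1/8 * ‖z‖ ^ 2) := by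
      have h2 := Real.add_one_le_exp (1/8 * ‖z‖ ^ 2)
      have h3 := Real.sq_sqrt (norm_nonneg z)
      have h4 : √‖z‖ ≤ 1 + ‖z‖ := by nlinarith [sq_nonneg (√‖z‖ - 1), Real.sqrt_nonneg ‖z‖]
      nlinarith [sq_nonneg (‖z‖ - 1)]
    have h5 : Real.exp (-(1/8) * ‖z‖ ^ 2) = Real.exp (1/8 * ‖z‖ ^ 2) *
        Real.exp (-(1/4) * ‖z‖ ^ 2) := by
      rw [← Real.exp_add]; congr 1; ring
    rw [h5]
    calc √‖z‖ * ‖V z‖ ≤ (8 * Real.exp (1/8 * ‖z‖ ^ 2)) * (C * Real.exp (-(1/4) * ‖z‖ ^ 2)) :=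
          mul_le_mul h1 (hC z) (norm_nonneg _) (by positivity)
      _ = _ := by ring

lemma avg_hol [CompleteSpace F] (hV : GK V) (hV0 : ∫ z, V z = 0) (hc : Continuous h)
    (hB : ∀ x, |h x| ≤ B) {b : ℝ} (hb : Hol b h) :
    ∀ x, ∀ s > 0, ‖avg V h x s‖ ≤ (b * ∫ z, √‖z‖ * ‖V z‖) * s ^ (1/2:ℝ) := by
  intro x s hs
  have h1 : avg V h x s = ∫ z, (h (x + s • z) - h x) • V z := by
    simp only [sub_smul]
    have i2 : Integrable (fun z => h x • V z) := hV.integrable.smul (h x)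
    rw [integral_sub (avg_integrable hV hc hB x s) i2, integral_smul, hV0]
    simp [avg]
  rw [h1, ← Real.sqrt_eq_rpow]
  have h2 : (b * ∫ z, √‖z‖ * ‖V z‖) * √s = ∫ z, (b * √s) * (√‖z‖ * ‖V z‖) := by
    rw [integral_const_mul]; ring
  rw [h2]
  refine norm_integral_le_of_norm_le ((sqrt_integrable hV).const_mul _)
    (Eventually.of_forall fun z => ?_)
  rw [norm_smul]
  have h3 := hb (x + s • z) x
  rw [add_sub_cancel_left, norm_smul, Real.norm_of_nonneg hs.le, Real.sqrt_mul hs.le] at h3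
  calc _ ≤ (b * (√s * √‖z‖)) * ‖V z‖ := mul_le_mul_of_nonneg_right h3 (norm_nonneg _)
    _ = _ := by ring

end

lemma avg_lip {V : Eu m → F} {V' : Eu m → (Eu m →L[ℝ] F)} (hV : GK V) (hV' : GK V')
    (hd : ∀ z, HasFDerivAt V (-V' z) z) {h : Eu m → ℝ} (hc : Continuous h) {B : ℝ}
    (hB : ∀ x, |h x| ≤ B) {s : ℝ} (hs : 0 < s) (x y : Eu m) :
    ‖avg V h x s - avg V h y s‖ ≤ s⁻¹ * (B * ∫ z : Eu m, ‖V' z‖) * ‖x - y‖ := by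
  refine Convex.norm_image_sub_le_of_norm_hasFDerivWithin_le (𝕜 := ℝ) (s := univ)
    (f := fun x => avg V h x s) (f' := fun x => s⁻¹ • avg V' h x s)
    (fun z _ => (avg_hasFDerivAt hV hV' hd hc hB hs z).hasFDerivWithinAt)
    (fun z _ => ?_) convex_univ (mem_univ _) (mem_univ _)
  rw [norm_smul, Real.norm_of_nonneg (by positivity)]
  exact mul_le_mul_of_nonneg_left (avg_norm_le hV' hB z s) (by positivity)

lemma res_hol {κ : ℝ} (hκ : 0 < κ) {h : Eu m → ℝ} (hc : Continuous h) {B : ℝ}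
    (hB : ∀ x, |h x| ≤ B) :
    Hol (B * (2 * (∫ z : Eu m, ‖W1 z‖) + ∫ z : Eu m, ‖W2 z‖) * J κ (-(1/2))) (res κ 0 W1 h) := by
  intro x y
  have hB0 : 0 ≤ B := (abs_nonneg _).trans (hB 0)
  set I1 := ∫ z : Eu m, ‖W1 z‖
  set I2 := ∫ z : Eu m, ‖W2 z‖
  have hI1 : 0 ≤ I1 := integral_nonneg fun _ => norm_nonneg _
  have hI2 : 0 ≤ I2 := integral_nonneg fun _ => norm_nonneg _
  have h0 : (-1:ℝ) < 0 + 0 := by norm_num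
  unfold res
  rw [← integral_sub (res_integrable hκ h0 gkW1 hc hB (avg_bound0 gkW1 hB) x)
    (res_integrable hκ h0 gkW1 hc hB (avg_bound0 gkW1 hB) y)]
  have e : B * (2 * I1 + I2) * J κ (-(1/2)) * √‖x - y‖ =
      ∫ s in Ioi 0, (B * (2 * I1 + I2) * √‖x - y‖) * wt κ (-(1/2)) s := by
    rw [integral_const_mul]; unfold J; ring
  rw [e]
  refine norm_integral_le_of_norm_le ((wt_integrable hκ (by norm_num)).const_mul _) ?_
  refine (ae_restrict_mem measurableSet_Ioi).mono fun s hs => ?_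
  have hs : 0 < s := hs
  rw [← smul_sub, norm_smul, Real.norm_of_nonneg (wt_nonneg _ _ hs)]
  have hw : wt κ (-(1/2)) s = wt κ 0 s * (√s)⁻¹ := by
    rw [← zero_add (-(1/2):ℝ), ← wt_mul κ 0 _ hs, Real.rpow_neg hs.le, ← Real.sqrt_eq_rpow]
  rw [hw]
  suffices hh : ‖avg W1 h x s - avg W1 h y s‖ ≤ B * (2 * I1 + I2) * √‖x - y‖ * (√s)⁻¹ by
    calc _ ≤ wt κ 0 s * (B * (2 * I1 + I2) * √‖x - y‖ * (√s)⁻¹) :=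
          mul_le_mul_of_nonneg_left hh (wt_nonneg _ _ hs)
      _ = _ := by ring
  have hss := Real.sqrt_pos.2 hs
  rcases le_total ‖x - y‖ s with hxy | hxy
  · have h1 : ‖avg W1 h x s - avg W1 h y s‖ ≤ s⁻¹ * (B * I2) * ‖x - y‖ := by
      exact avg_lip gkW1 gkW2 hasFDerivAt_W1 hc hB hs x y
    have h2 : s⁻¹ * ‖x - y‖ ≤ √‖x - y‖ * (√s)⁻¹ := by
      rw [← div_eq_inv_mul, ← div_eq_mul_inv, div_le_div_iff₀ hs hss]
      have a1 := Real.sq_sqrt hs.le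
      have a2 := Real.sq_sqrt (norm_nonneg (x - y))
      have a3 := Real.sqrt_le_sqrt hxy
      have a4 := Real.sqrt_nonneg ‖x-y‖
      calc ‖x - y‖ * √s = √‖x-y‖ * √‖x-y‖ * √s := by rw [Real.mul_self_sqrt (norm_nonneg _)]
        _ ≤ √‖x-y‖ * √s * √s := by gcongr
        _ = √‖x-y‖ * s := by rw [mul_assoc, Real.mul_self_sqrt hs.le]
    calc _ ≤ _ := h1
      _ = (B * I2) * (s⁻¹ * ‖x - y‖) := by ring
      _ ≤ (B * (2 * I1 + I2)) * (√‖x - y‖ * (√s)⁻¹) := by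
        gcongr
        linarith
      _ = _ := by ring
  · have h1 : ‖avg W1 h x s - avg W1 h y s‖ ≤ 2 * (B * I1) := by
      refine (norm_sub_le _ _).trans ?_
      have := avg_norm_le gkW1 hB x s
      have := avg_norm_le gkW1 hB y s
      linarith
    have h2 : 1 ≤ √‖x - y‖ * (√s)⁻¹ := by
      rw [← div_eq_mul_inv, one_le_div hss]
      exact Real.sqrt_le_sqrt hxy
    calc _ ≤ _ := h1
      _ ≤ (B * (2 * I1 + I2)) * 1 := by nlinarith [mul_nonneg hB0 hI2]
      _ ≤ (B * (2 * I1 + I2)) * (√‖x - y‖ * (√s)⁻¹) := by gcongr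
      _ = _ := by ring

lemma res_grad {κ : ℝ} (hκ : 0 < κ) {h : Eu m → ℝ} (hc : Continuous h) {B : ℝ}
    (hB : ∀ x, |h x| ≤ B) (x : Eu m) :
    HasFDerivAt (res κ 1 W h) (res κ 0 W1 h x) x := by
  have := res_hasFDerivAt hκ (j := 1) (a := 0) (by norm_num) (by norm_num) gkW gkW1 hasFDerivAt_W
    hc hB (avg_bound0 gkW1 hB) x
  simpa using this

lemma res_hess {κ : ℝ} (hκ : 0 < κ) {h : Eu m → ℝ} (hc : Continuous h) {B : ℝ}
    (hB : ∀ x, |h x| ≤ B) {b : ℝ} (hb : Hol b h) (x : Eu m) :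
    HasFDerivAt (res κ 0 W1 h) (res κ (-1) W2 h x) x := by
  have := res_hasFDerivAt hκ (j := 0) (a := 1/2) (by norm_num) (by norm_num) gkW1 gkW2
    hasFDerivAt_W1 hc hB (avg_hol gkW2 integral_W2 hc hB hb) x
  rwa [zero_sub] at this

lemma res_contDiff {κ : ℝ} (hκ : 0 < κ) {h : Eu m → ℝ} (hc : Continuous h) {B : ℝ}
    (hB : ∀ x, |h x| ≤ B) {b : ℝ} (hb : Hol b h) : ContDiff ℝ 2 (res κ 1 W h) := by
  have e1 : fderiv ℝ (res κ 1 W h) = res κ 0 W1 h := funext fun x => (res_grad hκ hc hB x).fderiv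
  have e2 : fderiv ℝ (res κ 0 W1 h) = res κ (-1) W2 h :=
    funext fun x => (res_hess hκ hc hB hb x).fderiv
  have c1 : ContDiff ℝ 1 (res κ 0 W1 h) := by
    rw [contDiff_one_iff_fderiv]
    refine ⟨fun x => (res_hess hκ hc hB hb x).differentiableAt, ?_⟩
    rw [e2]
    exact res_continuous hκ (a := 1/2) (by norm_num) gkW2 hc hB
      (avg_hol gkW2 integral_W2 hc hB hb)
  have : ContDiff ℝ (1 + 1) (res κ 1 W h) := by
    rw [contDiff_succ_iff_fderiv]
    refine ⟨fun x => (res_grad hκ hc hB x).differentiableAt, by simp, ?_⟩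
    rw [e1]; exact c1
  exact this

lemma res_eq {κ : ℝ} (hκ : 0 < κ) {h : Eu m → ℝ} (hc : Continuous h) {B : ℝ}
    (hB : ∀ x, |h x| ≤ B) {b : ℝ} (hb : Hol b h) (x : Eu m) :
    κ * res κ 1 W h x - (1/2) * lap (res κ 1 W h) x = h x := by
  have e1 : fderiv ℝ (res κ 1 W h) = res κ 0 W1 h := funext fun x => (res_grad hκ hc hB x).fderiv
  rw [lap_eq_trc, e1, (res_hess hκ hc hB hb x).fderiv]
  have i2 := res_integrable hκ (j := -1) (a := 1/2) (by norm_num) gkW2 hc hB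
      (avg_hol gkW2 integral_W2 hc hB hb) x
  have i1 := res_integrable hκ (j := 1) (a := 0) (by norm_num) gkW hc hB (avg_bound0 gkW hB) x
  simp only [smul_eq_mul] at i1
  unfold res
  rw [← (trc m).integral_comp_comm i2]
  have i3 : IntegrableOn (fun s => wt κ (-1) s * avg W3 h x s) (Ioi 0) := by
    have := (trc m).integrable_comp i2
    refine this.congr (Eventually.of_forall fun s => ?_)
    simp [trc_avg hc hB]
  have e3 : ∀ s, trc m (wt κ (-1) s • avg W2 h x s) = wt κ (-1) s * avg W3 h x s := by
    intro s; simp [trc_avg hc hB]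
  simp only [e3, smul_eq_mul]
  have ca : Continuous (fun s => avg W h x s) :=
    (avg_continuous gkW hc hB).comp (continuous_const.prodMk continuous_id)
  have key := integral_Ioi_of_hasDerivAt_of_tendsto (a := 0) (m := 0)
    (f := fun s => Real.exp (-κ * s ^ 2) * avg W h x s)
    (f' := fun s => (1/2) * (wt κ (-1) s * avg W3 h x s) - κ * (wt κ 1 s * avg W h x s))
    (Continuous.continuousWithinAt (by fun_prop)) (fun s hs => ?_) ?_ ?_
  · rw [integral_sub (i3.const_mul _) (Integrable.const_mul i1 _), integral_const_mul,
      integral_const_mul] at key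
    have e4 : avg W h x 0 = h x := by
      unfold avg
      simp only [zero_smul, add_zero, smul_eq_mul]
      rw [integral_const_mul, integral_W, mul_one]
    simp [e4] at key
    linarith
  · have hs : 0 < s := hs
    have d1 : HasDerivAt (fun s => Real.exp (-κ * s ^ 2))
        (Real.exp (-κ * s ^ 2) * (-κ * (2 * s))) s := by
      have := ((hasDerivAt_pow 2 s).const_mul (-κ)).exp
      simpa using this
    refine (d1.mul (avg_hasDerivAt hc hB hs x)).congr_deriv ?_
    unfold wt
    rw [Real.rpow_neg_one, Real.rpow_one]
    ring
  · exact (i3.const_mul _).sub (Integrable.const_mul i1 _)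
  · have t1 : Tendsto (fun s : ℝ => Real.exp (-κ * s ^ 2)) atTop (𝓝 0) := by
      refine Real.tendsto_exp_atBot.comp ?_
      exact (tendsto_pow_atTop (two_ne_zero)).const_mul_atTop_of_neg (neg_neg_of_pos hκ)
    have := t1.zero_mul_isBoundedUnder_le (g := fun s => avg W h x s)
      ⟨B * ∫ z : Eu m, ‖W z‖, by
        rw [eventually_map]
        exact Eventually.of_forall fun s => avg_norm_le gkW hB x s⟩
    exact this

end Res


open Filter Topology MeasureTheory Set
open scoped ZeroAtInfty
set_option linter.unusedSectionVars false
set_option maxSynthPendingDepth 3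

section MaxPrinciple
variable {m : ℕ}

lemma exists_max_of_pos {w : Eu m → ℝ} (hw : Continuous w) (h0 : Tendsto w (cocompact _) (𝓝 0))
    {x : Eu m} (hx : 0 < w x) : ∃ x₀, (∀ y, w y ≤ w x₀) ∧ 0 < w x₀ := by
  obtain ⟨x₀, h⟩ := hw.exists_forall_ge' x
    ((h0.eventually (gt_mem_nhds hx)).mono fun y hy => le_of_lt hy)
  exact ⟨x₀, h, hx.trans_le (h x)⟩

lemma cmpr {u v : Eu m → ℝ} (hu : ContDiff ℝ 2 u) (hv : ContDiff ℝ 2 v)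
    (h0 : Tendsto (fun x => u x - v x) (cocompact _) (𝓝 0))
    {H : (Eu m →L[ℝ] ℝ) → ℝ} {c g₁ g₂ : Eu m → ℝ} {κ δ : ℝ} (hκ : 0 < κ) (hδ : 0 ≤ δ)
    (hc : ∀ x, κ ≤ c x)
    (h1 : ∀ x, c x * u x - (1/2) * lap u x + H (fderiv ℝ u x) ≤ g₁ x)
    (h2 : ∀ x, g₂ x ≤ c x * v x - (1/2) * lap v x + H (fderiv ℝ v x))
    (hg : ∀ x, g₁ x - g₂ x ≤ δ) (x : Eu m) : u x - v x ≤ δ / κ := by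
  by_contra hx
  push Not at hx
  have hx0 : 0 < u x - v x := lt_of_le_of_lt (by positivity) hx
  obtain ⟨x₀, hm, hp⟩ := exists_max_of_pos (hu.continuous.sub hv.continuous) h0 hx0
  obtain ⟨e1, e2⟩ := max_point hu hv (x := x₀) (Eventually.of_forall hm)
  have a1 := h1 x₀
  have a2 := h2 x₀
  rw [e1] at a1
  have a3 := hg x₀
  have a4 := hm x
  have a5 : δ / κ < u x₀ - v x₀ := lt_of_lt_of_le hx a4
  rw [div_lt_iff₀ hκ] at a5
  have a6 : κ * (u x₀ - v x₀) ≤ c x₀ * (u x₀ - v x₀) :=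
    mul_le_mul_of_nonneg_right (hc x₀) hp.le
  nlinarith

lemma fderiv_zero_fun (x : Eu m) : fderiv ℝ (fun _ : Eu m => (0:ℝ)) x = 0 := by simp

lemma lap_zero_fun (x : Eu m) : lap (fun _ : Eu m => (0:ℝ)) x = 0 := by
  rw [lap_eq_trc]; simp

lemma eq_res {κ : ℝ} (hκ : 0 < κ) {v h : Eu m → ℝ} (hv : ContDiff ℝ 2 v)
    (hv0 : Tendsto v (cocompact _) (𝓝 0)) {B b : ℝ} (hB : ∀ x, |h x| ≤ B) (hb : Hol b h)
    (h0 : Tendsto h (cocompact _) (𝓝 0))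
    (he : ∀ x, κ * v x - (1/2) * lap v x = h x) : v = res κ 1 W h := by
  have hc := hb.continuous
  have c2 := res_contDiff hκ hc hB hb
  have e2 := res_eq hκ hc hB hb
  have t2 : Tendsto (res κ 1 W h) (cocompact _) (𝓝 0) :=
    res_tendsto_zero hκ (by norm_num) gkW hc hB h0
  have k1 := cmpr hv c2 (by simpa using hv0.sub t2) (H := fun _ => 0) (c := fun _ => κ)
    (g₁ := h) (g₂ := h) hκ le_rfl (fun _ => le_rfl) (fun x => by rw [he x]; simp)
    (fun x => by rw [e2 x]; simp) (fun x => by simp)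
  have k2 := cmpr c2 hv (by simpa using t2.sub hv0) (H := fun _ => 0) (c := fun _ => κ)
    (g₁ := h) (g₂ := h) hκ le_rfl (fun _ => le_rfl) (fun x => by rw [e2 x]; simp)
    (fun x => by rw [he x]; simp) (fun x => by simp)
  ext x
  have := k1 x
  have := k2 x
  simp only [zero_div] at *
  linarith

end MaxPrinciple

section Existence
variable {m : ℕ}

lemma bounded_of_C0 {F : Type*} [NormedAddCommGroup F] (p : C₀(Eu m, F)) (x : Eu m) :
    ‖p x‖ ≤ ‖p‖ := by
  rw [← ZeroAtInftyContinuousMap.norm_toBCF_eq_norm]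
  exact p.toBCF.norm_coe_le_norm x

lemma C0_dist_le {F : Type*} [NormedAddCommGroup F] {p q : C₀(Eu m, F)} {C : ℝ} (hC : 0 ≤ C)
    (h : ∀ x, ‖p x - q x‖ ≤ C) : dist p q ≤ C := by
  rw [← ZeroAtInftyContinuousMap.dist_toBCF_eq_dist, BoundedContinuousFunction.dist_le hC]
  intro x
  rw [dist_eq_norm]
  exact h x

lemma C0_le_dist {F : Type*} [NormedAddCommGroup F] (p q : C₀(Eu m, F)) (x : Eu m) :
    ‖p x - q x‖ ≤ dist p q := by
  rw [← ZeroAtInftyContinuousMap.dist_toBCF_eq_dist, ← dist_eq_norm]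
  exact BoundedContinuousFunction.dist_coe_le_dist (f := p.toBCF) (g := q.toBCF) x

noncomputable def C1 (m : ℕ) : ℝ := ∫ z : Eu m, ‖W1 z‖

lemma C1_nonneg : 0 ≤ C1 m := integral_nonneg fun _ => norm_nonneg _

lemma res_W1_le {κ : ℝ} (hκ : 0 < κ) {h : Eu m → ℝ} {B : ℝ} (hB : ∀ x, |h x| ≤ B) (x : Eu m) :
    ‖res κ 0 W1 h x‖ ≤ B * C1 m * √(Real.pi / κ) := by
  have := res_norm_le hκ (j := 0) (a := 0) (by norm_num) (avg_bound0 gkW1 hB) x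
  rwa [add_zero, J_zero] at this

variable {H : (Eu m →L[ℝ] ℝ) → ℝ} {Hb Λ : ℝ}

lemma exists_S (hH0 : H 0 = 0) (hHb : ∀ p, |H p| ≤ Hb) (hΛ : 0 ≤ Λ)
    (hHΛ : ∀ p q, |H p - H q| ≤ Λ * ‖p - q‖)
    {κ : ℝ} (hκ : 0 < κ) (hsmall : Λ * C1 m * √(Real.pi / κ) ≤ 1/2)
    (g : C₀(Eu m, ℝ)) : ∃ u : C₀(Eu m, ℝ), Differentiable ℝ u ∧
      (∀ A, (∀ x, |g x| ≤ A) → ∀ x, ‖fderiv ℝ u x‖ ≤ (A + Hb) * C1 m * √(Real.pi / κ)) ∧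
      ∀ b, Hol b g → ContDiff ℝ 2 u ∧
        ∀ x, κ * u x - (1/2) * lap u x + H (fderiv ℝ u x) = g x := by
  have hHc : Continuous H := by
    have : LipschitzWith ⟨Λ, hΛ⟩ H := LipschitzWith.of_dist_le_mul fun p q => by
      rw [Real.dist_eq, dist_eq_norm]; exact hHΛ p q
    exact this.continuous
  -- source term
  let src : C₀(Eu m, Eu m →L[ℝ] ℝ) → Eu m → ℝ := fun p x => g x - H (p x)
  have src_c : ∀ p, Continuous (src p) := fun p =>
    (map_continuous g).sub (hHc.comp (map_continuous p))
  have src_b : ∀ A, (∀ x, |g x| ≤ A) → ∀ p x, |src p x| ≤ A + Hb := fun A hA p x =>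
    (abs_sub _ _).trans (add_le_add (hA x) (hHb _))
  have g_b : ∀ x, |g x| ≤ ‖g‖ := fun x => bounded_of_C0 g x
  have src_0 : ∀ p, Tendsto (src p) (cocompact _) (𝓝 0) := fun p => by
    have h1 := (hHc.tendsto 0).comp (zero_at_infty p)
    rw [hH0] at h1
    simpa using (zero_at_infty g).sub h1
  let T : C₀(Eu m, Eu m →L[ℝ] ℝ) → C₀(Eu m, Eu m →L[ℝ] ℝ) := fun p =>
    { toFun := res κ 0 W1 (src p)
      continuous_toFun := (res_hol hκ (src_c p) (src_b _ g_b p)).continuous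
      zero_at_infty' := res_tendsto_zero hκ (by norm_num) gkW1 (src_c p) (src_b _ g_b p) (src_0 p) }
  have hT : ∀ p x, T p x = res κ 0 W1 (src p) x := fun p x => rfl
  have hcon : ContractingWith (1/2) T := by
    refine ⟨by rw [← NNReal.coe_lt_coe]; norm_num, LipschitzWith.of_dist_le_mul fun p q => ?_⟩
    have hd := dist_nonneg (x := p) (y := q)
    refine C0_dist_le (by positivity) fun x => ?_
    rw [hT, hT, ← res_sub hκ (by norm_num) gkW1 (src_c p) (src_c q) (src_b _ g_b p)
      (src_b _ g_b q)]
    refine (res_W1_le hκ (B := Λ * dist p q) (fun y => ?_) x).trans ?_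
    · have e : src p y - src q y = -(H (p y) - H (q y)) := by simp only [src]; ring
      rw [e, abs_neg]
      exact (hHΛ _ _).trans (mul_le_mul_of_nonneg_left (C0_le_dist p q y) hΛ)
    · push_cast
      nlinarith
  obtain ⟨p, hp⟩ : ∃ p, T p = p := ⟨_, hcon.fixedPoint_isFixedPt⟩
  have hpx : ∀ x, p x = res κ 0 W1 (src p) x := fun x => by
    conv_lhs => rw [← hp]
    rfl
  have hgr := res_grad hκ (src_c p) (src_b _ g_b p)
  have hfd : ∀ x, fderiv ℝ (res κ 1 W (src p)) x = p x := fun x => by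
    rw [(hgr x).fderiv, hpx]
  let u : C₀(Eu m, ℝ) :=
    { toFun := res κ 1 W (src p)
      continuous_toFun := by
        have : Differentiable ℝ (res κ 1 W (src p)) := fun x => (hgr x).differentiableAt
        exact this.continuous
      zero_at_infty' := res_tendsto_zero hκ (by norm_num) gkW (src_c p) (src_b _ g_b p) (src_0 p) }
  have hu : (u : Eu m → ℝ) = res κ 1 W (src p) := rfl
  refine ⟨u, ?_, ?_, ?_⟩
  · rw [hu]; exact fun x => (hgr x).differentiableAt
  · intro A hA x
    rw [hu, hfd, hpx]
    exact res_W1_le hκ (src_b A hA p) x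
  · intro b hb
    have hph := res_hol hκ (src_c p) (src_b _ g_b p)
    set bp := (‖g‖ + Hb) * (2 * (∫ z : Eu m, ‖W1 z‖) + ∫ z : Eu m, ‖W2 z‖) * J κ (-(1/2))
    have hs : Hol (b + Λ * bp) (src p) := by
      intro x y
      have e : src p x - src p y = (g x - g y) - (H (p x) - H (p y)) := by simp only [src]; ring
      rw [e]
      refine (norm_sub_le _ _).trans ?_
      have h1 := hb x y
      have h2 := hHΛ (p x) (p y)
      have h3 := hph x y
      rw [← hpx, ← hpx] at h3
      rw [← Real.norm_eq_abs] at h2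
      nlinarith
    rw [hu]
    refine ⟨res_contDiff hκ (src_c p) (src_b _ g_b p) hs, fun x => ?_⟩
    rw [res_eq hκ (src_c p) (src_b _ g_b p) hs, hfd]
    simp [src]

lemma hol_of_lip {u : Eu m → ℝ} {L M : ℝ} (hM : ∀ x, |u x| ≤ M)
    (hd : Differentiable ℝ u) (hL : ∀ x, ‖fderiv ℝ u x‖ ≤ L) : Hol (L + 2 * M) u := by
  intro x y
  have hL0 : 0 ≤ L := (norm_nonneg _).trans (hL 0)
  have hM0 : 0 ≤ M := (abs_nonneg _).trans (hM 0)
  have hs := Real.sqrt_nonneg ‖x - y‖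
  rcases le_total ‖x - y‖ 1 with h | h
  · have h1 : ‖u x - u y‖ ≤ L * ‖x - y‖ :=
      Convex.norm_image_sub_le_of_norm_fderiv_le (𝕜 := ℝ) (fun z _ => hd z) (fun z _ => hL z)
        convex_univ (mem_univ _) (mem_univ _)
    have h2 : ‖x - y‖ ≤ √‖x - y‖ := by
      have h3 : √‖x - y‖ ≤ 1 := by simpa using Real.sqrt_le_sqrt h
      have h4 := Real.mul_self_sqrt (norm_nonneg (x - y))
      nlinarith
    nlinarith [mul_le_mul_of_nonneg_left h2 hL0, mul_nonneg hM0 hs]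
  · have h1 : ‖u x - u y‖ ≤ 2 * M := by
      refine (norm_sub_le _ _).trans ?_
      have := hM x; have := hM y
      rw [← Real.norm_eq_abs] at *
      linarith
    have h2 : 1 ≤ √‖x - y‖ := by simpa using Real.sqrt_le_sqrt h
    nlinarith [mul_le_mul_of_nonneg_left h2 hM0, mul_nonneg hL0 hs]

lemma hol_mul {u v : Eu m → ℝ} {a b A B : ℝ} (hu : Hol a u) (hv : Hol b v) (hA : ∀ x, |u x| ≤ A)
    (hB : ∀ x, |v x| ≤ B) : Hol (A * b + B * a) (fun x => u x * v x) := by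
  intro x y
  have e : u x * v x - u y * v y = u x * (v x - v y) + v y * (u x - u y) := by ring
  rw [e]
  refine (norm_add_le _ _).trans ?_
  rw [norm_mul, norm_mul]
  have h1 := mul_le_mul (hA x) (hv x y) (norm_nonneg _) ((abs_nonneg _).trans (hA 0))
  have h2 := mul_le_mul (hB y) (hu x y) (norm_nonneg _) ((abs_nonneg _).trans (hB 0))
  rw [← Real.norm_eq_abs] at h1 h2
  nlinarith

lemma hol_add {u v : Eu m → ℝ} {a b : ℝ} (hu : Hol a u) (hv : Hol b v) :
    Hol (a + b) (fun x => u x + v x) := by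
  intro x y
  have e : u x + v x - (u y + v y) = (u x - u y) + (v x - v y) := by ring
  rw [e]
  refine (norm_add_le _ _).trans ?_
  have := hu x y
  have := hv x y
  nlinarith

lemma hol_const (c : ℝ) : Hol 0 (fun _ : Eu m => c) := by
  intro x y; simp

lemma exists_fix (hH0 : H 0 = 0) (hHb : ∀ p, |H p| ≤ Hb) (hΛ : 0 ≤ Λ)
    (hHΛ : ∀ p q, |H p - H q| ≤ Λ * ‖p - q‖)
    {κ : ℝ} (hκ : 0 < κ) (hκ1 : κ ≤ 1) {k : Eu m → ℝ} (hk0 : ∀ x, 0 ≤ k x) (hk1 : ∀ x, k x ≤ 1)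
    {bk : ℝ} (hbk : Hol bk k) (g : C₀(Eu m, ℝ)) {bg A : ℝ} (hbg : Hol bg g) (hA : ∀ x, |g x| ≤ A) :
    ∃ u : C₀(Eu m, ℝ), ContDiff ℝ 2 u ∧
        ∀ x, (κ + k x) * u x - (1/2) * lap u x + H (fderiv ℝ u x) = g x := by
  obtain ⟨κ₀, hκ₀, hsmall⟩ : ∃ κ₀ : ℝ, 3 ≤ κ₀ ∧ Λ * C1 m * √(Real.pi / κ₀) ≤ 1/2 := by
    have t : Tendsto (fun κ : ℝ => Λ * C1 m * √(Real.pi / κ)) atTop (𝓝 (Λ * C1 m * √0)) :=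
      ((tendsto_const_nhds.div_atTop tendsto_id).sqrt).const_mul _
    rw [Real.sqrt_zero, mul_zero] at t
    obtain ⟨κ₀, h1, h2⟩ := ((t.eventually (gt_mem_nhds (show (0:ℝ) < 1/2 by norm_num))).and
      (eventually_ge_atTop 3)).exists
    exact ⟨κ₀, h2, h1.le⟩
  have hκ₀p : 0 < κ₀ := by linarith
  choose S hSd hSg hSe using exists_S hH0 hHb hΛ hHΛ hκ₀p hsmall
  have hA0 : 0 ≤ A := (abs_nonneg _).trans (hA 0)
  have hkc : Continuous k := hbk.continuous
  set M := A / κ with hMdef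
  have hM0 : 0 ≤ M := by positivity
  have hMκ : κ * M = A := by rw [hMdef]; field_simp
  set L0 := (κ₀ * M + Hb) * C1 m * √(Real.pi / κ₀) with hL0
  have hc0 : ∀ x, 0 ≤ κ₀ - κ - k x := fun x => by have := hk1 x; linarith
  have hc1 : ∀ x, κ₀ - κ - k x ≤ κ₀ - κ := fun x => by have := hk0 x; linarith
  -- the modified source
  let gh : C₀(Eu m, ℝ) → C₀(Eu m, ℝ) := fun u =>
    { toFun := fun x => g x + (κ₀ - κ - k x) * u x
      continuous_toFun := by
        have := map_continuous g
        have := map_continuous u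
        fun_prop
      zero_at_infty' := by
        have h1 : Tendsto (fun x => (κ₀ - κ - k x) * u x) (cocompact _) (𝓝 0) := by
          refine squeeze_zero_norm (fun x => ?_)
            (show Tendsto (fun x => (κ₀ - κ) * ‖u x‖) (cocompact _) (𝓝 0) by
              simpa using (zero_at_infty u).norm.const_mul (κ₀ - κ))
          rw [norm_mul, Real.norm_of_nonneg (hc0 x)]
          exact mul_le_mul_of_nonneg_right (hc1 x) (norm_nonneg _)
        simpa using (zero_at_infty g).add h1 }
  have hgh : ∀ u x, gh u x = g x + (κ₀ - κ - k x) * u x := fun u x => rfl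
  let Z : Set C₀(Eu m, ℝ) := {u | (∀ x, |u x| ≤ M) ∧ Hol (L0 + 2 * M) u}
  have hchol : Hol bk (fun x => κ₀ - κ - k x) := by
    intro x y
    have e : κ₀ - κ - k x - (κ₀ - κ - k y) = -(k x - k y) := by ring
    rw [e, norm_neg]; exact hbk x y
  have hcb : ∀ x, |κ₀ - κ - k x| ≤ κ₀ - κ := fun x => by
    rw [abs_of_nonneg (hc0 x)]; exact hc1 x
  have hghhol : ∀ u ∈ Z, Hol (bg + ((κ₀ - κ) * (L0 + 2 * M) + M * bk)) (gh u) := fun u hu =>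
    hol_add hbg (hol_mul hchol hu.2 hcb hu.1)
  have hghb : ∀ u ∈ Z, ∀ x, |gh u x| ≤ κ₀ * M := by
    intro u hu x
    rw [hgh]
    refine (abs_add_le _ _).trans ?_
    rw [abs_mul]
    have h1 := mul_le_mul (hcb x) (hu.1 x) (abs_nonneg _) (by linarith)
    have h2 := hA x
    nlinarith
  have hmaps : MapsTo (fun u => S (gh u)) Z Z := by
    intro u hu
    have hb := hghb u hu
    obtain ⟨c2, he⟩ := hSe (gh u) _ (hghhol u hu)
    have hz : ∀ x, κ₀ * (fun _ : Eu m => (0:ℝ)) x - (1/2) * lap (fun _ : Eu m => (0:ℝ)) x +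
        H (fderiv ℝ (fun _ : Eu m => (0:ℝ)) x) = 0 := fun x => by
      rw [lap_zero_fun, fderiv_zero_fun, hH0]; ring
    have k1 := cmpr c2 (contDiff_const (c := (0:ℝ))) (by simpa using zero_at_infty (S (gh u)))
      (H := H) (c := fun _ => κ₀) (g₁ := gh u) (g₂ := fun _ => 0) (δ := κ₀ * M) hκ₀p (by positivity)
      (fun _ => le_rfl) (fun x => (he x).le) (fun x => (hz x).ge)
      (fun x => by have := (abs_le.1 (hb x)).2; linarith)
    have k2 := cmpr (contDiff_const (c := (0:ℝ))) c2
      (by simpa using (zero_at_infty (S (gh u))).neg)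
      (H := H) (c := fun _ => κ₀) (g₂ := gh u) (g₁ := fun _ => 0) (δ := κ₀ * M) hκ₀p (by positivity)
      (fun _ => le_rfl) (fun x => (hz x).le) (fun x => (he x).ge)
      (fun x => by have := (abs_le.1 (hb x)).1; linarith)
    have hbd : ∀ x, |S (gh u) x| ≤ M := fun x => by
      have := k1 x
      have := k2 x
      rw [mul_div_cancel_left₀ _ hκ₀p.ne'] at *
      rw [abs_le]; constructor <;> linarith
    exact ⟨hbd, hol_of_lip hbd (hSd _) (hSg _ _ hb)⟩
  have hclosed : IsClosed Z := by
    have hev : ∀ x : Eu m, Continuous (fun u : C₀(Eu m, ℝ) => u x) := fun x => by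
      have : LipschitzWith 1 (fun u : C₀(Eu m, ℝ) => u x) :=
        LipschitzWith.of_dist_le_mul fun p q => by
          rw [dist_eq_norm]; simpa using C0_le_dist p q x
      exact this.continuous
    have : Z = (⋂ x, {u | |u x| ≤ M}) ∩ ⋂ x, ⋂ y, {u | ‖u x - u y‖ ≤ (L0 + 2 * M) * √‖x - y‖} := by
      ext u; simp [Z, Hol]
    rw [this]
    refine IsClosed.inter (isClosed_iInter fun x => ?_)
      (isClosed_iInter fun x => isClosed_iInter fun y => ?_)
    · exact isClosed_le (hev x).abs continuous_const
    · exact isClosed_le ((hev x).sub (hev y)).norm continuous_const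
  have hq0 : 0 ≤ (κ₀ - κ) / κ₀ := div_nonneg (by linarith) hκ₀p.le
  have hcontr : ContractingWith ⟨(κ₀ - κ) / κ₀, hq0⟩ (hmaps.restrict _ Z Z) := by
    refine ⟨?_, LipschitzWith.of_dist_le_mul fun u v => ?_⟩
    · apply NNReal.coe_lt_coe.1
      change (κ₀ - κ) / κ₀ < 1
      rw [div_lt_one hκ₀p]; linarith
    · obtain ⟨u, hu⟩ := u
      obtain ⟨v, hv⟩ := v
      change dist (S (gh u)) (S (gh v)) ≤ (κ₀ - κ) / κ₀ * dist u v
      have hd := dist_nonneg (x := u) (y := v)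
      have main : ∀ u ∈ Z, ∀ v ∈ Z, ∀ x, S (gh u) x - S (gh v) x ≤
          (κ₀ - κ) / κ₀ * dist u v := by
        intro u hu v hv x
        obtain ⟨c2, he⟩ := hSe (gh u) _ (hghhol u hu)
        obtain ⟨c2', he'⟩ := hSe (gh v) _ (hghhol v hv)
        have hd := dist_nonneg (x := u) (y := v)
        have k1 := cmpr c2 c2'
          (by simpa using (zero_at_infty (S (gh u))).sub (zero_at_infty (S (gh v))))
          (H := H) (c := fun _ => κ₀) (g₁ := gh u) (g₂ := gh v) (δ := (κ₀ - κ) * dist u v) hκ₀p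
          (mul_nonneg (by linarith) hd)
          (fun _ => le_rfl) (fun x => (he x).le) (fun x => (he' x).ge)
          (fun x => ?_) x
        · rw [mul_div_right_comm] at k1; exact k1
        · rw [hgh, hgh]
          have h1 := C0_le_dist u v x
          have h3 := (le_abs_self _).trans h1
          calc _ = (κ₀ - κ - k x) * (u x - v x) := by ring
            _ ≤ (κ₀ - κ - k x) * dist u v := mul_le_mul_of_nonneg_left h3 (hc0 x)
            _ ≤ _ := mul_le_mul_of_nonneg_right (hc1 x) hd
      refine C0_dist_le (by positivity) fun x => ?_
      rw [Real.norm_eq_abs, abs_le]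
      have h1 := main u hu v hv x
      have h2 := main v hv u hu x
      rw [dist_comm v u] at h2
      constructor <;> linarith
  have h0Z : (0 : C₀(Eu m, ℝ)) ∈ Z := by
    have hL00 : 0 ≤ L0 := by
      have := (abs_nonneg _).trans (hHb 0)
      have := C1_nonneg (m := m)
      positivity
    refine ⟨fun x => by simpa using hM0, fun x y => ?_⟩
    simp only [ZeroAtInftyContinuousMap.coe_zero, Pi.zero_apply, sub_self, norm_zero]
    positivity
  obtain ⟨u, huZ, hfix, -⟩ := ContractingWith.exists_fixedPoint' hclosed.isComplete hmaps hcontr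
    h0Z (edist_ne_top _ _)
  have hfix : S (gh u) = u := hfix
  obtain ⟨c2, he⟩ := hSe (gh u) _ (hghhol u huZ)
  rw [hfix] at c2 he
  refine ⟨u, c2, fun x => ?_⟩
  have := he x
  rw [hgh] at this
  linarith

end Existence


open Filter Topology MeasureTheory Set
set_option linter.unusedSectionVars false
set_option maxSynthPendingDepth 3

section GLip
variable {m : ℕ}

lemma exists_basis {e : Eu m} (he : ‖e‖ = 1) :
    ∃ b : OrthonormalBasis (Fin m) ℝ (Eu m), ∃ i, b i = e := by
  have hm : 0 < m := by
    rcases Nat.eq_zero_or_pos m with h | h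
    · subst h
      have : e = 0 := Subsingleton.elim _ _
      rw [this] at he; simp at he
    · exact h
  have ho : Orthonormal ℝ (({⟨0, hm⟩} : Set (Fin m)).domRestrict (fun _ => e)) := by
    refine ⟨fun i => he, fun i j hij => ?_⟩
    exact absurd (Subsingleton.elim i j) hij
  obtain ⟨b, hb⟩ := ho.exists_orthonormalBasis_extension_of_card_eq (by simp)
  exact ⟨b, ⟨0, hm⟩, hb _ rfl⟩

lemma glip {u : Eu m → ℝ} (hu : ContDiff ℝ 2 u) (h0 : Tendsto u (cocompact _) (𝓝 0))
    {H : (Eu m →L[ℝ] ℝ) → ℝ} {e : Eu m → ℝ} {M A : ℝ} (hM : ∀ x, |u x| ≤ M)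
    (hA : ∀ x, |e x| ≤ A) (he : ∀ x, -(1/2) * lap u x + H (fderiv ℝ u x) = e x) (x : Eu m) :
    ‖fderiv ℝ u x‖ ≤ 2 * M + A + 2 := by
  have hM0 : 0 ≤ M := (abs_nonneg _).trans (hM 0)
  have hA0 : 0 ≤ A := (abs_nonneg _).trans (hA 0)
  set L := 2 * M + A + 2 with hL
  set B := A + 1 with hB
  have key : ∀ x y : Eu m, ‖x - y‖ ≤ 1 → u x - u y ≤ L * ‖x - y‖ - B * ‖x - y‖ ^ 2 := by
    by_contra hcon
    push Not at hcon
    obtain ⟨x₁, y₁, hr1, hΦ1⟩ := hcon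
    let Φ : Eu m × Eu m → ℝ := fun p =>
      u p.1 - u p.2 - (L * ‖p.1 - p.2‖ - B * ‖p.1 - p.2‖ ^ 2)
    have hΦc : Continuous Φ := by
      have := hu.continuous
      fun_prop
    set δ := Φ (x₁, y₁) with hδ
    have hδ0 : 0 < δ := by simp only [hδ, Φ]; linarith
    have hω : ∀ r : ℝ, 0 ≤ r → r ≤ 1 → 0 ≤ L * r - B * r ^ 2 := by
      intro r hr0 hr1
      have : r ^ 2 ≤ r := by nlinarith
      nlinarith
    obtain ⟨ρ, hρ⟩ : ∃ ρ : ℝ, ∀ x : Eu m, ρ < ‖x‖ → |u x| < δ / 2 := by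
      have h1 : ∀ᶠ x in cocompact (Eu m), |u x| < δ / 2 := by
        have := h0.abs
        rw [abs_zero] at this
        exact this.eventually (gt_mem_nhds (by positivity))
      rw [cocompact_eq_comap, eventually_comap] at h1
      obtain ⟨ρ, h2⟩ := (eventually_atTop.1 h1)
      exact ⟨ρ, fun x hx => h2 _ hx.le x rfl⟩
    have hfar : ∀ x y : Eu m, ‖x - y‖ ≤ 1 → δ ≤ Φ (x, y) → ‖x‖ ≤ ρ + 1 ∧ ‖y‖ ≤ ρ + 1 := by
      intro x y hxy hd
      have h1 := hω _ (norm_nonneg (x - y)) hxy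
      have h2 : δ ≤ u x - u y := by simp only [Φ] at hd; linarith
      have h3 : ‖x‖ ≤ ‖y‖ + ‖x - y‖ := norm_le_norm_add_norm_sub' x y
      have h4 : ‖y‖ ≤ ‖x‖ + ‖x - y‖ := norm_le_norm_add_norm_sub x y
      by_contra hne
      have hx : ρ < ‖x‖ := by
        by_contra hx; exact hne ⟨by linarith, by linarith⟩
      have hy : ρ < ‖y‖ := by
        by_contra hy; exact hne ⟨by linarith, by linarith⟩
      have a := abs_lt.1 (hρ x hx)
      have b := abs_lt.1 (hρ y hy)
      linarith [a.1, a.2, b.1, b.2]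
    let K : Set (Eu m × Eu m) := (Metric.closedBall 0 (ρ+1) ×ˢ Metric.closedBall 0 (ρ+1)) ∩
      {p | ‖p.1 - p.2‖ ≤ 1}
    have hK : IsCompact K := by
      refine ((isCompact_closedBall _ _).prod (isCompact_closedBall _ _)).inter_right ?_
      exact isClosed_le (by fun_prop) continuous_const
    have h1K : (x₁, y₁) ∈ K := by
      have := hfar x₁ y₁ hr1 le_rfl
      refine ⟨⟨?_, ?_⟩, hr1⟩
      · simpa using this.1
      · simpa using this.2
    obtain ⟨⟨x, y⟩, hpK, hpmax⟩ := hK.exists_isMaxOn ⟨_, h1K⟩ hΦc.continuousOn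
    have hpδ : δ ≤ Φ (x, y) := hpmax h1K
    have hglob : ∀ x' y' : Eu m, ‖x' - y'‖ ≤ 1 → Φ (x', y') ≤ Φ (x, y) := by
      intro x' y' h
      by_contra hlt
      push Not at hlt
      have := hfar x' y' h (hpδ.trans hlt.le)
      refine absurd (hpmax (a := (x', y')) ⟨⟨?_, ?_⟩, h⟩) (not_le.2 hlt)
      · simpa using this.1
      · simpa using this.2
    have hxy1 : ‖x - y‖ ≤ 1 := hpK.2
    have hr0 : 0 < ‖x - y‖ := by
      by_contra h
      have h0 : x - y = 0 := by
        rw [← norm_eq_zero]; exact le_antisymm (not_lt.1 h) (norm_nonneg _)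
      have : x = y := sub_eq_zero.1 h0
      subst this
      simp [Φ] at hpδ
      linarith
    have hr1 : ‖x - y‖ < 1 := by
      refine lt_of_le_of_ne hxy1 fun h => ?_
      have a := abs_le.1 (hM x)
      have b := abs_le.1 (hM y)
      simp only [Φ, h] at hpδ
      rw [hL, hB] at hpδ
      linarith [a.1, a.2, b.1, b.2]
    set r := ‖x - y‖ with hr
    -- parallel directions
    have par : ∀ ξ : Eu m, fderiv ℝ u x ξ - fderiv ℝ u y ξ = 0 ∧
        fderiv ℝ (fderiv ℝ u) x ξ ξ - fderiv ℝ (fderiv ℝ u) y ξ ξ ≤ 0 := by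
      intro ξ
      refine doubling_line hu hu x y ξ ξ (G := fun _ => 0) (G' := fun _ => 0) (c := 0)
        (Eventually.of_forall fun t => hasDerivAt_const _ _) (hasDerivAt_const _ _) ?_
      refine Eventually.of_forall fun t => ?_
      have e1 : x + t • ξ - (y + t • ξ) = x - y := by abel
      have := hglob (x + t • ξ) (y + t • ξ) (by rw [e1]; exact hxy1)
      simp only [Φ, e1] at this
      simp only [zero_smul, add_zero, sub_zero]
      linarith
    let ee : Eu m := r⁻¹ • (x - y)
    have hee : ‖ee‖ = 1 := by
      simp only [ee, norm_smul, norm_inv, Real.norm_of_nonneg hr0.le, ← hr]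
      exact inv_mul_cancel₀ hr0.ne'
    have hxe : x - y = r • ee := by
      simp only [ee, smul_smul, mul_inv_cancel₀ hr0.ne', one_smul]
    have anti : fderiv ℝ (fderiv ℝ u) x ee ee - fderiv ℝ (fderiv ℝ u) y ee ee ≤ -8 * B := by
      have := doubling_line hu hu x y ee (-ee)
        (G := fun t => L * (r + 2 * t) - B * (r + 2 * t) ^ 2)
        (G' := fun t => L * 2 - B * (2 * (r + 2 * t) * 2)) (c := -8 * B)
        (Eventually.of_forall fun t => ?_) ?_ ?_
      · simpa using this.2
      · have d1 : HasDerivAt (fun t : ℝ => r + 2 * t) 2 t := by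
          simpa using ((hasDerivAt_id t).const_mul 2).const_add r
        refine ((d1.const_mul L).sub ((d1.pow 2).const_mul B)).congr_deriv ?_
        simp
      · have d1 : HasDerivAt (fun t : ℝ => r + 2 * t) 2 0 := by
          simpa using ((hasDerivAt_id (0:ℝ)).const_mul 2).const_add r
        refine ((hasDerivAt_const _ (L * 2)).sub
          (((d1.const_mul 2).mul_const 2).const_mul B)).congr_deriv ?_
        ring
      · have hev : ∀ᶠ t : ℝ in 𝓝 0, 0 < r + 2 * t ∧ r + 2 * t < 1 := by
          have hc : Continuous (fun t : ℝ => r + 2 * t) := by fun_prop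
          have ht := hc.tendsto 0
          simp only [mul_zero, add_zero] at ht
          exact (ht.eventually (lt_mem_nhds hr0)).and (ht.eventually (gt_mem_nhds hr1))
        filter_upwards [hev] with t ht
        have e1 : x + t • ee - (y + t • (-ee)) = (r + 2 * t) • ee := by
          have : x + t • ee - (y + t • (-ee)) = (x - y) + (2 * t) • ee := by module
          rw [this, hxe]; module
        have e2 : ‖x + t • ee - (y + t • (-ee))‖ = r + 2 * t := by
          rw [e1, norm_smul, hee, mul_one, Real.norm_of_nonneg ht.1.le]
        have := hglob (x + t • ee) (y + t • (-ee)) (by rw [e2]; exact ht.2.le)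
        simp only [Φ, e2] at this
        simp only [zero_smul, add_zero, mul_zero]
        rw [← hr] at this
        linarith
    obtain ⟨b, i, hbi⟩ := exists_basis hee
    have hD : fderiv ℝ u x = fderiv ℝ u y := by
      ext ξ
      have := (par ξ).1
      linarith
    have hlap : lap u x - lap u y ≤ -8 * B := by
      rw [lap_eq_basis u x b, lap_eq_basis u y b, ← Finset.sum_sub_distrib]
      have h1 : ∑ j, (fderiv ℝ (fderiv ℝ u) x (b j) (b j) - fderiv ℝ (fderiv ℝ u) y (b j) (b j))
          ≤ ∑ j, (if j = i then -8 * B else 0) := by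
        refine Finset.sum_le_sum fun j _ => ?_
        split_ifs with hj
        · rw [hj, hbi]; exact anti
        · exact (par (b j)).2
      simpa using h1
    have ex := he x
    have ey := he y
    rw [hD] at ex
    have a := abs_le.1 (hA x)
    have b' := abs_le.1 (hA y)
    linarith [a.1, a.2, b'.1, b'.2]
  have hL0 : 0 ≤ L := by positivity
  refine (hu.differentiable (by norm_num) x).hasFDerivAt.le_of_lip' hL0 ?_
  filter_upwards [Metric.ball_mem_nhds x one_pos] with y hy
  have hy : ‖y - x‖ < 1 := by simpa [dist_eq_norm] using hy
  have k1 := key y x hy.le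
  have k2 := key x y (by rw [norm_sub_rev]; exact hy.le)
  rw [norm_sub_rev x y] at k2
  have hB0 : 0 ≤ B := by positivity
  have := mul_nonneg hB0 (sq_nonneg ‖y - x‖)
  rw [Real.norm_eq_abs, abs_le]
  constructor <;> linarith

end GLip


open Filter Topology MeasureTheory Set
open scoped ZeroAtInfty
set_option linter.unusedSectionVars false
set_option maxSynthPendingDepth 3

section Tools
variable {m : ℕ}

lemma rpow_sub_le {θ a b : ℝ} (hθ : 1 ≤ θ) (ha : 0 ≤ a) (hab : a ≤ b) :
    b ^ θ - a ^ θ ≤ θ * b ^ (θ - 1) * (b - a) := by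
  rcases (ha.trans hab).eq_or_lt with h | hb
  · have h2 : a = 0 := le_antisymm (h ▸ hab) ha
    subst h2; rw [← h]; simp
  have h1 := one_add_mul_self_le_rpow_one_add (s := a / b - 1)
    (by have : 0 ≤ a / b := by positivity
        linarith) hθ
  have h2 : (1 + (a / b - 1)) ^ θ = a ^ θ / b ^ θ := by
    rw [add_sub_cancel, Real.div_rpow ha hb.le]
  rw [h2] at h1
  have h3 : b ^ θ = b ^ (θ - 1) * b := by
    rw [← Real.rpow_add_one hb.ne']; simp
  have h4 : 0 < b ^ θ := Real.rpow_pos_of_pos hb _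
  have h5 : (1 + θ * (a / b - 1)) * b ^ θ ≤ a ^ θ := by
    rwa [le_div_iff₀ h4] at h1
  have h6 : (a / b - 1) * b ^ θ = b ^ (θ - 1) * (a - b) := by
    rw [h3]; field_simp
  nlinarith

lemma abs_rpow_sub_le {θ a b c : ℝ} (hθ : 1 ≤ θ) (ha : 0 ≤ a) (hb : 0 ≤ b) (hac : a ≤ c)
    (hbc : b ≤ c) : |b ^ θ - a ^ θ| ≤ θ * c ^ (θ - 1) * |b - a| := by
  wlog hab : a ≤ b generalizing a b
  · have := this hb ha hbc hac (le_of_not_ge hab)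
    rwa [abs_sub_comm, abs_sub_comm a b] at this
  have h1 := rpow_sub_le hθ ha hab
  rw [abs_of_nonneg (sub_nonneg.2 (Real.rpow_le_rpow ha hab (by linarith))),
    abs_of_nonneg (sub_nonneg.2 hab)]
  refine h1.trans ?_
  have : b ^ (θ - 1) ≤ c ^ (θ - 1) := Real.rpow_le_rpow hb hbc (by linarith)
  have h2 : 0 ≤ b - a := by linarith
  gcongr

/-- The truncated Hamiltonian. -/
noncomputable def HT (m : ℕ) (θ n : ℝ) (p : Eu m →L[ℝ] ℝ) : ℝ := (1/θ) * (min ‖p‖ n) ^ θ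

lemma HT_zero {θ n : ℝ} (hθ : 1 < θ) (hn : 0 ≤ n) : HT m θ n 0 = 0 := by
  unfold HT
  rw [norm_zero, min_eq_left hn, Real.zero_rpow (by linarith)]; simp

lemma HT_nonneg {θ n : ℝ} (hθ : 1 < θ) (hn : 0 ≤ n) (p : Eu m →L[ℝ] ℝ) : 0 ≤ HT m θ n p := by
  unfold HT
  have : 0 ≤ min ‖p‖ n := le_min (norm_nonneg _) hn
  positivity

lemma HT_le {θ n : ℝ} (hθ : 1 < θ) (hn : 0 ≤ n) (p : Eu m →L[ℝ] ℝ) :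
    HT m θ n p ≤ (1/θ) * ‖p‖ ^ θ := by
  unfold HT
  have : 0 ≤ min ‖p‖ n := le_min (norm_nonneg _) hn
  have := Real.rpow_le_rpow this (min_le_left ‖p‖ n) (by linarith : 0 ≤ θ)
  gcongr

lemma HT_bdd {θ n : ℝ} (hθ : 1 < θ) (hn : 0 ≤ n) (p : Eu m →L[ℝ] ℝ) :
    |HT m θ n p| ≤ (1/θ) * n ^ θ := by
  rw [abs_of_nonneg (HT_nonneg hθ hn p)]
  unfold HT
  have : 0 ≤ min ‖p‖ n := le_min (norm_nonneg _) hn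
  have := Real.rpow_le_rpow this (min_le_right ‖p‖ n) (by linarith : 0 ≤ θ)
  gcongr

lemma HT_lip {θ n : ℝ} (hθ : 1 < θ) (hn : 0 ≤ n) (p q : Eu m →L[ℝ] ℝ) :
    |HT m θ n p - HT m θ n q| ≤ n ^ (θ - 1) * ‖p - q‖ := by
  unfold HT
  have hp : 0 ≤ min ‖p‖ n := le_min (norm_nonneg _) hn
  have hq : 0 ≤ min ‖q‖ n := le_min (norm_nonneg _) hn
  have h1 := abs_rpow_sub_le hθ.le hq hp (min_le_right _ n) (min_le_right _ n)
  have h2 : |min ‖p‖ n - min ‖q‖ n| ≤ ‖p - q‖ :=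
    (abs_min_sub_min_le_max _ _ _ _).trans (by simpa using abs_norm_sub_norm_le p q)
  rw [← mul_sub, abs_mul, abs_of_pos (by positivity : 0 < 1/θ)]
  have h3 : 0 ≤ n ^ (θ - 1) := by positivity
  calc (1/θ) * |min ‖p‖ n ^ θ - min ‖q‖ n ^ θ|
      ≤ (1/θ) * (θ * n ^ (θ - 1) * ‖p - q‖) := by
        gcongr
        exact h1.trans (by gcongr)
    _ = _ := by field_simp

lemma HT_eq {θ n : ℝ} {p : Eu m →L[ℝ] ℝ} (h : ‖p‖ ≤ n) : HT m θ n p = (1/θ) * ‖p‖ ^ θ := by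
  unfold HT; rw [min_eq_left h]

lemma hol_of_compact {h : Eu m → ℝ} (hl : LocallyLipschitz h) {ρ : ℝ}
    (h0 : ∀ x, ρ < ‖x‖ → h x = 0) :
    ∃ b B, Hol b h ∧ (∀ x, |h x| ≤ B) ∧ Tendsto h (cocompact _) (𝓝 0) := by
  have hcomp : IsCompact (Metric.closedBall (0 : Eu m) (ρ + 1)) := isCompact_closedBall _ _
  obtain ⟨K, hK⟩ := (hl.locallyLipschitzOn (s := Metric.closedBall (0 : Eu m) (ρ + 1))
    ).exists_lipschitzOnWith_of_compact hcomp
  obtain ⟨B, hB⟩ := hcomp.exists_bound_of_continuousOn hl.continuous.continuousOn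
  have hB' : ∀ x, |h x| ≤ |B| := by
    intro x
    by_cases hx : ‖x‖ ≤ ρ + 1
    · exact (hB x (by simpa using hx)).trans (le_abs_self _)
    · rw [h0 x (by linarith)]; simp
  refine ⟨K + 2 * |B|, |B|, fun x y => ?_, hB', ?_⟩
  · have hs := Real.sqrt_nonneg ‖x - y‖
    rcases le_total ‖x - y‖ 1 with hr | hr
    · have hs2 : ‖x - y‖ ≤ √‖x - y‖ := by
        have : √‖x - y‖ ≤ 1 := Real.sqrt_le_one.2 hr
        nlinarith [Real.sq_sqrt (norm_nonneg (x - y))]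
      have hmain : ‖h x - h y‖ ≤ K * ‖x - y‖ := by
        by_cases hxy : ‖x‖ ≤ ρ + 1 ∧ ‖y‖ ≤ ρ + 1
        · have := hK.dist_le_mul x (by simpa using hxy.1) y (by simpa using hxy.2)
          rwa [dist_eq_norm, dist_eq_norm] at this
        · have h3 : ‖x‖ ≤ ‖y‖ + ‖x - y‖ := norm_le_norm_add_norm_sub' x y
          have h4 : ‖y‖ ≤ ‖x‖ + ‖x - y‖ := norm_le_norm_add_norm_sub x y
          have : h x = 0 ∧ h y = 0 := by
            rw [not_and_or] at hxy
            rcases hxy with hx | hy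
            · exact ⟨h0 x (by linarith), h0 y (by linarith)⟩
            · exact ⟨h0 x (by linarith), h0 y (by linarith)⟩
          rw [this.1, this.2]; simp; positivity
      have : (K:ℝ) * ‖x - y‖ ≤ K * √‖x - y‖ := by gcongr
      nlinarith [abs_nonneg B]
    · have h1 : 1 ≤ √‖x - y‖ := Real.one_le_sqrt.2 hr
      have h2 : ‖h x - h y‖ ≤ |h x| + |h y| := norm_sub_le _ _
      have h3 := hB' x
      have h4 := hB' y
      have h5 : 0 ≤ (K:ℝ) * √‖x - y‖ := by positivity
      nlinarith [abs_nonneg B]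
  · refine tendsto_const_nhds.congr' ?_
    rw [cocompact_eq_comap]
    filter_upwards [preimage_mem_comap (Ioi_mem_atTop ρ)] with x hx
    exact (h0 x hx).symm

lemma LocallyLipschitz.mul_real {X : Type*} [PseudoEMetricSpace X] {a b : X → ℝ}
    (ha : LocallyLipschitz a) (hb : LocallyLipschitz b) :
    LocallyLipschitz (fun x => a x * b x) := by
  have h1 : LocallyLipschitz (fun p : ℝ × ℝ => p.1 * p.2) :=
    (contDiff_mul (𝕜 := ℝ) (n := 1)).locallyLipschitz
  exact h1.comp (ha.prodMk hb)

/-- clamp to the unit interval -/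
noncomputable def clp (t : ℝ) : ℝ := max 0 (min 1 t)

lemma clp_nonneg (t : ℝ) : 0 ≤ clp t := le_max_left _ _
lemma clp_le (t : ℝ) : clp t ≤ 1 := max_le zero_le_one (min_le_left _ _)
lemma clp_one {t : ℝ} (h : 1 ≤ t) : clp t = 1 := by simp [clp, min_eq_left h]
lemma clp_zero {t : ℝ} (h : t ≤ 0) : clp t = 0 := by
  unfold clp; rw [max_eq_left]; exact (min_le_right _ _).trans h
lemma clp_lip (s t : ℝ) : |clp s - clp t| ≤ |s - t| := by
  unfold clp
  refine (abs_max_sub_max_le_max _ _ _ _).trans ?_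
  have := abs_min_sub_min_le_max 1 s 1 t
  simp at this ⊢
  exact this

lemma hol_of_lip_unit {h : Eu m → ℝ} (h0 : ∀ x, 0 ≤ h x) (h1 : ∀ x, h x ≤ 1)
    (hl : ∀ x y, |h x - h y| ≤ ‖x - y‖) : Hol 1 h := by
  intro x y
  rw [one_mul]
  rcases le_total ‖x - y‖ 1 with hr | hr
  · have hs2 : ‖x - y‖ ≤ √‖x - y‖ := by
      have : √‖x - y‖ ≤ 1 := Real.sqrt_le_one.2 hr
      nlinarith [Real.sq_sqrt (norm_nonneg (x - y)), Real.sqrt_nonneg ‖x - y‖]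
    exact (hl x y).trans hs2
  · have h1' : 1 ≤ √‖x - y‖ := Real.one_le_sqrt.2 hr
    refine le_trans ?_ h1'
    rw [Real.norm_eq_abs, abs_le]
    constructor <;> linarith [h0 x, h0 y, h1 x, h1 y]

lemma lap_continuous {u : Eu m → ℝ} (hu : ContDiff ℝ 2 u) : Continuous (lap u) := by
  have : lap u = fun x => trc m (fderiv ℝ (fderiv ℝ u) x) := by
    funext x; exact lap_eq_trc u x
  rw [this]
  exact (trc m).continuous.comp ((contDiff_fderiv hu).continuous_fderiv (by norm_num))

lemma lap_congr {u v : Eu m → ℝ} {x : Eu m} (h : u =ᶠ[𝓝 x] v) : lap u x = lap v x := by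
  rw [lap_eq_trc, lap_eq_trc, (h.fderiv).fderiv_eq]

lemma lap_normsq (x : Eu m) : lap (fun y : Eu m => ‖y‖ ^ 2) x = 2 * m := by
  have h1 : fderiv ℝ (fun y : Eu m => ‖y‖ ^ 2) = fun y => ((2:ℝ) • isl m) y := by
    funext y
    ext v
    rw [fderiv_norm_sq_apply]
    simp [isl_apply]
  rw [lap_eq, h1]
  have : fderiv ℝ (fun y => ((2:ℝ) • isl m) y) x = (2:ℝ) • isl m :=
    ContinuousLinearMap.fderiv _
  rw [this]
  simp [isl_apply, mul_comm]

lemma lap_const_sub (c : ℝ) (u : Eu m → ℝ) (x : Eu m) :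
    lap (fun y => c - u y) x = - lap u x := by
  rw [lap_eq_trc, lap_eq_trc]
  have : fderiv ℝ (fun y => c - u y) = fun y => - fderiv ℝ u y := by
    funext y; rw [fderiv_const_sub]
  rw [this, fderiv_fun_neg, map_neg]

lemma lap_const_mul (c : ℝ) {u : Eu m → ℝ} (hu : ContDiff ℝ 2 u) (x : Eu m) :
    lap (fun y => c * u y) x = c * lap u x := by
  rw [lap_eq_trc, lap_eq_trc]
  have : fderiv ℝ (fun y => c * u y) = fun y => c • fderiv ℝ u y := by
    funext y; exact fderiv_const_mul (hu.differentiable (by norm_num) y) c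
  have h2 : DifferentiableAt ℝ (fderiv ℝ u) x :=
    (contDiff_fderiv hu).differentiable (by norm_num) x
  rw [this, fderiv_fun_const_smul h2, map_smul, smul_eq_mul]

/-- cutoff -/
lemma exists_cut (m : ℕ) {R : ℝ} (hR : 0 ≤ R) : ∃ χ : Eu m → ℝ, ContDiff ℝ 3 χ ∧
    (∀ x, 0 ≤ χ x) ∧ (∀ x, χ x ≤ 1) ∧ (∀ x, ‖x‖ < R + 1 → χ =ᶠ[𝓝 x] fun _ => 1) ∧
    (∀ x, R + 2 < ‖x‖ → χ =ᶠ[𝓝 x] fun _ => 0) := by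
  let χ : ContDiffBump (0 : Eu m) := ⟨R + 1, R + 2, by linarith, by linarith⟩
  refine ⟨χ, by exact_mod_cast χ.contDiff (n := 3), fun x => χ.nonneg, fun x => χ.le_one, fun x hx => ?_, fun x hx => ?_⟩
  · exact χ.eventuallyEq_one_of_mem_ball (by simpa using hx)
  · have : ∀ᶠ y in 𝓝 x, R + 2 < ‖y‖ := (continuous_norm.tendsto x).eventually (lt_mem_nhds hx)
    filter_upwards [this] with y hy
    exact χ.zero_of_le_dist (by simpa using hy.le)

lemma exists_barrier (hm : 1 ≤ m) {R : ℝ} (hR : 0 ≤ R) : ∃ w : Eu m → ℝ, ∃ C : ℝ,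
    ContDiff ℝ 2 w ∧ (∀ x, 1 ≤ w x) ∧ (∀ x, w x ≤ C) ∧
    ∀ x, 1 ≤ clp (‖x‖ - R) * w x - (1/2) * lap w x := by
  obtain ⟨χ, hχ, hχ0, hχ1, hχi, hχo⟩ := exists_cut m hR
  let q : Eu m → ℝ := fun x => χ x * ‖x‖ ^ 2
  have hq : ContDiff ℝ 2 q := (hχ.of_le (by norm_num)).mul (contDiff_norm_sq ℝ)
  obtain ⟨B, hB⟩ := (isCompact_closedBall (0 : Eu m) (R + 2)).exists_bound_of_continuousOn
    (lap_continuous hq).continuousOn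
  obtain ⟨B2, hB2⟩ := (isCompact_closedBall (0 : Eu m) (R + 2)).exists_bound_of_continuousOn
    hq.continuous.continuousOn
  have hz : ∀ x, R + 2 < ‖x‖ → q =ᶠ[𝓝 x] fun _ => 0 := by
    intro x hx
    filter_upwards [hχo x hx] with y hy
    simp [q, hy]
  have hlq : ∀ x, |lap q x| ≤ |B| := by
    intro x
    by_cases hx : ‖x‖ ≤ R + 2
    · exact (hB x (by simpa using hx)).trans (le_abs_self _)
    · rw [lap_congr (hz x (not_le.1 hx)), lap_zero_fun]; simp
  have hq2 : ∀ x, |q x| ≤ |B2| := by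
    intro x
    by_cases hx : ‖x‖ ≤ R + 2
    · exact (hB2 x (by simpa using hx)).trans (le_abs_self _)
    · rw [(hz x (not_le.1 hx)).self_of_nhds]; simp
  have hw1 : ∀ x, 1 + |B| ≤ 1 + |B| + |B2| - q x := fun x => by
    have := (abs_le.1 (hq2 x)).2; linarith
  refine ⟨fun x => (1 + |B| + |B2|) - q x, 1 + |B| + |B2| + |B2|, contDiff_const.sub hq,
    fun x => ?_, fun x => ?_, fun x => ?_⟩
  · have := hw1 x
    linarith [abs_nonneg B]
  · have := (abs_le.1 (hq2 x)).1
    simp only; linarith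
  · rw [lap_const_sub]
    rcases lt_or_ge ‖x‖ (R + 1) with hx | hx
    · have e : q =ᶠ[𝓝 x] fun y => ‖y‖ ^ 2 := by
        filter_upwards [hχi x hx] with y hy
        simp [q, hy]
      rw [lap_congr e, lap_normsq]
      have h1 : (1:ℝ) ≤ m := by exact_mod_cast hm
      have h2 := clp_nonneg (‖x‖ - R)
      have h3 := hw1 x
      have : 0 ≤ clp (‖x‖ - R) * (1 + |B| + |B2| - q x) :=
        mul_nonneg h2 (by linarith [abs_nonneg B])
      linarith
    · rw [clp_one (by linarith)]
      have := (abs_le.1 (hlq x)).1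
      have h3 := hw1 x
      linarith [abs_nonneg B]

end Tools


open Filter Topology MeasureTheory Set
open scoped ZeroAtInfty
set_option linter.unusedSectionVars false
set_option maxSynthPendingDepth 3

section Approx
variable {m : ℕ}

lemma approx (hm : 1 ≤ m) {θ : ℝ} (hθ : 1 < θ) {f : Eu m → ℝ} (hf : LocallyLipschitz f)
    {φ : Eu m → ℝ} (hφ : ContDiff ℝ 2 φ)
    (hsub : ∀ y, -(1/2) * lap φ y + (1/θ) * ‖fderiv ℝ φ y‖ ^ θ ≤ f y)
    {R : ℝ} (hR : 0 ≤ R) {ε : ℝ} (hε : 0 < ε) :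
    ∃ κ : ℝ, ∃ u : Eu m → ℝ, 0 < κ ∧ ContDiff ℝ 2 u ∧ (∀ x, |κ * u x| ≤ ε) ∧
      ∀ x, ‖x‖ ≤ R → κ * u x - (1/2) * lap u x + (1/θ) * ‖fderiv ℝ u x‖ ^ θ = f x := by
  obtain ⟨χ, hχ, hχ0, hχ1, hχi, hχo⟩ := exists_cut m hR
  let ψ : Eu m → ℝ := fun x => χ x * φ x
  have hψ : ContDiff ℝ 2 ψ := (hχ.of_le (by norm_num)).mul hφ
  have hzψ : ∀ x, R + 2 < ‖x‖ → ψ =ᶠ[𝓝 x] fun _ => 0 := by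
    intro x hx
    filter_upwards [hχo x hx] with y hy
    simp [ψ, hy]
  have hiψ : ∀ x, ‖x‖ < R + 1 → ψ =ᶠ[𝓝 x] φ := by
    intro x hx
    filter_upwards [hχi x hx] with y hy
    simp [ψ, hy]
  let F : Eu m → ℝ := fun x => -(1/2) * lap ψ x + (1/θ) * ‖fderiv ℝ ψ x‖ ^ θ
  have hFc : Continuous F := by
    have h1 := lap_continuous hψ
    have h2 : Continuous (fderiv ℝ ψ) := hψ.continuous_fderiv (by norm_num)
    have h3 : Continuous fun x => ‖fderiv ℝ ψ x‖ ^ θ :=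
      h2.norm.rpow_const fun x => Or.inr (by linarith)
    fun_prop
  have hF1 : ∀ x, ‖x‖ < R + 1 → F x ≤ f x := by
    intro x hx
    simp only [F]
    rw [lap_congr (hiψ x hx), (hiψ x hx).fderiv_eq]
    exact hsub x
  have hF0 : ∀ x, R + 2 < ‖x‖ → F x = 0 := by
    intro x hx
    simp only [F]
    rw [lap_congr (hzψ x hx), (hzψ x hx).fderiv_eq, lap_zero_fun, fderiv_zero_fun, norm_zero,
      Real.zero_rpow (by linarith)]
    simp
  obtain ⟨N, hN⟩ := (isCompact_closedBall (0 : Eu m) (R + 3)).exists_bound_of_continuousOn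
    ((hFc.abs.add hf.continuous.abs)).continuousOn
  replace hN : ∀ x, ‖x‖ ≤ R + 3 → |F x| + |f x| ≤ N := fun x hx =>
    (le_abs_self _).trans (hN x (by simpa using hx))
  let g : Eu m → ℝ := fun x => clp (R + 3 - ‖x‖) * (f x + N * clp (‖x‖ - R))
  have hcl : ∀ a : ℝ, ∀ s : ℝ, |s| = 1 → LocallyLipschitz fun x : Eu m => clp (a + s * ‖x‖) := by
    intro a s hs
    apply LipschitzWith.locallyLipschitz (K := 1)
    apply LipschitzWith.of_dist_le_mul
    intro x y
    rw [dist_eq_norm, dist_eq_norm, NNReal.coe_one, one_mul, Real.norm_eq_abs]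
    refine (clp_lip _ _).trans ?_
    have : a + s * ‖x‖ - (a + s * ‖y‖) = s * (‖x‖ - ‖y‖) := by ring
    rw [this, abs_mul, hs, one_mul]
    exact abs_norm_sub_norm_le x y
  have hg : LocallyLipschitz g := by
    have h1 := hcl (R + 3) (-1) (by simp)
    have h2 := hcl (-R) 1 (by simp)
    have h3 : LocallyLipschitz fun x : Eu m => N * clp (-R + 1 * ‖x‖) :=
      (LocallyLipschitz.const N).mul_real h2
    have h4 := h1.mul_real (hf.add h3)
    convert h4 using 2 with x
    simp only [g]
    congr 2
    · ring
    · ring_nf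
  obtain ⟨bg, A, hbg, hA, hg0⟩ := hol_of_compact hg (ρ := R + 3) (by
    intro x hx
    simp only [g]
    rw [clp_zero (by linarith), zero_mul])
  have hgF : ∀ x, F x ≤ g x := by
    intro x
    rcases le_or_gt ‖x‖ (R + 3) with h3 | h3
    · have hn := hN x h3
      have hFx := le_abs_self (F x)
      have hfx := neg_abs_le (f x)
      have hN0 : 0 ≤ N := by linarith [abs_nonneg (F x), abs_nonneg (f x)]
      rcases lt_or_ge ‖x‖ (R + 1) with h1 | h1
      · simp only [g]
        rw [clp_one (by linarith : 1 ≤ R + 3 - ‖x‖), one_mul]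
        have := hF1 x h1
        have := mul_nonneg hN0 (clp_nonneg (‖x‖ - R))
        linarith
      · simp only [g]
        rw [clp_one (by linarith : 1 ≤ ‖x‖ - R)]
        rcases le_or_gt ‖x‖ (R + 2) with h2 | h2
        · rw [clp_one (by linarith : 1 ≤ R + 3 - ‖x‖)]
          linarith
        · rw [hF0 x h2]
          apply mul_nonneg (clp_nonneg _)
          linarith [abs_nonneg (F x)]
    · rw [hF0 x (by linarith)]
      simp only [g]
      rw [clp_zero (by linarith), zero_mul]
  obtain ⟨w, Cw, hw, hw1, hwC, hwe⟩ := exists_barrier hm hR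
  obtain ⟨Mψ, hMψ⟩ := (isCompact_closedBall (0 : Eu m) (R + 2)).exists_bound_of_continuousOn
    hψ.continuous.continuousOn
  have hψM : ∀ x, |ψ x| ≤ |Mψ| := by
    intro x
    by_cases hx : ‖x‖ ≤ R + 2
    · exact (hMψ x (by simpa using hx)).trans (le_abs_self _)
    · rw [(hzψ x (not_le.1 hx)).self_of_nhds]; simp
  have hψ0 : Tendsto ψ (cocompact _) (𝓝 0) := by
    refine tendsto_const_nhds.congr' ?_
    rw [cocompact_eq_comap]
    filter_upwards [preimage_mem_comap (Ioi_mem_atTop (R + 2))] with x hx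
    exact ((hzψ x hx).self_of_nhds).symm
  have hA0 : 0 ≤ A := (abs_nonneg _).trans (hA 0)
  have hCw : 1 ≤ Cw := (hw1 0).trans (hwC 0)
  set M := (A + 1) * Cw + 2 * |Mψ| with hM
  have hM0 : 0 ≤ M := by positivity
  set n := 2 * M + (A + 2 * M) + 2 with hn
  have hn0 : 0 ≤ n := by positivity
  set κ := min 1 (ε / (M + 1)) with hκ
  have hκ0 : 0 < κ := by
    apply lt_min one_pos; positivity
  have hκ1 : κ ≤ 1 := min_le_left _ _
  let G : C₀(Eu m, ℝ) := ⟨⟨g, hg.continuous⟩, hg0⟩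
  have hGx : ∀ x, G x = g x := fun x => rfl
  have hk : Hol 1 (fun x : Eu m => clp (‖x‖ - R)) := by
    refine hol_of_lip_unit (fun x => clp_nonneg _) (fun x => clp_le _) fun x y => ?_
    refine (clp_lip _ _).trans ?_
    have : ‖x‖ - R - (‖y‖ - R) = ‖x‖ - ‖y‖ := by ring
    rw [this]; exact abs_norm_sub_norm_le x y
  obtain ⟨u, hu, hue⟩ := exists_fix (HT_zero hθ hn0) (HT_bdd hθ hn0)
    (Real.rpow_nonneg hn0 _) (HT_lip hθ hn0) hκ0 hκ1 (fun x => clp_nonneg (‖x‖ - R))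
    (fun x => clp_le (‖x‖ - R)) hk G hbg hA
  have hu0 : Tendsto u (cocompact _) (𝓝 0) := u.zero_at_infty'
  have hup : ∀ x, u x ≤ (A + 1) * w x := by
    by_contra hcon
    push Not at hcon
    obtain ⟨x₁, hx₁⟩ := hcon
    have hcont : Continuous fun x => u x - (A + 1) * w x :=
      hu.continuous.sub (continuous_const.mul hw.continuous)
    have hev : ∀ᶠ x in cocompact (Eu m), u x - (A + 1) * w x ≤ u x₁ - (A + 1) * w x₁ := by
      filter_upwards [hu0.eventually (gt_mem_nhds (by linarith : (0:ℝ) < A + 1))] with x hx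
      have := hw1 x
      nlinarith
    obtain ⟨x₀, hx₀⟩ := hcont.exists_forall_ge' x₁ hev
    have hpos := hx₀ x₁
    have hmx : IsLocalMax (fun y => u y - (fun z => (A + 1) * w z) y) x₀ :=
      Filter.Eventually.of_forall fun y => hx₀ y
    have hmax := max_point hu (contDiff_const.mul hw) hmx
    rw [lap_const_mul (A + 1) hw] at hmax
    have he := hue x₀
    rw [hGx] at he
    have h1 := (abs_le.1 (hA x₀)).2
    have h2 := HT_nonneg hθ hn0 (fderiv ℝ u x₀)
    have h3 := hwe x₀
    have h4 := hw1 x₀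
    have h5 := clp_nonneg (‖x₀‖ - R)
    have h6 : (A + 1) * w x₀ ≤ u x₀ := by linarith
    have h7 : clp (‖x₀‖ - R) * ((A + 1) * w x₀) ≤ clp (‖x₀‖ - R) * u x₀ :=
      mul_le_mul_of_nonneg_left h6 h5
    have h8 : 0 ≤ (A + 1) * w x₀ := by positivity
    have h9 : 0 ≤ κ * u x₀ := mul_nonneg hκ0.le (h8.trans h6)
    have h10 : (A + 1) * 1 ≤ (A + 1) * (clp (‖x₀‖ - R) * w x₀ - (1/2) * lap w x₀) :=
      mul_le_mul_of_nonneg_left h3 (by linarith)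
    nlinarith [hmax.2]
  have hlo : ∀ x, ψ x - u x ≤ |Mψ| := by
    by_contra hcon
    push Not at hcon
    obtain ⟨x₁, hx₁⟩ := hcon
    obtain ⟨x₀, hx₀, hp⟩ := exists_max_of_pos (w := fun x => ψ x - u x)
      (hψ.continuous.sub hu.continuous) (by simpa using hψ0.sub hu0)
      (x := x₁) ((abs_nonneg _).trans_lt hx₁)
    have hmx : IsLocalMax (fun y => ψ y - u y) x₀ :=
      Filter.Eventually.of_forall fun y => hx₀ y
    have hmax := max_point hψ hu hmx
    have he := hue x₀
    rw [hGx, ← hmax.1] at he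
    have h1 := hgF x₀
    have h2 := HT_le hθ hn0 (fderiv ℝ ψ x₀)
    have h3 : 0 ≤ (κ + clp (‖x₀‖ - R)) * u x₀ := by
      simp only [F] at h1
      linarith [hmax.2]
    have h4 : 0 ≤ u x₀ := by
      have := clp_nonneg (‖x₀‖ - R)
      exact nonneg_of_mul_nonneg_right h3 (by linarith)
    have h5 := hx₀ x₁
    have h6 := (abs_le.1 (hψM x₀)).2
    linarith
  have huM : ∀ x, |u x| ≤ M := by
    intro x
    have h1 := hup x
    have h2 := hlo x
    have h3 := (abs_le.1 (hψM x)).1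
    have h4 : (A + 1) * w x ≤ (A + 1) * Cw := mul_le_mul_of_nonneg_left (hwC x) (by linarith)
    have h5 : 0 ≤ (A + 1) * Cw := by positivity
    rw [abs_le]
    constructor <;> linarith [abs_nonneg Mψ]
  have hgl := glip hu hu0 (H := HT m θ n)
    (e := fun x => g x - (κ + clp (‖x‖ - R)) * u x) (M := M) (A := A + 2 * M) huM (fun x => by
      have h1 : |(κ + clp (‖x‖ - R)) * u x| ≤ 2 * M := by
        have := clp_nonneg (‖x‖ - R)
        have := clp_le (‖x‖ - R)
        rw [abs_mul, abs_of_nonneg (by linarith)]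
        exact mul_le_mul (by linarith) (huM x) (abs_nonneg _) (by norm_num)
      have h2 := abs_sub (g x) ((κ + clp (‖x‖ - R)) * u x)
      have h3 := hA x
      linarith) (fun x => by
      have := hue x
      rw [hGx] at this
      linarith)
  refine ⟨κ, u, hκ0, hu, fun x => ?_, fun x hx => ?_⟩
  · rw [abs_mul, abs_of_pos hκ0]
    have h1 : κ ≤ ε / (M + 1) := min_le_right _ _
    calc κ * |u x| ≤ ε / (M + 1) * (M + 1) := by
          have := huM x
          gcongr
          linarith
      _ = ε := by field_simp
  · have h1 := hue x
    rw [hGx, HT_eq (hgl x)] at h1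
    simp only [g] at h1
    rw [clp_zero (by linarith : ‖x‖ - R ≤ 0), clp_one (by linarith : 1 ≤ R + 3 - ‖x‖)] at h1
    linarith

end Approx


open Filter Topology MeasureTheory Set
set_option linter.unusedSectionVars false
set_option maxSynthPendingDepth 3

section Dbl
variable {m : ℕ}

lemma calc_deriv (L r D a1 a2 b1 b2 β : ℝ) (hD : 0 < D) :
    ∃ G' : ℝ → ℝ, (∀ᶠ t in 𝓝 (0:ℝ), HasDerivAt
      (fun t => L * ((r + a1 * t + a2 * t ^ 2) * (D + b1 * t + b2 * t ^ 2) ^ (-β))) (G' t) t) ∧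
      HasDerivAt G' (L * D ^ (-β) * (2 * a2 - 2 * β * a1 * b1 / D +
        β * (β + 1) * r * b1 ^ 2 / D ^ 2 - 2 * β * r * b2 / D)) 0 ∧
      G' 0 = L * D ^ (-β) * (a1 - β * r * b1 / D) := by
  have dA : ∀ t, HasDerivAt (fun t : ℝ => r + a1 * t + a2 * t ^ 2) (a1 + 2 * a2 * t) t := by
    intro t
    refine ((((hasDerivAt_id t).const_mul a1).const_add r).add
      ((hasDerivAt_pow 2 t).const_mul a2)).congr_deriv ?_
    simp; ring
  have dB : ∀ t, HasDerivAt (fun t : ℝ => D + b1 * t + b2 * t ^ 2) (b1 + 2 * b2 * t) t := by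
    intro t
    refine ((((hasDerivAt_id t).const_mul b1).const_add D).add
      ((hasDerivAt_pow 2 t).const_mul b2)).congr_deriv ?_
    simp; ring
  have dA' : HasDerivAt (fun t : ℝ => a1 + 2 * a2 * t) (2 * a2) 0 := by
    simpa using ((hasDerivAt_id (0:ℝ)).const_mul (2 * a2)).const_add a1
  have dB' : HasDerivAt (fun t : ℝ => b1 + 2 * b2 * t) (2 * b2) 0 := by
    simpa using ((hasDerivAt_id (0:ℝ)).const_mul (2 * b2)).const_add b1
  have hev : ∀ᶠ t : ℝ in 𝓝 0, 0 < D + b1 * t + b2 * t ^ 2 := by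
    have hc : Continuous (fun t : ℝ => D + b1 * t + b2 * t ^ 2) := by fun_prop
    have ht := hc.tendsto 0
    simp only [mul_zero, add_zero, ne_eq, OfNat.ofNat_ne_zero, not_false_eq_true, zero_pow] at ht
    exact ht.eventually (lt_mem_nhds hD)
  refine ⟨fun t => L * ((a1 + 2 * a2 * t) * (D + b1 * t + b2 * t ^ 2) ^ (-β) +
    (r + a1 * t + a2 * t ^ 2) * ((b1 + 2 * b2 * t) * (-β) *
      (D + b1 * t + b2 * t ^ 2) ^ (-β - 1))), ?_, ?_, ?_⟩
  · filter_upwards [hev] with t ht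
    exact ((dA t).mul ((dB t).rpow_const (p := -β) (Or.inl ht.ne'))).const_mul L
  · have e0 : D + b1 * 0 + b2 * 0 ^ 2 = D := by ring
    have p1 := (dB 0).rpow_const (p := -β) (Or.inl (by rw [e0]; exact hD.ne'))
    have p2 := (dB 0).rpow_const (p := -β - 1) (Or.inl (by rw [e0]; exact hD.ne'))
    have := ((dA'.mul p1).add ((dA 0).mul ((dB'.mul_const (-β)).mul p2))).const_mul L
    refine this.congr_deriv ?_
    simp only [Pi.mul_apply]
    rw [e0]
    have h1 : D ^ (-β - 1) = D ^ (-β) / D := by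
      rw [Real.rpow_sub_one hD.ne']
    have h2 : D ^ (-β - 1 - 1) = D ^ (-β) / D ^ 2 := by
      rw [Real.rpow_sub_one hD.ne', h1]; field_simp
    rw [h1, h2]
    field_simp
    ring
  · have e0 : D + b1 * 0 + b2 * 0 ^ 2 = D := by ring
    simp only [e0]
    rw [Real.rpow_sub_one hD.ne']
    field_simp
    ring

/-- localisation function -/
noncomputable def DD (x y : Eu m) : ℝ := 1 - ‖x‖ ^ 2 - ‖y‖ ^ 2 - 8 * ‖x - y‖

lemma dbl_line {u : Eu m → ℝ} (hu : ContDiff ℝ 2 u) {L β : ℝ} (hL : 0 ≤ L) (hβ : 0 ≤ β)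
    {x y : Eu m} (hD : 0 < DD x y) (hr : 0 < ‖x - y‖)
    (hmax : ∀ x' y', 0 < DD x' y' → u x' - u y' - L * (‖x' - y'‖ * DD x' y' ^ (-β)) ≤
      u x - u y - L * (‖x - y‖ * DD x y ^ (-β))) (ξ : Eu m) (s : ℝ) {e : Eu m}
    (he : x - y = ‖x - y‖ • e) {a1 a2 b1 b2 : ℝ} (ha1 : a1 = (1 - s) * inner ℝ e ξ)
    (ha2 : a2 = (1 - s) ^ 2 * ‖ξ‖ ^ 2 / (2 * ‖x - y‖))
    (hb1 : b1 = -2 * inner ℝ x ξ - 2 * s * inner ℝ y ξ - 8 * a1)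
    (hb2 : b2 = - ‖ξ‖ ^ 2 - s ^ 2 * ‖ξ‖ ^ 2 - 8 * a2) :
    fderiv ℝ u x ξ - s * fderiv ℝ u y ξ =
        L * DD x y ^ (-β) * (a1 - β * ‖x - y‖ * b1 / DD x y) ∧
    fderiv ℝ (fderiv ℝ u) x ξ ξ - s ^ 2 * fderiv ℝ (fderiv ℝ u) y ξ ξ ≤
      L * DD x y ^ (-β) * (2 * a2 - 2 * β * a1 * b1 / DD x y +
        β * (β + 1) * ‖x - y‖ * b1 ^ 2 / DD x y ^ 2 - 2 * β * ‖x - y‖ * b2 / DD x y) := by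
  set r := ‖x - y‖ with hrdef
  obtain ⟨G', hG1, hG2, hG3⟩ := calc_deriv L r (DD x y) a1 a2 b1 b2 β hD
  have hev : ∀ᶠ t : ℝ in 𝓝 0, 0 < DD x y + b1 * t + b2 * t ^ 2 := by
    have hc : Continuous (fun t : ℝ => DD x y + b1 * t + b2 * t ^ 2) := by fun_prop
    have ht := hc.tendsto 0
    simp only [mul_zero, add_zero, ne_eq, OfNat.ofNat_ne_zero, not_false_eq_true, zero_pow] at ht
    exact ht.eventually (lt_mem_nhds hD)
  have key := doubling_line hu hu x y ξ (s • ξ) hG1 hG2 (by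
    filter_upwards [hev] with t ht
    set x' := x + t • ξ
    set y' := y + t • s • ξ
    set At := r + a1 * t + a2 * t ^ 2 with hAt
    have hx' : ‖x'‖ ^ 2 = ‖x‖ ^ 2 + 2 * t * inner ℝ x ξ + t ^ 2 * ‖ξ‖ ^ 2 := by
      rw [norm_add_sq_real, inner_smul_right, norm_smul, mul_pow, Real.norm_eq_abs, sq_abs]; ring
    have hy' : ‖y'‖ ^ 2 = ‖y‖ ^ 2 + 2 * t * s * inner ℝ y ξ + t ^ 2 * s ^ 2 * ‖ξ‖ ^ 2 := by
      rw [norm_add_sq_real, inner_smul_right, inner_smul_right, norm_smul, norm_smul, mul_pow,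
        mul_pow, Real.norm_eq_abs, Real.norm_eq_abs, sq_abs, sq_abs]; ring
    have hd : x' - y' = (x - y) + (t * (1 - s)) • ξ := by
      simp only [x', y', smul_smul, mul_sub, mul_one, sub_smul]; abel
    have hxy' : ‖x' - y'‖ ^ 2 =
        r ^ 2 + 2 * t * (1 - s) * (r * inner ℝ e ξ) + (t * (1 - s)) ^ 2 * ‖ξ‖ ^ 2 := by
      rw [hd, norm_add_sq_real, inner_smul_right, norm_smul, mul_pow, Real.norm_eq_abs, sq_abs,
        ← hrdef]
      conv_lhs => rw [he]
      rw [inner_smul_left]; simp; ring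
    have hA : ‖x' - y'‖ ≤ At := by
      have e1 : ‖x' - y'‖ ^ 2 = 2 * r * At - r ^ 2 := by
        rw [hxy', hAt, ha1, ha2]; field_simp; ring
      have : 0 ≤ (‖x' - y'‖ - r) ^ 2 := sq_nonneg _
      nlinarith
    have hB : DD x y + b1 * t + b2 * t ^ 2 ≤ DD x' y' := by
      have : DD x y + b1 * t + b2 * t ^ 2 = 1 - ‖x'‖ ^ 2 - ‖y'‖ ^ 2 - 8 * At := by
        rw [hx', hy', hb1, hb2, hAt, DD]; ring
      rw [this, DD]; linarith
    have h1 := hmax x' y' (ht.trans_le hB)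
    have h2 : DD x' y' ^ (-β) ≤ (DD x y + b1 * t + b2 * t ^ 2) ^ (-β) :=
      Real.rpow_le_rpow_of_nonpos ht hB (by linarith)
    have h3 : ‖x' - y'‖ * DD x' y' ^ (-β) ≤ At * (DD x y + b1 * t + b2 * t ^ 2) ^ (-β) :=
      mul_le_mul hA h2 (Real.rpow_nonneg (ht.trans_le hB).le _) ((norm_nonneg _).trans hA)
    have h4 := mul_le_mul_of_nonneg_left h3 hL
    simp only [zero_smul, add_zero, mul_zero, ne_eq, OfNat.ofNat_ne_zero, not_false_eq_true,
      zero_pow]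
    linarith)
  constructor
  · rw [← hG3, ← key.1]; simp
  · refine le_trans (le_of_eq ?_) key.2
    simp; ring

lemma DD_facts {x y : Eu m} (hD : 0 < DD x y) :
    DD x y ≤ 1 ∧ ‖x - y‖ < 1 ∧ ‖x‖ < 1 ∧ ‖y‖ < 1 := by
  have h1 := sq_nonneg ‖x‖
  have h2 := sq_nonneg ‖y‖
  have h3 := norm_nonneg (x - y)
  have hx := norm_nonneg x
  have hy := norm_nonneg y
  unfold DD at *
  refine ⟨by linarith, by linarith, ?_, ?_⟩ <;> nlinarith

/-- second order constant -/
noncomputable def cc1 (β : ℝ) : ℝ := 1 + 36 * β + 144 * β * (β + 1)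

lemma dbl_num {β r D a1 a2 b1 s σ : ℝ} (hβ : 0 ≤ β) (hr : 0 < r) (hD : 0 < D) (hD1 : D ≤ 1)
    (hs0 : 0 ≤ s) (hs1 : s ≤ 1) (hσ0 : 0 ≤ σ) (hσ1 : σ ≤ 1) (h1 : |a1| ≤ σ) (h2 : |b1| ≤ 12)
    (ha2 : a2 = σ ^ 2 * 1 ^ 2 / (2 * r)) :
    2 * a2 - 2 * β * a1 * b1 / D + β * (β + 1) * r * b1 ^ 2 / D ^ 2 -
      2 * β * r * (-1 ^ 2 - s ^ 2 * 1 ^ 2 - 8 * a2) / D ≤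
    cc1 β * (σ ^ 2 / r + σ / D + r / D ^ 2) := by
  have h3 : -(2 * β * a1 * b1 / D) ≤ 24 * β * (σ / D) := by
    have : -(a1 * b1) ≤ σ * 12 := by
      refine (neg_le_abs _).trans ?_
      rw [abs_mul]
      exact mul_le_mul h1 h2 (abs_nonneg _) hσ0
    have e1 : -(2 * β * a1 * b1 / D) = 2 * β / D * (-(a1 * b1)) := by ring
    have e2 : 24 * β * (σ / D) = 2 * β / D * (σ * 12) := by ring
    rw [e1, e2]
    exact mul_le_mul_of_nonneg_left this (by positivity)
  have h4 : β * (β + 1) * r * b1 ^ 2 / D ^ 2 ≤ 144 * β * (β + 1) * (r / D ^ 2) := by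
    have : b1 ^ 2 ≤ 144 := by
      have := sq_le_sq' (by linarith [(abs_le.1 h2).1] : -12 ≤ b1) (abs_le.1 h2).2
      linarith
    have e1 : β * (β + 1) * r * b1 ^ 2 / D ^ 2 = β * (β + 1) * r / D ^ 2 * b1 ^ 2 := by ring
    have e2 : 144 * β * (β + 1) * (r / D ^ 2) = β * (β + 1) * r / D ^ 2 * 144 := by ring
    rw [e1, e2]
    exact mul_le_mul_of_nonneg_left this (by positivity)
  have h5 : -(2 * β * r * (-1 ^ 2 - s ^ 2 * 1 ^ 2 - 8 * a2) / D) ≤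
      4 * β * (r / D ^ 2) + 8 * β * (σ / D) := by
    have e1 : -(2 * β * r * (-1 ^ 2 - s ^ 2 * 1 ^ 2 - 8 * a2) / D) =
        2 * β * (1 + s ^ 2) * (r / D) + 8 * β * (σ ^ 2 / D) := by
      rw [ha2]; field_simp; ring
    rw [e1]
    have q1 : σ ^ 2 / D ≤ σ / D := by
      apply div_le_div_of_nonneg_right _ hD.le; nlinarith
    have q2 : r / D ≤ r / D ^ 2 := by
      apply div_le_div_of_nonneg_left hr.le (by positivity); nlinarith
    have q3 : 2 * β * (1 + s ^ 2) * (r / D) ≤ 2 * β * 2 * (r / D ^ 2) := by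
      have : s ^ 2 ≤ 1 := by nlinarith
      gcongr
      linarith
    have q4 : 8 * β * (σ ^ 2 / D) ≤ 8 * β * (σ / D) := by gcongr
    linarith
  have h6 : 2 * a2 = σ ^ 2 / r := by rw [ha2]; field_simp
  rw [h6]
  have p1 : 0 ≤ σ ^ 2 / r := by positivity
  have p2 : 0 ≤ σ / D := by positivity
  have p3 : 0 ≤ r / D ^ 2 := by positivity
  have p4 : 0 ≤ β * (β + 1) := by positivity
  have t1 : 0 ≤ β * (σ ^ 2 / r) := by positivity
  have t2 : 0 ≤ β * (β + 1) * (σ ^ 2 / r) := by positivity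
  have t3 : 0 ≤ β * (σ / D) := by positivity
  have t4 : 0 ≤ β * (β + 1) * (σ / D) := by positivity
  have t5 : 0 ≤ β * (r / D ^ 2) := by positivity
  unfold cc1
  generalize σ ^ 2 / r = X at *
  generalize r / D ^ 2 = Z at *
  linarith

lemma dbl_second {u : Eu m → ℝ} (hu : ContDiff ℝ 2 u) {L β : ℝ} (hL : 0 ≤ L) (hβ : 0 ≤ β)
    {x y : Eu m} (hD : 0 < DD x y) (hr : 0 < ‖x - y‖)
    (hmax : ∀ x' y', 0 < DD x' y' → u x' - u y' - L * (‖x' - y'‖ * DD x' y' ^ (-β)) ≤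
      u x - u y - L * (‖x - y‖ * DD x y ^ (-β))) {ξ : Eu m} (hξ : ‖ξ‖ = 1) {s : ℝ} (hs0 : 0 ≤ s)
    (hs1 : s ≤ 1) :
    fderiv ℝ (fderiv ℝ u) x ξ ξ - s ^ 2 * fderiv ℝ (fderiv ℝ u) y ξ ξ ≤
      cc1 β * (L * DD x y ^ (-β)) * ((1 - s) ^ 2 / ‖x - y‖ + (1 - s) / DD x y +
        ‖x - y‖ / DD x y ^ 2) := by
  obtain ⟨hD1, hr1, hx1, hy1⟩ := DD_facts hD
  let e : Eu m := ‖x - y‖⁻¹ • (x - y)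
  have hee : ‖e‖ = 1 := by
    simp only [e, norm_smul, norm_inv, norm_norm]
    exact inv_mul_cancel₀ hr.ne'
  have hxe : x - y = ‖x - y‖ • e := by
    simp only [e, smul_smul, mul_inv_cancel₀ hr.ne', one_smul]
  have k := (dbl_line hu hL hβ hD hr hmax ξ s hxe rfl rfl rfl rfl).2
  rw [hξ] at k
  set r := ‖x - y‖
  set D := DD x y
  set a1 := (1 - s) * inner ℝ e ξ with ha1
  set a2 := (1 - s) ^ 2 * 1 ^ 2 / (2 * r) with ha2
  set b1 := -2 * inner ℝ x ξ - 2 * s * inner ℝ y ξ - 8 * a1 with hb1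
  set σ := 1 - s with hσ
  have hσ0 : 0 ≤ σ := by linarith
  have hσ1 : σ ≤ 1 := by linarith
  have i1 : |inner ℝ e ξ| ≤ 1 := by
    have := abs_real_inner_le_norm e ξ; rwa [hee, hξ, one_mul] at this
  have i2 : |inner ℝ x ξ| ≤ 1 := by
    have := abs_real_inner_le_norm x ξ; rw [hξ, mul_one] at this; linarith
  have i3 : |inner ℝ y ξ| ≤ 1 := by
    have := abs_real_inner_le_norm y ξ; rw [hξ, mul_one] at this; linarith
  have h1 : |a1| ≤ σ := by
    rw [ha1, abs_mul, abs_of_nonneg hσ0]; nlinarith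
  have h2 : |b1| ≤ 12 := by
    have hsy : |s * inner ℝ y ξ| ≤ 1 := by
      rw [abs_mul, abs_of_nonneg hs0]; nlinarith [abs_nonneg (inner ℝ y ξ)]
    rw [abs_le] at *
    constructor <;> linarith
  refine k.trans ?_
  have hQ : 0 ≤ L * D ^ (-β) := by positivity
  rw [mul_comm (cc1 β), mul_assoc (L * D ^ (-β)) (cc1 β)]
  refine mul_le_mul_of_nonneg_left ?_ hQ
  exact dbl_num hβ hr hD hD1 hs0 hs1 hσ0 hσ1 h1 h2 rfl

lemma dbl_first {u : Eu m → ℝ} (hu : ContDiff ℝ 2 u) {L β : ℝ} (hL : 0 ≤ L) (hβ : 0 ≤ β)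
    {x y : Eu m} (hD : 0 < DD x y) (hr : 0 < ‖x - y‖)
    (hmax : ∀ x' y', 0 < DD x' y' → u x' - u y' - L * (‖x' - y'‖ * DD x' y' ^ (-β)) ≤
      u x - u y - L * (‖x - y‖ * DD x y ^ (-β))) :
    ‖fderiv ℝ u x - fderiv ℝ u y‖ ≤ 4 * β * (L * DD x y ^ (-β)) * (‖x - y‖ / DD x y) ∧
    L * DD x y ^ (-β) ≤ ‖fderiv ℝ u x‖ ∧ L * DD x y ^ (-β) ≤ ‖fderiv ℝ u y‖ ∧
    ‖fderiv ℝ u x‖ ≤ (1 + 14 * β) * (L * DD x y ^ (-β)) / DD x y ∧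
    ‖fderiv ℝ u y‖ ≤ (1 + 14 * β) * (L * DD x y ^ (-β)) / DD x y := by
  obtain ⟨hD1, hr1, hx1, hy1⟩ := DD_facts hD
  let e : Eu m := ‖x - y‖⁻¹ • (x - y)
  have hee : ‖e‖ = 1 := by
    simp only [e, norm_smul, norm_inv, norm_norm]
    exact inv_mul_cancel₀ hr.ne'
  have hxe : x - y = ‖x - y‖ • e := by
    simp only [e, smul_smul, mul_inv_cancel₀ hr.ne', one_smul]
  have k0 := fun ξ => (dbl_line hu hL hβ hD hr hmax ξ 0 hxe rfl rfl rfl rfl).1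
  have k1 := fun ξ => (dbl_line hu hL hβ hD hr hmax ξ 1 hxe rfl rfl rfl rfl).1
  set r := ‖x - y‖
  set D := DD x y
  set Q := L * D ^ (-β) with hQd
  have hQ : 0 ≤ Q := by positivity
  have hrD : 0 ≤ r / D := by positivity
  have hrD1 : r / D ≤ 1 / D := by gcongr
  have h1D : 1 ≤ 1 / D := by rw [le_div_iff₀ hD]; linarith
  have g1 : ‖fderiv ℝ u x - fderiv ℝ u y‖ ≤ 4 * β * Q * (r / D) := by
    refine ContinuousLinearMap.opNorm_le_bound _ (by positivity) fun ξ => ?_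
    rw [_root_.sub_apply]
    have := k1 ξ
    have e1 : (fderiv ℝ u x) ξ - (fderiv ℝ u y) ξ =
        2 * β * Q * (r / D) * (inner ℝ x ξ + inner ℝ y ξ) := by
      rw [one_mul] at this
      rw [this]; field_simp; ring
    rw [e1, norm_mul, Real.norm_of_nonneg (by positivity)]
    have i2 := abs_real_inner_le_norm x ξ
    have i3 := abs_real_inner_le_norm y ξ
    have i4 : ‖inner ℝ x ξ + inner ℝ y ξ‖ ≤ 2 * ‖ξ‖ := by
      refine (norm_add_le _ _).trans ?_
      rw [Real.norm_eq_abs, Real.norm_eq_abs]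
      nlinarith [norm_nonneg ξ]
    calc _ ≤ 2 * β * Q * (r / D) * (2 * ‖ξ‖) := by gcongr
      _ = _ := by ring
  have ex : ∀ ξ, fderiv ℝ u x ξ = Q * ((1 + 8 * β * (r / D)) * inner ℝ e ξ +
      2 * β * (r / D) * inner ℝ x ξ) := by
    intro ξ
    have := k0 ξ
    rw [zero_mul, sub_zero] at this
    rw [this]; field_simp; ring
  have g2 : Q ≤ fderiv ℝ u x e - 4 * β * Q * (r / D) := by
    rw [ex e, real_inner_self_eq_norm_sq, hee]
    have i2 := abs_real_inner_le_norm x e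
    rw [hee, mul_one] at i2
    have i3 := (abs_le.1 i2).1
    have i4 : -1 ≤ inner ℝ x e := by linarith
    have p1 : 0 ≤ 2 * β * (r / D) := by positivity
    have p2 := mul_le_mul_of_nonneg_left i4 p1
    have p3 : Q * 1 ≤ Q * ((1 + 8 * β * (r / D)) * 1 ^ 2 +
      2 * β * (r / D) * inner ℝ x e - 4 * β * (r / D)) := by
      refine mul_le_mul_of_nonneg_left ?_ hQ
      linarith
    linarith
  have le1 : ∀ p : Eu m →L[ℝ] ℝ, p e ≤ ‖p‖ := fun p => by
    have := p.le_opNorm e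
    rw [hee, mul_one] at this
    exact (le_abs_self _).trans this
  have g3 : ‖fderiv ℝ u x‖ ≤ (1 + 10 * β) * Q / D := by
    refine ContinuousLinearMap.opNorm_le_bound _ (by positivity) fun ξ => ?_
    rw [ex, norm_mul, Real.norm_of_nonneg hQ]
    have i1 := abs_real_inner_le_norm e ξ
    rw [hee, one_mul] at i1
    have i2 := abs_real_inner_le_norm x ξ
    have i2' : |inner ℝ x ξ| ≤ ‖ξ‖ := by nlinarith [norm_nonneg ξ]
    have i4 : ‖(1 + 8 * β * (r / D)) * inner ℝ e ξ + 2 * β * (r / D) * inner ℝ x ξ‖ ≤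
        (1 + 8 * β * (r / D)) * ‖ξ‖ + 2 * β * (r / D) * ‖ξ‖ := by
      refine (norm_add_le _ _).trans ?_
      have w1 : 0 ≤ 1 + 8 * β * (r / D) := by positivity
      have w2 : 0 ≤ 2 * β * (r / D) := by positivity
      rw [norm_mul, norm_mul, Real.norm_of_nonneg w1,
        Real.norm_of_nonneg w2, Real.norm_eq_abs, Real.norm_eq_abs]
      exact add_le_add (mul_le_mul_of_nonneg_left i1 w1) (mul_le_mul_of_nonneg_left i2' w2)
    have i5 : (1 + 8 * β * (r / D)) * ‖ξ‖ + 2 * β * (r / D) * ‖ξ‖ ≤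
        ((1 + 10 * β) * (1 / D)) * ‖ξ‖ := by
      rw [← add_mul]
      refine mul_le_mul_of_nonneg_right ?_ (norm_nonneg _)
      nlinarith
    calc _ ≤ Q * (((1 + 10 * β) * (1 / D)) * ‖ξ‖) :=
          mul_le_mul_of_nonneg_left (i4.trans i5) hQ
      _ = _ := by ring
  have g4 : 4 * β * Q * (r / D) ≤ 4 * β * Q / D := by
    calc _ ≤ 4 * β * Q * (1 / D) := by gcongr
      _ = _ := by ring
  have e5 : (1 + 14 * β) * Q / D = (1 + 10 * β) * Q / D + 4 * β * Q / D := by ring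
  have p0 : 0 ≤ 4 * β * Q * (r / D) := by positivity
  refine ⟨g1, ?_, ?_, ?_, ?_⟩
  · have := le1 (fderiv ℝ u x); linarith
  · have h1 := le1 (fderiv ℝ u y)
    have h2 := le1 (fderiv ℝ u x - fderiv ℝ u y)
    rw [_root_.sub_apply] at h2
    linarith
  · linarith
  · have h1 := norm_sub_norm_le (fderiv ℝ u y) (fderiv ℝ u x)
    rw [norm_sub_rev] at h1
    linarith

end Dbl


open Filter Topology MeasureTheory Set
set_option linter.unusedSectionVars false
set_option maxSynthPendingDepth 3

section LGrad
variable {m : ℕ}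

lemma num_contra {θ q Q r D S T c2 Lg C : ℝ} (hθ : 0 < θ) (hq : 1 ≤ q) (hQ : 1 ≤ Q) (hr : 0 < r) (hr2 : r ≤ 1)
    (hD : 0 < D) (hDq : 1 / D ≤ q) (hc2 : 0 ≤ c2) (hLg : 0 ≤ Lg) (hC : 0 ≤ C)
    (hS : Q * q ^ 4 / θ ≤ S) (hT : Q * q ^ 4 / θ ≤ T)
    (hST : -(2 * c2 * r * (Q * q ^ 5)) - 2 * Lg * r ≤ S - T)
    (hE : ∀ s, 0 ≤ s → s ≤ 1 →
      S - s ^ 2 * T ≤ C * Q * ((1 - s) ^ 2 / r + (1 - s) / D + r / D ^ 2)) :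
    q ≤ θ * (2 * c2 + 2 * Lg + 3 * C) := by
  have hq0 : 0 < q := by linarith
  have hQ0 : 0 < Q := by linarith
  have hD0 : 0 < 1 / D := by positivity
  have hD2 : 1 / D ^ 2 ≤ q ^ 2 := by
    have : 1 / D ^ 2 = (1 / D) ^ 2 := by ring
    rw [this]; gcongr
  have hq2 : q ≤ q ^ 2 := by nlinarith
  rcases le_or_gt (r * q ^ 2) 1 with h | h
  · have hσ : 0 ≤ r * q ^ 2 := by positivity
    have k := hE (1 - r * q ^ 2) (by linarith) (by linarith)
    have e0 : 1 - (1 - r * q ^ 2) = r * q ^ 2 := by ring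
    rw [e0] at k
    have b : (r * q ^ 2) ^ 2 / r + r * q ^ 2 / D + r / D ^ 2 ≤ r * (3 * q ^ 4) := by
      have e1 : (r * q ^ 2) ^ 2 / r + r * q ^ 2 / D + r / D ^ 2 =
          r * (q ^ 4 + q ^ 2 * (1 / D) + 1 / D ^ 2) := by field_simp
      rw [e1]
      refine mul_le_mul_of_nonneg_left ?_ hr.le
      have : q ^ 2 * (1 / D) ≤ q ^ 2 * q ^ 2 := by gcongr; linarith
      have : q ^ 2 * 1 ≤ q ^ 2 * q ^ 2 := by gcongr; nlinarith
      nlinarith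
    have b2 := mul_le_mul_of_nonneg_left b (by positivity : 0 ≤ C * Q)
    have t : r * q ^ 2 * T ≤ (1 - (1 - r * q ^ 2) ^ 2) * T := by
      have hT0 : 0 ≤ T := le_trans (by positivity) hT
      refine mul_le_mul_of_nonneg_right ?_ hT0
      nlinarith
    have t2 : r * q ^ 2 * (Q * q ^ 4 / θ) ≤ r * q ^ 2 * T := by gcongr
    have main : r * (Q * q ^ 6 / θ) ≤ r * (2 * c2 * (Q * q ^ 5) + 2 * Lg + C * Q * (3 * q ^ 4)) := by
      have e1 : r * q ^ 2 * (Q * q ^ 4 / θ) = r * (Q * q ^ 6 / θ) := by ring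
      rw [e1] at t2
      linarith
    have main2 := le_of_mul_le_mul_left main hr
    have p1 : 1 ≤ Q * q ^ 5 := by
      have : 1 ≤ q ^ 5 := one_le_pow₀ hq
      nlinarith
    have p2 : Q * q ^ 4 ≤ Q * q ^ 5 := by
      have : q ^ 4 ≤ q ^ 5 := pow_le_pow_right₀ hq (by norm_num)
      gcongr
    have main3 : Q * q ^ 6 / θ ≤ (2 * c2 + 2 * Lg + 3 * C) * (Q * q ^ 5) := by
      have := mul_le_mul_of_nonneg_left p1 (by positivity : 0 ≤ 2 * Lg)
      have := mul_le_mul_of_nonneg_left p2 (by positivity : 0 ≤ 3 * C)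
      linarith
    rw [div_le_iff₀ hθ] at main3
    have : (Q * q ^ 5) * q ≤ (Q * q ^ 5) * (θ * (2 * c2 + 2 * Lg + 3 * C)) := by linarith
    exact le_of_mul_le_mul_left this (by positivity)
  · have k := hE 0 le_rfl zero_le_one
    have hr1 : 1 / r ≤ q ^ 2 := by
      rw [div_le_iff₀ hr]; linarith
    have hrD : r / D ^ 2 ≤ r * q ^ 2 := by
      have : r / D ^ 2 = r * (1 / D ^ 2) := by ring
      rw [this]; gcongr
    have b : (1 - 0) ^ 2 / r + (1 - 0) / D + r / D ^ 2 ≤ 3 * q ^ 2 := by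
      have : r * q ^ 2 ≤ 1 * q ^ 2 := by gcongr
      have e1 : (1 - 0) ^ 2 / r + (1 - 0) / D + r / D ^ 2 = 1 / r + 1 / D + r / D ^ 2 := by ring
      rw [e1]
      linarith
    have b2 := mul_le_mul_of_nonneg_left b (by positivity : 0 ≤ C * Q)
    have main : Q * q ^ 4 / θ ≤ C * Q * (3 * q ^ 2) := by linarith
    rw [div_le_iff₀ hθ] at main
    have : (Q * q ^ 2) * q ^ 2 ≤ (Q * q ^ 2) * (θ * (3 * C)) := by linarith
    have := le_of_mul_le_mul_left this (by positivity)
    have : 0 ≤ θ * (2 * c2 + 2 * Lg) := by positivity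
    linarith

set_option maxHeartbeats 2000000 in
lemma lgrad0 {θ : ℝ} (hθ : 1 < θ) {A Lg : ℝ} (hA : 0 ≤ A) (hLg : 0 ≤ Lg) : ∃ L : ℝ,
    ∀ (u g : Eu m → ℝ) (κ : ℝ), ContDiff ℝ 2 u → 0 ≤ κ →
      (∀ x, ‖x‖ < 1 → κ * u x - (1/2) * lap u x + (1/θ) * ‖fderiv ℝ u x‖ ^ θ = g x) →
      (∀ x, ‖x‖ < 1 → |κ * u x| ≤ 1) → (∀ x, ‖x‖ < 1 → |g x| ≤ A) →
      (∀ x y, ‖x‖ < 1 → ‖y‖ < 1 → |g x - g y| ≤ Lg * ‖x - y‖) → ‖fderiv ℝ u 0‖ ≤ L := by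
  set μ := (θ - 1) / 4 with hμ
  have hμ0 : 0 < μ := by rw [hμ]; linarith
  set β := θ / μ with hβd
  have hβ : 0 < β := by positivity
  set c2 := 4 * β * (1 + 14 * β) ^ (θ - 1) with hc2
  have hc20 : 0 ≤ c2 := by positivity
  set C := m * cc1 β with hC
  have hC0 : 0 ≤ C := by
    have : 0 ≤ cc1 β := by unfold cc1; positivity
    positivity
  set Z := θ * (2 * c2 + 2 * Lg + 3 * C) with hZ
  have hZ0 : 0 ≤ Z := by positivity
  set L := max (max 1 (θ * (2 + 2 * A))) ((Z + 1) ^ (1 / μ)) with hL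
  have hL1 : 1 ≤ L := (le_max_left _ _).trans (le_max_left _ _)
  have hL2 : θ * (2 + 2 * A) ≤ L := (le_max_right _ _).trans (le_max_left _ _)
  have hL3 : (Z + 1) ^ (1 / μ) ≤ L := le_max_right _ _
  refine ⟨L, fun u g κ hu hκ he hκu hgA hgL => ?_⟩
  -- the key doubling inequality
  have key : ∀ x y : Eu m, 0 < DD x y → u x - u y ≤ L * (‖x - y‖ * DD x y ^ (-β)) := by
    by_contra hcon
    push Not at hcon
    obtain ⟨x₁, y₁, hD₁, hΦ₁⟩ := hcon
    have hDc : Continuous fun p : Eu m × Eu m => DD p.1 p.2 := by unfold DD; fun_prop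
    obtain ⟨K, hK⟩ := ((hu.of_le (by norm_num : (1:WithTop ℕ∞) ≤ 2)).locallyLipschitz.locallyLipschitzOn
      (s := Metric.closedBall (0 : Eu m) 1)).exists_lipschitzOnWith_of_compact
      (isCompact_closedBall _ _)
    have hK' : ∀ x y : Eu m, ‖x‖ < 1 → ‖y‖ < 1 → u x - u y ≤ K * ‖x - y‖ := by
      intro x y hx hy
      have := hK.dist_le_mul x (by simpa using hx.le) y (by simpa using hy.le)
      rw [dist_eq_norm, dist_eq_norm] at this
      exact (le_abs_self _).trans this
    set c := (L / (K + 1)) ^ (1 / β) with hc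
    have hc0 : 0 < c := by positivity
    have hDge : ∀ x y : Eu m, 0 < DD x y → 0 < u x - u y - L * (‖x - y‖ * DD x y ^ (-β)) →
        c ≤ DD x y ∧ 0 < ‖x - y‖ := by
      intro x y hD hp
      obtain ⟨hD1, hr1, hx1, hy1⟩ := DD_facts hD
      have h1 := hK' x y hx1 hy1
      have hr : 0 < ‖x - y‖ := by
        rcases (norm_nonneg (x - y)).eq_or_lt with h | h
        · rw [← h] at hp h1; simp at hp h1; linarith
        · exact h
      refine ⟨?_, hr⟩
      have h2 : ‖x - y‖ * (L * DD x y ^ (-β)) < ‖x - y‖ * K := by linarith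
      have h3 := lt_of_mul_lt_mul_left h2 hr.le
      have hDβ : 0 < DD x y ^ β := Real.rpow_pos_of_pos hD _
      rw [Real.rpow_neg hD.le, ← div_eq_mul_inv, div_lt_iff₀ hDβ] at h3
      have h4 : L / (K + 1) ≤ DD x y ^ β := by
        rw [div_le_iff₀ (by positivity)]
        linarith
      have h5 : c ≤ (DD x y ^ β) ^ (1 / β) :=
        Real.rpow_le_rpow (by positivity) h4 (by positivity)
      rwa [← Real.rpow_mul hD.le, mul_one_div_cancel hβ.ne', Real.rpow_one] at h5
    let Φ : Eu m × Eu m → ℝ := fun p => u p.1 - u p.2 - L * (‖p.1 - p.2‖ * DD p.1 p.2 ^ (-β))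
    let KK : Set (Eu m × Eu m) :=
      (Metric.closedBall (0 : Eu m) 1 ×ˢ Metric.closedBall (0 : Eu m) 1) ∩ {p | c ≤ DD p.1 p.2}
    have hKc : IsCompact KK :=
      ((isCompact_closedBall _ _).prod (isCompact_closedBall _ _)).inter_right
        (isClosed_le continuous_const hDc)
    have hmem : ∀ x y : Eu m, 0 < DD x y → 0 < Φ (x, y) → (x, y) ∈ KK := by
      intro x y hD hp
      obtain ⟨hD1, hr1, hx1, hy1⟩ := DD_facts hD
      exact ⟨⟨by simpa using hx1.le, by simpa using hy1.le⟩, (hDge x y hD hp).1⟩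
    have hp₁ : 0 < Φ (x₁, y₁) := by simp only [Φ]; linarith
    have hΦc : ContinuousOn Φ KK := by
      have h1 : ContinuousOn (fun p : Eu m × Eu m => DD p.1 p.2 ^ (-β)) KK :=
        hDc.continuousOn.rpow_const fun p hp => Or.inl (hc0.trans_le hp.2).ne'
      have h2 : Continuous fun p : Eu m × Eu m => u p.1 - u p.2 := by
        have := hu.continuous
        fun_prop
      have h3 : Continuous fun p : Eu m × Eu m => ‖p.1 - p.2‖ := by fun_prop
      exact h2.continuousOn.sub (continuousOn_const.mul (h3.continuousOn.mul h1))
    obtain ⟨⟨x, y⟩, hpK, hpmax⟩ := hKc.exists_isMaxOn ⟨_, hmem x₁ y₁ hD₁ hp₁⟩ hΦc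
    have hpos : 0 < Φ (x, y) := hp₁.trans_le (hpmax (hmem x₁ y₁ hD₁ hp₁))
    have hD : 0 < DD x y := hc0.trans_le hpK.2
    have hr : 0 < ‖x - y‖ := (hDge x y hD hpos).2
    have hmax : ∀ x' y', 0 < DD x' y' → u x' - u y' - L * (‖x' - y'‖ * DD x' y' ^ (-β)) ≤
        u x - u y - L * (‖x - y‖ * DD x y ^ (-β)) := by
      intro x' y' hD'
      rcases le_or_gt (Φ (x', y')) 0 with h | h
      · exact h.trans hpos.le
      · exact hpmax (hmem x' y' hD' h)
    have hL0 : 0 ≤ L := by linarith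
    obtain ⟨f1, f2, f3, f4, f5⟩ := dbl_first hu hL0 hβ.le hD hr hmax
    have sec := fun (ξ : Eu m) (hξ : ‖ξ‖ = 1) (s : ℝ) (hs0 : 0 ≤ s) (hs1 : s ≤ 1) =>
      dbl_second hu hL0 hβ.le hD hr hmax hξ hs0 hs1
    obtain ⟨hD1, hr1, hx1, hy1⟩ := DD_facts hD
    have hgl := hgL x y hx1 hy1
    have huxy : 0 ≤ u x - u y := by
      have : 0 ≤ L * (‖x - y‖ * DD x y ^ (-β)) := by positivity
      simp only [Φ] at hpos
      linarith
    set r := ‖x - y‖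
    set D := DD x y
    set Q := L * D ^ (-β) with hQ
    have hDβ : 1 ≤ D ^ (-β) := Real.one_le_rpow_of_pos_of_le_one_of_nonpos hD hD1 (by linarith)
    have hQL : L ≤ Q := by rw [hQ]; exact le_mul_of_one_le_right hL0 hDβ
    have hQ1 : 1 ≤ Q := hL1.trans hQL
    have hQ0 : 0 < Q := by linarith
    set q := Q ^ μ with hq
    have hq1 : 1 ≤ q := Real.one_le_rpow hQ1 hμ0.le
    have hDθ : D ^ (-θ) ≤ q := by
      have e1 : D ^ (-θ) = (D ^ (-β)) ^ μ := by
        rw [← Real.rpow_mul hD.le]; congr 1; rw [hβd]; field_simp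
      rw [e1, hq]
      refine Real.rpow_le_rpow (by positivity) ?_ hμ0.le
      rw [hQ]; exact le_mul_of_one_le_left (by positivity) hL1
    have hDq : 1 / D ≤ q := by
      refine le_trans ?_ hDθ
      rw [one_div, ← Real.rpow_neg_one]
      exact Real.rpow_le_rpow_of_exponent_ge hD hD1 (by linarith)
    have hQθ : Q ^ θ = Q * q ^ 4 := by
      rw [hq, ← Real.rpow_natCast, ← Real.rpow_mul hQ0.le]
      nth_rewrite 2 [← Real.rpow_one Q]
      rw [← Real.rpow_add hQ0]
      congr 1; rw [hμ]; push_cast; ring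
    have hST : ∀ z : Eu m, ‖z‖ < 1 → Q ≤ ‖fderiv ℝ u z‖ → Q * q ^ 4 / θ ≤ lap u z := by
      intro z hz hQz
      have h1 := he z hz
      have h2 := (abs_le.1 (hκu z hz)).1
      have h3 := (abs_le.1 (hgA z hz)).2
      have h4 : Q ^ θ ≤ ‖fderiv ℝ u z‖ ^ θ := Real.rpow_le_rpow hQ0.le hQz (by linarith)
      have h5 : (1/θ) * Q ^ θ ≤ (1/θ) * ‖fderiv ℝ u z‖ ^ θ := by gcongr
      have h6 : (2 + 2 * A) ≤ (1/θ) * Q ^ θ := by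
        have : Q ≤ Q ^ θ := by
          conv_lhs => rw [← Real.rpow_one Q]
          exact Real.rpow_le_rpow_of_exponent_le hQ1 hθ.le
        have : θ * (2 + 2 * A) ≤ Q ^ θ := by linarith
        rw [one_div, ← div_eq_inv_mul, le_div_iff₀ (by linarith)]
        linarith
      have e7 : Q * q ^ 4 / θ = (1/θ) * Q ^ θ := by rw [hQθ]; ring
      rw [e7]
      linarith
    have hHd : |(1/θ) * ‖fderiv ℝ u x‖ ^ θ - (1/θ) * ‖fderiv ℝ u y‖ ^ θ| ≤
        c2 * r * (Q * q ^ 5) := by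
      have h1 := abs_rpow_sub_le hθ.le (norm_nonneg _) (norm_nonneg _) f5 f4
      have h2 := (abs_norm_sub_norm_le (fderiv ℝ u x) (fderiv ℝ u y)).trans f1
      set P := (1 + 14 * β) * Q / D with hP
      have hP0 : 0 ≤ P := by positivity
      have e1 : P ^ (θ - 1) = (1 + 14 * β) ^ (θ - 1) * (Q ^ θ / Q) * (D ^ (-θ) * D) := by
        rw [hP, Real.div_rpow (by positivity) hD.le, Real.mul_rpow (by positivity) hQ0.le,
          Real.rpow_sub_one hQ0.ne', Real.rpow_sub_one hD.ne', Real.rpow_neg hD.le]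
        field_simp
      rw [← mul_sub, abs_mul, abs_of_pos (by positivity : 0 < 1 / θ)]
      calc (1/θ) * |‖fderiv ℝ u x‖ ^ θ - ‖fderiv ℝ u y‖ ^ θ|
          ≤ (1/θ) * (θ * P ^ (θ - 1) * (4 * β * Q * (r / D))) := by
            gcongr
            exact h1.trans (by gcongr)
        _ = c2 * r * (Q ^ θ * D ^ (-θ)) := by
            rw [e1, hc2]; field_simp
        _ ≤ c2 * r * (Q ^ θ * q) := by gcongr
        _ = c2 * r * (Q * q ^ 5) := by rw [hQθ]; ring
    have hdiff : -(2 * c2 * r * (Q * q ^ 5)) - 2 * Lg * r ≤ lap u x - lap u y := by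
      have h1 := he x hx1
      have h2 := he y hy1
      have h3 := (abs_le.1 hHd).1
      have h4 := (abs_le.1 hgl).2
      have h5 := mul_nonneg hκ huxy
      linarith
    have hE : ∀ s, 0 ≤ s → s ≤ 1 →
        lap u x - s ^ 2 * lap u y ≤ C * Q * ((1 - s) ^ 2 / r + (1 - s) / D + r / D ^ 2) := by
      intro s hs0 hs1
      rw [lap_eq, lap_eq, Finset.mul_sum, ← Finset.sum_sub_distrib]
      refine (Finset.sum_le_card_nsmul _ _ _ fun i _ =>
        sec (EuclideanSpace.single i 1) (by simp) s hs0 hs1).trans (le_of_eq ?_)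
      simp only [Finset.card_univ, Fintype.card_fin, nsmul_eq_mul, hC]
      ring
    have fin := num_contra (by linarith) hq1 hQ1 hr hr1.le hD hDq hc20 hLg hC0
      (hST x hx1 f2) (hST y hy1 f3) hdiff hE
    have : Z + 1 ≤ q := by
      have h1 : ((Z + 1) ^ (1 / μ)) ^ μ ≤ Q ^ μ :=
        Real.rpow_le_rpow (by positivity) (hL3.trans hQL) hμ0.le
      rwa [← Real.rpow_mul (by positivity), one_div_mul_cancel hμ0.ne', Real.rpow_one] at h1
    linarith
  -- conclusion
  have hd : HasFDerivAt u (fderiv ℝ u 0) 0 := (hu.differentiable (by norm_num) 0).hasFDerivAt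
  refine le_of_forall_pos_le_add fun ε hε => ?_
  refine hd.le_of_lip' (by linarith) ?_
  have hc : Continuous fun x : Eu m => DD x 0 := by unfold DD; fun_prop
  have hD0 : DD (0 : Eu m) 0 = 1 := by simp [DD]
  have ev1 : ∀ᶠ x : Eu m in 𝓝 0, 0 < DD x 0 := by
    have := hc.tendsto 0
    rw [hD0] at this
    exact this.eventually (lt_mem_nhds one_pos)
  have ev2 : ∀ᶠ x : Eu m in 𝓝 0, L * DD x 0 ^ (-β) < L + ε := by
    have h1 : ContinuousAt (fun x : Eu m => L * DD x 0 ^ (-β)) 0 :=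
      continuousAt_const.mul (hc.continuousAt.rpow_const (Or.inl (by rw [hD0]; norm_num)))
    have h2 := h1.tendsto
    rw [hD0, Real.one_rpow, mul_one] at h2
    exact h2.eventually (gt_mem_nhds (by linarith))
  filter_upwards [ev1, ev2] with x h1 h2
  have hsym : DD 0 x = DD x 0 := by unfold DD; rw [norm_sub_rev]; ring
  have k1 := key x 0 h1
  have k2 := key 0 x (by rw [hsym]; exact h1)
  rw [hsym, norm_sub_rev] at k2
  have h3 : L * (‖x - 0‖ * DD x 0 ^ (-β)) ≤ (L + ε) * ‖x - 0‖ := by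
    have := mul_le_mul_of_nonneg_right h2.le (norm_nonneg (x - 0))
    linarith
  rw [Real.norm_eq_abs, abs_le]
  constructor <;> linarith

lemma lgrad {θ : ℝ} (hθ : 1 < θ) {A Lg : ℝ} (hA : 0 ≤ A) (hLg : 0 ≤ Lg) : ∃ L : ℝ,
    ∀ (u g : Eu m → ℝ) (κ : ℝ) (x₀ : Eu m), ContDiff ℝ 2 u → 0 ≤ κ →
      (∀ x, ‖x - x₀‖ < 1 → κ * u x - (1/2) * lap u x + (1/θ) * ‖fderiv ℝ u x‖ ^ θ = g x) →
      (∀ x, ‖x - x₀‖ < 1 → |κ * u x| ≤ 1) → (∀ x, ‖x - x₀‖ < 1 → |g x| ≤ A) →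
      (∀ x y, ‖x - x₀‖ < 1 → ‖y - x₀‖ < 1 → |g x - g y| ≤ Lg * ‖x - y‖) →
      ‖fderiv ℝ u x₀‖ ≤ L := by
  obtain ⟨L, hL⟩ := lgrad0 (m := m) hθ hA hLg
  refine ⟨L, fun u g κ x₀ hu hκ he hκu hgA hgL => ?_⟩
  have hfd : ∀ x, fderiv ℝ (fun z => u (x₀ + z)) x = fderiv ℝ u (x₀ + x) := fun x =>
    fderiv_comp_add_left x₀
  have hlap : ∀ x, lap (fun z => u (x₀ + z)) x = lap u (x₀ + x) := by
    intro x
    rw [lap_eq_trc, lap_eq_trc]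
    have : fderiv ℝ (fun z => u (x₀ + z)) = fun z => fderiv ℝ u (x₀ + z) := funext hfd
    rw [this, fderiv_comp_add_left]
  have hn : ∀ x : Eu m, x₀ + x - x₀ = x := fun x => by abel
  have := hL (fun z => u (x₀ + z)) (fun z => g (x₀ + z)) κ
    (hu.comp (contDiff_const.add contDiff_id)) hκ
    (fun x hx => by rw [hfd, hlap]; exact he _ (by rwa [hn]))
    (fun x hx => hκu _ (by rwa [hn])) (fun x hx => hgA _ (by rwa [hn]))
    (fun x y hx hy => by
      have := hgL (x₀ + x) (x₀ + y) (by rwa [hn]) (by rwa [hn])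
      simpa using this)
  rwa [hfd, add_zero] at this

end LGrad


open Filter Topology MeasureTheory Set
set_option linter.unusedSectionVars false
set_option maxSynthPendingDepth 3

section Rep
variable {m : ℕ}

/-- The right-hand side of the localised equation. -/
noncomputable def Psi (θ : ℝ) (f χ : Eu m → ℝ) (z : Eu m × ℝ × (Eu m →L[ℝ] ℝ) × ℝ) : ℝ :=
  χ z.1 * z.2.1 - (χ z.1 * ((1/θ) * ‖z.2.2.1‖ ^ θ + z.2.2.2 - f z.1) +
    (∑ i, fderiv ℝ χ z.1 (EuclideanSpace.single i 1) * z.2.2.1 (EuclideanSpace.single i 1)) +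
      (1/2) * z.2.1 * lap χ z.1)

lemma rpow_locLip {θ : ℝ} (hθ : 1 < θ) : LocallyLipschitz fun t : ℝ => t ^ θ := by
  have := Real.contDiff_rpow_const_of_le (p := θ) (n := 1) (by simpa using hθ.le)
  have h2 : ContDiff ℝ 1 fun t : ℝ => t ^ θ := by exact_mod_cast this
  exact h2.locallyLipschitz

lemma Psi_lip {θ : ℝ} (hθ : 1 < θ) {f χ : Eu m → ℝ} (hf : LocallyLipschitz f)
    (hχ : ContDiff ℝ 3 χ) : LocallyLipschitz (Psi θ f χ) := by
  have c1 : ContDiff ℝ 2 (fderiv ℝ χ) := hχ.fderiv_right (by norm_num)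
  have c2 : ContDiff ℝ 1 (fderiv ℝ (fderiv ℝ χ)) := c1.fderiv_right (by norm_num)
  have c3 : ContDiff ℝ 1 (lap χ) := by
    have : lap χ = fun x => trc m (fderiv ℝ (fderiv ℝ χ) x) := by
      funext x; exact lap_eq_trc χ x
    rw [this]
    exact (trc m).contDiff.comp c2
  have p1 : ContDiff ℝ 1 (fun z : Eu m × ℝ × (Eu m →L[ℝ] ℝ) × ℝ => z.1) := contDiff_fst
  have p2 : ContDiff ℝ 1 (fun z : Eu m × ℝ × (Eu m →L[ℝ] ℝ) × ℝ => z.2.1) :=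
    contDiff_fst.comp contDiff_snd
  have p3 : ContDiff ℝ 1 (fun z : Eu m × ℝ × (Eu m →L[ℝ] ℝ) × ℝ => z.2.2.1) :=
    contDiff_fst.comp (contDiff_snd.comp contDiff_snd)
  have p4 : ContDiff ℝ 1 (fun z : Eu m × ℝ × (Eu m →L[ℝ] ℝ) × ℝ => z.2.2.2) :=
    contDiff_snd.comp (contDiff_snd.comp contDiff_snd)
  have x1 : ContDiff ℝ 1 (fun z : Eu m × ℝ × (Eu m →L[ℝ] ℝ) × ℝ => χ z.1) :=
    (hχ.of_le (by norm_num)).comp p1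
  have s1 : ContDiff ℝ 1 (fun z : Eu m × ℝ × (Eu m →L[ℝ] ℝ) × ℝ => χ z.1 * z.2.1) := x1.mul p2
  have s2 : ContDiff ℝ 1 (fun z : Eu m × ℝ × (Eu m →L[ℝ] ℝ) × ℝ =>
      ∑ i, fderiv ℝ χ z.1 (EuclideanSpace.single i 1) * z.2.2.1 (EuclideanSpace.single i 1)) := by
    refine ContDiff.sum fun i _ => ContDiff.mul ?_ ?_
    · exact ((c1.of_le (by norm_num)).comp p1).clm_apply contDiff_const
    · exact p3.clm_apply contDiff_const
  have s3 : ContDiff ℝ 1 (fun z : Eu m × ℝ × (Eu m →L[ℝ] ℝ) × ℝ =>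
      (1/2) * z.2.1 * lap χ z.1) := (contDiff_const.mul p2).mul (c3.comp p1)
  have l1 : LocallyLipschitz (fun z : Eu m × ℝ × (Eu m →L[ℝ] ℝ) × ℝ => (1/θ) * ‖z.2.2.1‖ ^ θ) := by
    have n1 : LocallyLipschitz (fun z : Eu m × ℝ × (Eu m →L[ℝ] ℝ) × ℝ => ‖z.2.2.1‖) :=
      (lipschitzWith_one_norm.locallyLipschitz).comp p3.locallyLipschitz
    exact (LocallyLipschitz.const (1/θ)).mul_real ((rpow_locLip hθ).comp n1)
  have l2 : LocallyLipschitz (fun z : Eu m × ℝ × (Eu m →L[ℝ] ℝ) × ℝ => f z.1) :=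
    hf.comp p1.locallyLipschitz
  have l3 := x1.locallyLipschitz.mul_real ((l1.add p4.locallyLipschitz).sub l2)
  exact s1.locallyLipschitz.sub ((l3.add s2.locallyLipschitz).add s3.locallyLipschitz)

lemma lap_mul {χ v : Eu m → ℝ} (hχ : ContDiff ℝ 2 χ) (hv : ContDiff ℝ 2 v) (x : Eu m) :
    lap (fun y => χ y * v y) x = χ x * lap v x +
      2 * (∑ i, fderiv ℝ χ x (EuclideanSpace.single i 1) *
        fderiv ℝ v x (EuclideanSpace.single i 1)) + v x * lap χ x := by
  have d1 : Differentiable ℝ χ := hχ.differentiable (by norm_num)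
  have d2 : Differentiable ℝ v := hv.differentiable (by norm_num)
  have e1 : fderiv ℝ (fun y => χ y * v y) = fun y => χ y • fderiv ℝ v y + v y • fderiv ℝ χ y := by
    funext y; exact fderiv_fun_mul (d1 y) (d2 y)
  have d3 : DifferentiableAt ℝ (fderiv ℝ χ) x :=
    (contDiff_fderiv hχ).differentiable (by norm_num) x
  have d4 : DifferentiableAt ℝ (fderiv ℝ v) x :=
    (contDiff_fderiv hv).differentiable (by norm_num) x
  have e2 : HasFDerivAt (fun y => χ y • fderiv ℝ v y + v y • fderiv ℝ χ y) _ x :=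
    ((d1 x).hasFDerivAt.smul d4.hasFDerivAt).add ((d2 x).hasFDerivAt.smul d3.hasFDerivAt)
  rw [lap_eq, lap_eq, lap_eq, e1, e2.fderiv, Finset.mul_sum, Finset.mul_sum, Finset.mul_sum,
    ← Finset.sum_add_distrib, ← Finset.sum_add_distrib]
  refine Finset.sum_congr rfl fun i _ => ?_
  simp
  ring

lemma Psi_zero {θ : ℝ} {f χ : Eu m → ℝ} {x : Eu m} (h : χ =ᶠ[𝓝 x] fun _ => 0)
    (z : ℝ × (Eu m →L[ℝ] ℝ) × ℝ) : Psi θ f χ (x, z) = 0 := by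
  unfold Psi
  simp only
  rw [h.fderiv_eq, lap_congr h, lap_zero_fun, fderiv_zero_fun, h.self_of_nhds]
  simp

lemma rep {θ : ℝ} (hθ : 1 < θ) {f χ : Eu m → ℝ} (hf : LocallyLipschitz f) (hχ : ContDiff ℝ 3 χ)
    {ρ : ℝ} (hχo : ∀ x, ρ + 2 < ‖x‖ → χ =ᶠ[𝓝 x] fun _ => 0)
    {v t : Eu m → ℝ} (hv : ContDiff ℝ 2 v) (ht : LocallyLipschitz t)
    (he : ∀ x, ‖x‖ ≤ ρ + 2 → lap v x = 2 * ((1/θ) * ‖fderiv ℝ v x‖ ^ θ + t x - f x)) :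
    ∃ b B, Hol b (fun x => Psi θ f χ (x, v x, fderiv ℝ v x, t x)) ∧
      (∀ x, |Psi θ f χ (x, v x, fderiv ℝ v x, t x)| ≤ B) ∧
      Continuous (fun x => Psi θ f χ (x, v x, fderiv ℝ v x, t x)) ∧
      (fun x => χ x * v x) = res 1 1 W (fun x => Psi θ f χ (x, v x, fderiv ℝ v x, t x)) := by
  have hl : LocallyLipschitz (fun x => Psi θ f χ (x, v x, fderiv ℝ v x, t x)) := by
    refine (Psi_lip hθ hf hχ).comp (LocallyLipschitz.id.prodMk
      ((hv.of_le (by norm_num : (1:WithTop ℕ∞) ≤ 2)).locallyLipschitz.prodMk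
        ((contDiff_fderiv hv).locallyLipschitz.prodMk ht)))
  obtain ⟨b, B, hb, hB, h0⟩ := hol_of_compact hl (ρ := ρ + 2) fun x hx => Psi_zero (hχo x hx) _
  refine ⟨b, B, hb, hB, hl.continuous, ?_⟩
  have hχ2 : ContDiff ℝ 2 χ := hχ.of_le (by norm_num)
  have hz : ∀ x, ρ + 2 < ‖x‖ → (fun y => χ y * v y) =ᶠ[𝓝 x] fun _ => 0 := by
    intro x hx
    filter_upwards [hχo x hx] with y hy
    simp [hy]
  refine eq_res one_pos (hχ2.mul hv) ?_ hB hb h0 fun x => ?_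
  · refine tendsto_const_nhds.congr' ?_
    rw [cocompact_eq_comap]
    filter_upwards [preimage_mem_comap (Ioi_mem_atTop (ρ + 2))] with x hx
    exact ((hz x hx).self_of_nhds).symm
  · rcases le_or_gt ‖x‖ (ρ + 2) with hx | hx
    · rw [lap_mul hχ2 hv, he x hx]
      unfold Psi
      ring
    · rw [lap_congr (hz x hx), lap_zero_fun, Psi_zero (hχo x hx), (hχo x hx).self_of_nhds]
      simp

lemma hol_of_compact2 {h : Eu m → ℝ} (hc : Continuous h) {ρ b : ℝ}
    (h0 : ∀ x, ρ < ‖x‖ → h x = 0)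
    (hb : ∀ x y, ‖x‖ ≤ ρ + 1 → ‖y‖ ≤ ρ + 1 → |h x - h y| ≤ b * √‖x - y‖) :
    ∃ b B, Hol b h ∧ (∀ x, |h x| ≤ B) := by
  have hcomp : IsCompact (Metric.closedBall (0 : Eu m) (ρ + 1)) := isCompact_closedBall _ _
  obtain ⟨B, hB⟩ := hcomp.exists_bound_of_continuousOn hc.continuousOn
  have hB' : ∀ x, |h x| ≤ |B| := by
    intro x
    by_cases hx : ‖x‖ ≤ ρ + 1
    · exact (hB x (by simpa using hx)).trans (le_abs_self _)
    · rw [h0 x (by linarith)]; simp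
  refine ⟨|b| + 2 * |B|, |B|, fun x y => ?_, hB'⟩
  have hs := Real.sqrt_nonneg ‖x - y‖
  rcases le_total ‖x - y‖ 1 with hr | hr
  · have hmain : ‖h x - h y‖ ≤ |b| * √‖x - y‖ := by
      by_cases hxy : ‖x‖ ≤ ρ + 1 ∧ ‖y‖ ≤ ρ + 1
      · exact (hb x y hxy.1 hxy.2).trans (by gcongr; exact le_abs_self b)
      · have h3 : ‖x‖ ≤ ‖y‖ + ‖x - y‖ := norm_le_norm_add_norm_sub' x y
        have h4 : ‖y‖ ≤ ‖x‖ + ‖x - y‖ := norm_le_norm_add_norm_sub x y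
        have : h x = 0 ∧ h y = 0 := by
          rw [not_and_or] at hxy
          rcases hxy with hx | hy
          · exact ⟨h0 x (by linarith), h0 y (by linarith)⟩
          · exact ⟨h0 x (by linarith), h0 y (by linarith)⟩
        rw [this.1, this.2]; simp; positivity
    nlinarith [abs_nonneg B]
  · have h1 : 1 ≤ √‖x - y‖ := Real.one_le_sqrt.2 hr
    have h2 : ‖h x - h y‖ ≤ |h x| + |h y| := norm_sub_le _ _
    have h3 := hB' x
    have h4 := hB' y
    have h5 : 0 ≤ |b| * √‖x - y‖ := by positivity
    nlinarith [abs_nonneg B]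

end Rep


open Filter Topology MeasureTheory Set
set_option linter.unusedSectionVars false
set_option maxSynthPendingDepth 3

section Lim
variable {m : ℕ}

lemma lip_on_ball {f : Eu m → ℝ} (hf : LocallyLipschitz f) (ρ : ℝ) : ∃ A Lg : ℝ, 0 ≤ A ∧ 0 ≤ Lg ∧
    (∀ x, ‖x‖ ≤ ρ → |f x| ≤ A) ∧
    (∀ x y, ‖x‖ ≤ ρ → ‖y‖ ≤ ρ → |f x - f y| ≤ Lg * ‖x - y‖) := by
  have hcomp : IsCompact (Metric.closedBall (0 : Eu m) ρ) := isCompact_closedBall _ _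
  obtain ⟨A, hA⟩ := hcomp.exists_bound_of_continuousOn hf.continuous.continuousOn
  obtain ⟨K, hK⟩ := (hf.locallyLipschitzOn (s := Metric.closedBall (0 : Eu m) ρ)
    ).exists_lipschitzOnWith_of_compact hcomp
  refine ⟨|A|, K, abs_nonneg _, K.2, fun x hx => ?_, fun x y hx hy => ?_⟩
  · exact (hA x (by simpa using hx)).trans (le_abs_self _)
  · have := hK.dist_le_mul x (by simpa using hx) y (by simpa using hy)
    rwa [Real.dist_eq, dist_eq_norm] at this

lemma grad_bound {θ : ℝ} (hθ : 1 < θ) {f : Eu m → ℝ} (hf : LocallyLipschitz f)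
    {κ : ℕ → ℝ} {u : ℕ → Eu m → ℝ} (hκ : ∀ N, 0 < κ N) (hu : ∀ N, ContDiff ℝ 2 (u N))
    (hb : ∀ N x, |κ N * u N x| ≤ 1 / ((N : ℝ) + 1))
    (he : ∀ (N : ℕ) x, ‖x‖ ≤ N →
      κ N * u N x - (1/2) * lap (u N) x + (1/θ) * ‖fderiv ℝ (u N) x‖ ^ θ = f x) (ρ : ℝ) :
    ∃ L : ℝ, 0 ≤ L ∧ ∀ N : ℕ, ρ + 1 ≤ N → ∀ x, ‖x‖ ≤ ρ → ‖fderiv ℝ (u N) x‖ ≤ L := by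
  obtain ⟨A, Lg, hA, hLg, h1, h2⟩ := lip_on_ball hf (ρ + 1)
  obtain ⟨L, hL⟩ := lgrad (m := m) hθ hA hLg
  refine ⟨|L|, abs_nonneg _, fun N hN x₀ hx₀ => ?_⟩
  have key : ∀ x, ‖x - x₀‖ < 1 → ‖x‖ ≤ ρ + 1 := fun x hx => by
    have : ‖x‖ ≤ ‖x - x₀‖ + ‖x₀‖ := by simpa using norm_add_le (x - x₀) x₀
    linarith
  refine (hL (u N) f (κ N) x₀ (hu N) (hκ N).le (fun x hx => he N x ((key x hx).trans hN))
    (fun x hx => (hb N x).trans ?_) (fun x hx => h1 x (key x hx))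
    (fun x y hx hy => h2 x y (key x hx) (key y hy))).trans (le_abs_self _)
  rw [div_le_one (by positivity)]
  have : (0:ℝ) ≤ N := Nat.cast_nonneg N
  linarith

lemma lip_of_grad {u : Eu m → ℝ} (hu : ContDiff ℝ 2 u) {ρ L : ℝ}
    (h : ∀ x, ‖x‖ ≤ ρ → ‖fderiv ℝ u x‖ ≤ L) {x y : Eu m} (hx : ‖x‖ ≤ ρ) (hy : ‖y‖ ≤ ρ) :
    |u x - u y| ≤ L * ‖x - y‖ := by
  have hd : Differentiable ℝ u := hu.differentiable (by norm_num)
  have := (convex_closedBall (0 : Eu m) ρ).norm_image_sub_le_of_norm_fderiv_le (f := u) (C := L)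
    (𝕜 := ℝ) (fun z _ => hd z) (fun z hz => h z (by simpa using hz))
    (x := y) (y := x) (by simpa using hy) (by simpa using hx)
  simpa using this

/-- Uniform bound for the localised right-hand sides. -/
lemma Psi_bound {θ : ℝ} (hθ : 1 < θ) {f χ : Eu m → ℝ} (hf : LocallyLipschitz f)
    (hχ : ContDiff ℝ 3 χ) {ρ : ℝ}
    (hχo : ∀ x, ρ < ‖x‖ → χ =ᶠ[𝓝 x] fun _ => 0) (M : ℝ) :
    ∃ B : ℝ, 0 ≤ B ∧ ∀ (v t : Eu m → ℝ) (p : Eu m → (Eu m →L[ℝ] ℝ)),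
      (∀ x, ‖x‖ ≤ ρ → |v x| ≤ M) → (∀ x, ‖x‖ ≤ ρ → ‖p x‖ ≤ M) →
      (∀ x, ‖x‖ ≤ ρ → |t x| ≤ M) → ∀ x, |Psi θ f χ (x, v x, p x, t x)| ≤ B := by
  have hcomp : IsCompact (Metric.closedBall (0 : Eu m × ℝ × (Eu m →L[ℝ] ℝ) × ℝ) (max ρ M)) :=
    isCompact_closedBall _ _
  obtain ⟨B, hB⟩ := hcomp.exists_bound_of_continuousOn
    (Psi_lip hθ hf hχ).continuous.continuousOn
  refine ⟨|B|, abs_nonneg _, fun v t p h1 h2 h3 x => ?_⟩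
  by_cases hx : ‖x‖ ≤ ρ
  · refine (hB _ ?_).trans (le_abs_self _)
    rw [mem_closedBall_zero_iff]
    simp only [Prod.norm_def, sup_le_iff, Real.norm_eq_abs]
    exact ⟨hx.trans (le_max_left _ _), (h1 x hx).trans (le_max_right _ _),
      (h2 x hx).trans (le_max_right _ _), (h3 x hx).trans (le_max_right _ _)⟩
  · rw [Psi_zero (hχo x (not_le.1 hx))]
    simp

/-- Uniform Hölder bound for the gradients. -/
lemma hol_bound {θ : ℝ} (hθ : 1 < θ) {f : Eu m → ℝ} (hf : LocallyLipschitz f)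
    {v t : ℕ → Eu m → ℝ} (hv : ∀ N, ContDiff ℝ 2 (v N)) (ht : ∀ N, LocallyLipschitz (t N))
    (htb : ∀ N x, |t N x| ≤ 1) (hv0 : ∀ N, v N 0 = 0)
    (he : ∀ (N : ℕ) x, ‖x‖ ≤ N →
      lap (v N) x = 2 * ((1/θ) * ‖fderiv ℝ (v N) x‖ ^ θ + t N x - f x))
    (hG : ∀ ρ : ℝ, ∃ L : ℝ, 0 ≤ L ∧ ∀ N : ℕ, ρ + 1 ≤ N → ∀ x, ‖x‖ ≤ ρ → ‖fderiv ℝ (v N) x‖ ≤ L)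
    {ρ : ℝ} (hρ : 0 ≤ ρ) :
    ∃ b : ℝ, 0 ≤ b ∧ ∀ N : ℕ, ρ + 3 ≤ N → ∀ x y, ‖x‖ ≤ ρ → ‖y‖ ≤ ρ →
      ‖fderiv ℝ (v N) x - fderiv ℝ (v N) y‖ ≤ b * √‖x - y‖ := by
  obtain ⟨χ, hχ, hχ0, hχ1, hχi, hχo⟩ := exists_cut m hρ
  obtain ⟨L, hL0, hL⟩ := hG (ρ + 2)
  obtain ⟨B, hB0, hB⟩ := Psi_bound hθ hf hχ hχo (max (max L (L * (ρ + 2))) 1)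
  refine ⟨B * (2 * (∫ z : Eu m, ‖W1 z‖) + ∫ z : Eu m, ‖W2 z‖) * J 1 (-(1/2)), ?_,
    fun N hN => ?_⟩
  · have := J_nonneg (κ := 1) (j := -(1/2))
    have h1 : 0 ≤ ∫ z : Eu m, ‖W1 z‖ := integral_nonneg fun _ => norm_nonneg _
    have h2 : 0 ≤ ∫ z : Eu m, ‖W2 z‖ := integral_nonneg fun _ => norm_nonneg _
    positivity
  have hgr : ∀ x, ‖x‖ ≤ ρ + 2 → ‖fderiv ℝ (v N) x‖ ≤ L := hL N (by linarith)
  obtain ⟨b', B', -, -, hc, hrep⟩ := rep hθ hf hχ hχo (hv N) (ht N) (fun x hx => he N x (by linarith))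
  have hb := hB (v N) (t N) (fderiv ℝ (v N)) (fun x hx => by
      have := lip_of_grad (hv N) hgr hx (y := 0) (by rw [norm_zero]; linarith)
      rw [hv0, sub_zero, sub_zero] at this
      exact (this.trans (mul_le_mul_of_nonneg_left hx hL0)).trans
        ((le_max_right _ _).trans (le_max_left _ _)))
    (fun x hx => (hgr x hx).trans ((le_max_left _ _).trans (le_max_left _ _)))
    (fun x hx => (htb N x).trans (le_max_right _ _))
  have hh := res_hol one_pos hc hb
  have hfd : ∀ x, ‖x‖ ≤ ρ → fderiv ℝ (v N) x =
      res 1 0 W1 (fun x => Psi θ f χ (x, v N x, fderiv ℝ (v N) x, t N x)) x := fun x hx => by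
    have h1 := (res_grad one_pos hc hb x).fderiv
    rw [← h1, ← hrep]
    refine Filter.EventuallyEq.fderiv_eq ?_
    filter_upwards [hχi x (by linarith)] with y hy
    rw [hy, one_mul]
  intro x y hx hy
  rw [hfd x hx, hfd y hy]
  exact hh x y

end Lim


open Filter Topology MeasureTheory Set
set_option linter.unusedSectionVars false
set_option maxSynthPendingDepth 3

section Lim2
variable {m : ℕ} {F : Type*} [NormedAddCommGroup F]

lemma hyp_of_atTop {P : ℕ → Prop} (h : ∀ᶠ N in atTop, P N) : ∀ᶠ N in (hyperfilter ℕ : Filter ℕ), P N :=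
  Nat.hyperfilter_le_atTop h

lemma ultra_lim [ProperSpace F] {g : ℕ → F} {C : ℝ} (h : ∀ᶠ N in atTop, ‖g N‖ ≤ C) :
    ∃ l, Tendsto g (hyperfilter ℕ : Filter ℕ) (𝓝 l) := by
  have hc : IsCompact (Metric.closedBall (0 : F) C) := isCompact_closedBall _ _
  obtain ⟨l, -, hl⟩ := isCompact_iff_ultrafilter_le_nhds.1 hc ((hyperfilter ℕ).map g) (by
    rw [le_principal_iff]
    have h2 := hyp_of_atTop h
    have h3 : ∀ᶠ N in (hyperfilter ℕ : Filter ℕ), g N ∈ Metric.closedBall (0 : F) C := by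
      filter_upwards [h2] with N hN
      simpa using hN
    exact h3)
  exact ⟨l, hl⟩

/-- Local Hölder bounds, uniform along a filter. -/
def UHol (g : ℕ → Eu m → F) : Prop := ∀ ρ : ℝ, ∃ b : ℝ, 0 ≤ b ∧ ∀ᶠ N in atTop,
  ∀ x y, ‖x‖ ≤ ρ → ‖y‖ ≤ ρ → ‖g N x - g N y‖ ≤ b * √‖x - y‖

/-- Local Hölder bounds. -/
def LHol (l : Eu m → F) : Prop := ∀ ρ : ℝ, ∃ b : ℝ, 0 ≤ b ∧
  ∀ x y, ‖x‖ ≤ ρ → ‖y‖ ≤ ρ → ‖l x - l y‖ ≤ b * √‖x - y‖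

lemma UHol.lim {g : ℕ → Eu m → F} {l : Eu m → F} (hg : UHol g)
    (hl : ∀ x, Tendsto (fun N => g N x) (hyperfilter ℕ : Filter ℕ) (𝓝 (l x))) : LHol l := by
  intro ρ
  obtain ⟨b, hb0, hb⟩ := hg ρ
  refine ⟨b, hb0, fun x y hx hy => ?_⟩
  refine le_of_tendsto ((hl x).sub (hl y)).norm ?_
  filter_upwards [hyp_of_atTop hb] with N hN using hN x y hx hy

lemma sqrt_small (x₀ : Eu m) (b : ℝ) : Tendsto (fun x => b * √‖x - x₀‖) (𝓝 x₀) (𝓝 0) := by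
  have : Continuous (fun y : Eu m => b * √‖y - x₀‖) := by fun_prop
  simpa using this.tendsto x₀

lemma near_ball (x₀ : Eu m) : ∀ᶠ x in 𝓝 x₀, ‖x‖ ≤ ‖x₀‖ + 1 := by
  filter_upwards [continuous_norm.continuousAt.eventually (gt_mem_nhds (lt_add_one ‖x₀‖))]
    with x hx using le_of_lt hx

lemma LHol.continuous {l : Eu m → F} (h : LHol l) : Continuous l := by
  rw [continuous_iff_continuousAt]
  intro x₀
  obtain ⟨b, hb0, hb⟩ := h (‖x₀‖ + 1)
  rw [ContinuousAt, tendsto_iff_norm_sub_tendsto_zero]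
  refine squeeze_zero' (Eventually.of_forall fun _ => norm_nonneg _) ?_ (sqrt_small x₀ b)
  filter_upwards [near_ball x₀] with x hx using hb x x₀ hx (by linarith)

lemma UHol.joint {g : ℕ → Eu m → F} {l : Eu m → F} (hg : UHol g)
    (hl : ∀ x, Tendsto (fun N => g N x) (hyperfilter ℕ : Filter ℕ) (𝓝 (l x))) (x₀ : Eu m) :
    Tendsto (fun q : ℕ × Eu m => g q.1 q.2) ((hyperfilter ℕ : Filter ℕ) ×ˢ 𝓝 x₀)
      (𝓝 (l x₀)) := by
  obtain ⟨b, hb0, hb⟩ := hg (‖x₀‖ + 1)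
  have h1 : Tendsto (fun q : ℕ × Eu m => g q.1 x₀) ((hyperfilter ℕ : Filter ℕ) ×ˢ 𝓝 x₀)
      (𝓝 (l x₀)) := (hl x₀).comp tendsto_fst
  have h2 : Tendsto (fun q : ℕ × Eu m => g q.1 q.2 - g q.1 x₀)
      ((hyperfilter ℕ : Filter ℕ) ×ˢ 𝓝 x₀) (𝓝 0) := by
    rw [tendsto_zero_iff_norm_tendsto_zero]
    refine squeeze_zero' (Eventually.of_forall fun _ => norm_nonneg _) ?_
      ((sqrt_small x₀ b).comp tendsto_snd)
    filter_upwards [(hyp_of_atTop hb).prod_mk (near_ball x₀)] with q hq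
    exact hq.1 q.2 x₀ hq.2 (by linarith)
  simpa using h2.add h1

/-- Uniform convergence of compactly supported functions from joint convergence. -/
lemma unif_of_joint {h : ℕ → Eu m → ℝ} {l : Eu m → ℝ} (hc : Continuous l) {ρ : ℝ}
    (hz : ∀ N x, ρ < ‖x‖ → h N x = l x)
    (hj : ∀ x₀, Tendsto (fun q : ℕ × Eu m => h q.1 q.2) ((hyperfilter ℕ : Filter ℕ) ×ˢ 𝓝 x₀)
      (𝓝 (l x₀))) {ε : ℝ} (hε : 0 < ε) :
    ∀ᶠ N in (hyperfilter ℕ : Filter ℕ), ∀ x, |h N x - l x| ≤ ε := by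
  have hcomp : IsCompact (Metric.closedBall (0 : Eu m) ρ) := isCompact_closedBall _ _
  have key : ∀ᶠ N in (hyperfilter ℕ : Filter ℕ), ∀ x ∈ Metric.closedBall (0 : Eu m) ρ,
      |h N x - l x| < ε := by
    refine hcomp.induction_on (p := fun s => ∀ᶠ N in (hyperfilter ℕ : Filter ℕ), ∀ x ∈ s,
      |h N x - l x| < ε) (by simp) (fun s t hst ht => ht.mono fun N hN x hx => hN x (hst hx))
      (fun s t hs ht => by
        filter_upwards [hs, ht] with N h1 h2 x hx using hx.elim (h1 x) (h2 x)) fun x₀ _ => ?_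
    have h1 : Tendsto (fun q : ℕ × Eu m => |h q.1 q.2 - l q.2|)
        ((hyperfilter ℕ : Filter ℕ) ×ˢ 𝓝 x₀) (𝓝 0) := by
      simpa using ((hj x₀).sub ((hc.tendsto x₀).comp tendsto_snd)).abs
    obtain ⟨P, hP, Q, hQ, hPQ⟩ := eventually_prod_iff.1 (h1.eventually (gt_mem_nhds hε))
    refine ⟨{x | Q x}, mem_nhdsWithin_of_mem_nhds hQ, ?_⟩
    filter_upwards [hP] with N hN x hx using hPQ hN hx
  filter_upwards [key] with N hN x
  by_cases hx : ‖x‖ ≤ ρ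
  · exact (hN x (by simpa using hx)).le
  · rw [hz N x (not_le.1 hx)]
    simpa using hε.le

lemma res_lim {h : ℕ → Eu m → ℝ} {l : Eu m → ℝ} (hc : Continuous l) {B : ℝ}
    (hB : ∀ x, |l x| ≤ B)
    (hh : ∀ᶠ N in (hyperfilter ℕ : Filter ℕ), Continuous (h N) ∧ ∃ B, ∀ x, |h N x| ≤ B)
    (hu : ∀ ε > 0, ∀ᶠ N in (hyperfilter ℕ : Filter ℕ), ∀ x, |h N x - l x| ≤ ε)
    {E : Type*} [NormedAddCommGroup E] [NormedSpace ℝ E] [CompleteSpace E] {V : Eu m → E}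
    (hV : GK V) {j : ℝ} (hj : -1 < j) (x : Eu m) :
    Tendsto (fun N => res 1 j V (h N) x) (hyperfilter ℕ : Filter ℕ) (𝓝 (res 1 j V l x)) := by
  rw [tendsto_iff_norm_sub_tendsto_zero]
  set K := (∫ z : Eu m, ‖V z‖) * J 1 (j + 0)
  have hK : 0 ≤ K := mul_nonneg (integral_nonneg fun _ => norm_nonneg _) (J_nonneg _ _)
  rw [Metric.tendsto_nhds]
  intro ε hε
  have hδ : 0 < ε / (2 * (K + 1)) := by positivity
  filter_upwards [hh, hu _ hδ] with N hN hN2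
  obtain ⟨hcN, BN, hBN⟩ := hN
  rw [← res_sub one_pos hj hV hcN hc hBN hB x]
  have := res_norm_le (κ := 1) one_pos (j := j) (a := 0) (by linarith)
    (avg_bound0 (h := fun y => h N y - l y) hV hN2) x
  rw [dist_zero_right, norm_norm]
  refine this.trans_lt ?_
  have e : ε / (2 * (K + 1)) * (∫ z : Eu m, ‖V z‖) * J 1 (j + 0) = ε * (K / (2 * (K + 1))) := by
    simp only [K]; ring
  rw [e]
  have : K / (2 * (K + 1)) < 1 := by
    rw [div_lt_one (by positivity)]; linarith
  nlinarith

end Lim2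


open Filter Topology MeasureTheory Set
set_option linter.unusedSectionVars false
set_option maxSynthPendingDepth 3

section Lim3
variable {m : ℕ} {F G : Type*} [NormedAddCommGroup F] [NormedAddCommGroup G]

lemma norm_le_sqrt {x y : Eu m} {ρ : ℝ} (hx : ‖x‖ ≤ ρ) (hy : ‖y‖ ≤ ρ) :
    ‖x - y‖ ≤ √(2 * ρ) * √‖x - y‖ := by
  have h1 : ‖x - y‖ ≤ 2 * ρ := (norm_sub_le _ _).trans (by linarith)
  have h2 := Real.mul_self_sqrt (norm_nonneg (x - y))
  have h3 := Real.sqrt_le_sqrt h1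
  calc ‖x - y‖ = √‖x - y‖ * √‖x - y‖ := h2.symm
    _ ≤ _ := mul_le_mul_of_nonneg_right h3 (Real.sqrt_nonneg _)

lemma LHol.id : LHol (fun x : Eu m => x) := fun ρ =>
  ⟨√(2 * ρ), Real.sqrt_nonneg _, fun _ _ hx hy => norm_le_sqrt hx hy⟩

lemma LHol.const (c : F) : LHol (fun _ : Eu m => c) := fun ρ =>
  ⟨0, le_rfl, fun _ _ _ _ => by simp⟩

lemma LHol.prodMk {k : Eu m → F} {l : Eu m → G} (hk : LHol k) (hl : LHol l) :
    LHol (fun x => (k x, l x)) := by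
  intro ρ
  obtain ⟨a, ha0, ha⟩ := hk ρ
  obtain ⟨b, hb0, hb⟩ := hl ρ
  refine ⟨max a b, ha0.trans (le_max_left _ _), fun x y hx hy => ?_⟩
  rw [Prod.mk_sub_mk, Prod.norm_def]
  refine max_le ((ha x y hx hy).trans ?_) ((hb x y hx hy).trans ?_)
  · exact mul_le_mul_of_nonneg_right (le_max_left _ _) (Real.sqrt_nonneg _)
  · exact mul_le_mul_of_nonneg_right (le_max_right _ _) (Real.sqrt_nonneg _)

lemma LHol.comp_lip {k : Eu m → F} (hk : LHol k) {g : F → ℝ} (hg : LocallyLipschitz g) :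
    LHol (fun x => g (k x)) := by
  intro ρ
  obtain ⟨a, ha0, ha⟩ := hk ρ
  have hcomp : IsCompact (Set.image k (Metric.closedBall (0 : Eu m) ρ)) :=
    (isCompact_closedBall _ _).image hk.continuous
  obtain ⟨K, hK⟩ := (hg.locallyLipschitzOn (s := Set.image k (Metric.closedBall (0 : Eu m) ρ))
    ).exists_lipschitzOnWith_of_compact hcomp
  refine ⟨K * a, mul_nonneg K.2 ha0, fun x y hx hy => ?_⟩
  have := hK.dist_le_mul (k x) (mem_image_of_mem _ (by simpa using hx)) (k y)
    (mem_image_of_mem _ (by simpa using hy))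
  rw [dist_eq_norm, dist_eq_norm] at this
  rw [mul_assoc]
  exact this.trans (mul_le_mul_of_nonneg_left (ha x y hx hy) K.2)

lemma t_small {t : ℕ → Eu m → ℝ} (htb : ∀ N x, |t N x| ≤ 1 / ((N : ℝ) + 1)) (x₀ : Eu m) :
    Tendsto (fun q : ℕ × Eu m => t q.1 q.2) ((hyperfilter ℕ : Filter ℕ) ×ˢ 𝓝 x₀) (𝓝 0) := by
  rw [tendsto_zero_iff_norm_tendsto_zero]
  have h1 : Tendsto (fun N : ℕ => 1 / ((N : ℝ) + 1)) (hyperfilter ℕ : Filter ℕ) (𝓝 0) :=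
    tendsto_one_div_add_atTop_nhds_zero_nat.mono_left Nat.hyperfilter_le_atTop
  exact squeeze_zero (fun _ => norm_nonneg _) (fun q => htb q.1 q.2) (h1.comp tendsto_fst)

/-- The limit solves the equation locally. -/
lemma local_limit {θ : ℝ} (hθ : 1 < θ) {f : Eu m → ℝ} (hf : LocallyLipschitz f)
    {v t : ℕ → Eu m → ℝ} (hv : ∀ N, ContDiff ℝ 2 (v N)) (ht : ∀ N, LocallyLipschitz (t N))
    (htb : ∀ N x, |t N x| ≤ 1 / ((N : ℝ) + 1))
    (he : ∀ (N : ℕ) x, ‖x‖ ≤ N →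
      lap (v N) x = 2 * ((1/θ) * ‖fderiv ℝ (v N) x‖ ^ θ + t N x - f x))
    (hvU : UHol v) (hpU : UHol fun N => fderiv ℝ (v N))
    {w : Eu m → ℝ} {p : Eu m → (Eu m →L[ℝ] ℝ)}
    (hw : ∀ x, Tendsto (fun N => v N x) (hyperfilter ℕ : Filter ℕ) (𝓝 (w x)))
    (hp : ∀ x, Tendsto (fun N => fderiv ℝ (v N) x) (hyperfilter ℕ : Filter ℕ) (𝓝 (p x)))
    (x₀ : Eu m) :
    ContDiffAt ℝ 2 w x₀ ∧ -(1/2) * lap w x₀ + (1/θ) * ‖fderiv ℝ w x₀‖ ^ θ = f x₀ := by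
  obtain ⟨χ, hχ, hχ0, hχ1, hχi, hχo⟩ := exists_cut m (norm_nonneg x₀)
  set ρ := ‖x₀‖ with hρ
  have hP := Psi_lip hθ hf hχ
  have hwH : LHol w := hvU.lim hw
  have hpH : LHol p := hpU.lim hp
  set h : Eu m → ℝ := fun x => Psi θ f χ (x, w x, p x, 0) with hh
  set hN : ℕ → Eu m → ℝ := fun N x => Psi θ f χ (x, v N x, fderiv ℝ (v N) x, t N x) with hhN
  have hhH : LHol h :=
    (LHol.id.prodMk (hwH.prodMk (hpH.prodMk (LHol.const (0:ℝ))))).comp_lip hP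
  have hhc : Continuous h := hhH.continuous
  obtain ⟨b0, -, hb0⟩ := hhH (ρ + 2 + 1)
  obtain ⟨b, B, hb, hB⟩ := hol_of_compact2 hhc (ρ := ρ + 2)
    (fun x hx => Psi_zero (hχo x hx) _) hb0
  have hjoint : ∀ y, Tendsto (fun q : ℕ × Eu m => hN q.1 q.2)
      ((hyperfilter ℕ : Filter ℕ) ×ˢ 𝓝 y) (𝓝 (h y)) := fun y => by
    have h1 : Tendsto (fun q : ℕ × Eu m => q.2) ((hyperfilter ℕ : Filter ℕ) ×ˢ 𝓝 y) (𝓝 y) :=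
      tendsto_snd
    have h2 := h1.prodMk_nhds ((hvU.joint hw y).prodMk_nhds
      ((hpU.joint hp y).prodMk_nhds (t_small htb y)))
    exact (hP.continuous.tendsto _).comp h2
  have hunif : ∀ ε > 0, ∀ᶠ N in (hyperfilter ℕ : Filter ℕ), ∀ x, |hN N x - h x| ≤ ε :=
    fun ε hε => unif_of_joint hhc (ρ := ρ + 2) (fun N x hx => by
      rw [hhN, hh]
      simp only
      rw [Psi_zero (hχo x hx), Psi_zero (hχo x hx)]) hjoint hε
  have hrep : ∀ᶠ N : ℕ in (hyperfilter ℕ : Filter ℕ), (Continuous (hN N) ∧ ∃ B, ∀ x, |hN N x| ≤ B) ∧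
      (fun x => χ x * v N x) = res 1 1 W (hN N) := by
    refine hyp_of_atTop ?_
    filter_upwards [eventually_ge_atTop ⌈ρ + 2⌉₊] with N hNge
    have hNge' : ρ + 2 ≤ N := Nat.ceil_le.1 hNge
    obtain ⟨b', B', -, hB', hc, hr⟩ := rep hθ hf hχ hχo (hv N) (ht N)
      (fun x hx => he N x (by linarith))
    exact ⟨⟨hc, B', hB'⟩, hr⟩
  have hcb := hrep.mono fun N hN => hN.1
  have e1 : (fun x => χ x * w x) = res 1 1 W h := by
    funext x
    have h1 := res_lim hhc hB hcb hunif gkW (j := 1) (by norm_num) x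
    have h2 : Tendsto (fun N => χ x * v N x) (hyperfilter ℕ : Filter ℕ) (𝓝 (χ x * w x)) :=
      (hw x).const_mul _
    refine tendsto_nhds_unique (h2.congr' ?_) h1
    filter_upwards [hrep] with N hN
    exact congrFun hN.2 x
  have e2 : p x₀ = res 1 0 W1 h x₀ := by
    have h1 := res_lim hhc hB hcb hunif gkW1 (j := 0) (by norm_num) x₀
    refine tendsto_nhds_unique ((hp x₀).congr' ?_) h1
    filter_upwards [hrep] with N hN
    obtain ⟨⟨hc, B', hB'⟩, hr⟩ := hN
    have h1 := (res_grad one_pos hc hB' x₀).fderiv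
    rw [← h1, ← hr]
    refine Filter.EventuallyEq.fderiv_eq ?_
    filter_upwards [hχi x₀ (by linarith)] with y hy
    rw [hy, one_mul]
  have hwe : w =ᶠ[𝓝 x₀] res 1 1 W h := by
    rw [← e1]
    filter_upwards [hχi x₀ (by linarith)] with y hy
    rw [hy, one_mul]
  have hfd : fderiv ℝ w x₀ = p x₀ := by
    rw [hwe.fderiv_eq, (res_grad one_pos hhc hB x₀).fderiv, e2]
  refine ⟨((res_contDiff one_pos hhc hB hb).contDiffAt).congr_of_eventuallyEq hwe, ?_⟩
  have heq := res_eq one_pos hhc hB hb x₀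
  rw [← lap_congr hwe, ← hwe.eq_of_nhds] at heq
  have hχe := hχi x₀ (by linarith)
  have hx1 : χ x₀ = 1 := hχe.eq_of_nhds
  have hx2 : fderiv ℝ χ x₀ = 0 := by rw [hχe.fderiv_eq]; simp
  have hx3 : lap χ x₀ = 0 := by
    rw [lap_congr hχe, lap_eq_trc]
    have : fderiv ℝ (fun _ : Eu m => (1:ℝ)) = fun _ => 0 := by funext y; simp
    rw [this]
    simp
  have hhx : h x₀ = w x₀ - ((1/θ) * ‖p x₀‖ ^ θ - f x₀) := by
    rw [hh]
    simp [Psi, hx1, hx2, hx3]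
  rw [hhx] at heq
  rw [hfd]
  linarith

lemma limit_exists {θ : ℝ} (hθ : 1 < θ) {f : Eu m → ℝ} (hf : LocallyLipschitz f)
    (hap : ∀ R ε : ℝ, 0 ≤ R → 0 < ε → ∃ κ : ℝ, ∃ u : Eu m → ℝ, 0 < κ ∧ ContDiff ℝ 2 u ∧
      (∀ x, |κ * u x| ≤ ε) ∧
      ∀ x, ‖x‖ ≤ R → κ * u x - (1/2) * lap u x + (1/θ) * ‖fderiv ℝ u x‖ ^ θ = f x) :
    ∃ w : Eu m → ℝ, ContDiff ℝ 2 w ∧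
      ∀ x, -(1/2) * lap w x + (1/θ) * ‖fderiv ℝ w x‖ ^ θ = f x := by
  choose κ u hκ hu hb he using fun N : ℕ =>
    hap N (1 / ((N : ℝ) + 1)) (Nat.cast_nonneg N) (by positivity)
  set v : ℕ → Eu m → ℝ := fun N x => u N x - u N 0 with hvdef
  have hfd : ∀ N x, fderiv ℝ (v N) x = fderiv ℝ (u N) x := fun N x => by
    simp only [hvdef]
    rw [fderiv_sub_const]
  have hfd' : ∀ N, fderiv ℝ (v N) = fderiv ℝ (u N) := fun N => funext (hfd N)
  have hlap : ∀ N x, lap (v N) x = lap (u N) x := fun N x => by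
    rw [lap_eq_trc, lap_eq_trc, hfd']
  have hv : ∀ N, ContDiff ℝ 2 (v N) := fun N => (hu N).sub contDiff_const
  have ht : ∀ N, LocallyLipschitz (fun x => κ N * u N x) := fun N =>
    ((contDiff_const.mul (hu N)).of_le (by norm_num : (1 : WithTop ℕ∞) ≤ 2)).locallyLipschitz
  have hG0 := grad_bound hθ hf hκ hu hb he
  have hG : ∀ ρ : ℝ, ∃ L : ℝ, 0 ≤ L ∧ ∀ N : ℕ, ρ + 1 ≤ N → ∀ x, ‖x‖ ≤ ρ →
      ‖fderiv ℝ (v N) x‖ ≤ L := fun ρ => by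
    simpa only [hfd] using hG0 ρ
  have he' : ∀ (N : ℕ) x, ‖x‖ ≤ N →
      lap (v N) x = 2 * ((1/θ) * ‖fderiv ℝ (v N) x‖ ^ θ + κ N * u N x - f x) := fun N x hx => by
    rw [hlap, hfd]
    have := he N x hx
    linarith
  have hv0 : ∀ N, v N 0 = 0 := fun N => by simp [hvdef]
  have hb1 : ∀ N x, |κ N * u N x| ≤ 1 := fun N x => (hb N x).trans (by
    rw [div_le_one (by positivity)]
    have : (0:ℝ) ≤ N := Nat.cast_nonneg N
    linarith)
  have hev : ∀ r : ℝ, ∀ᶠ N : ℕ in atTop, r ≤ N := fun r =>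
    tendsto_natCast_atTop_atTop.eventually_ge_atTop r
  have hvU : UHol v := fun ρ => by
    obtain ⟨L, hL0, hL⟩ := hG ρ
    refine ⟨L * √(2 * ρ), by positivity, ?_⟩
    filter_upwards [hev (ρ + 1)] with N hN x y hx hy
    rw [mul_assoc]
    exact (lip_of_grad (hv N) (hL N hN) hx hy).trans
      (mul_le_mul_of_nonneg_left (norm_le_sqrt hx hy) hL0)
  have hpU : UHol fun N => fderiv ℝ (v N) := fun ρ => by
    obtain ⟨b, hb0, hb⟩ := hol_bound hθ hf hv ht hb1 hv0 he' hG (abs_nonneg ρ)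
    refine ⟨b, hb0, ?_⟩
    filter_upwards [hev (|ρ| + 3)] with N hN x y hx hy
    exact hb N hN x y (hx.trans (le_abs_self _)) (hy.trans (le_abs_self _))
  have hw : ∀ x, ∃ l, Tendsto (fun N => v N x) (hyperfilter ℕ : Filter ℕ) (𝓝 l) := fun x => by
    obtain ⟨L, hL0, hL⟩ := hG ‖x‖
    refine ultra_lim (C := L * ‖x‖) ?_
    filter_upwards [hev (‖x‖ + 1)] with N hN
    have := lip_of_grad (hv N) (hL N hN) (x := x) (y := 0) le_rfl (by simp)
    rwa [hv0, sub_zero, sub_zero] at this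
  have hp : ∀ x, ∃ l, Tendsto (fun N => fderiv ℝ (v N) x) (hyperfilter ℕ : Filter ℕ) (𝓝 l) :=
    fun x => by
      obtain ⟨L, hL0, hL⟩ := hG ‖x‖
      refine ultra_lim (C := L) ?_
      filter_upwards [hev (‖x‖ + 1)] with N hN
      exact hL N hN x le_rfl
  choose w hw using hw
  choose p hp using hp
  have key := local_limit hθ hf hv ht hb he' hvU hpU hw hp
  exact ⟨w, contDiff_iff_contDiffAt.2 fun x => (key x).1, fun x => (key x).2⟩

end Lim3

theorem stmt1 (m : ℕ) (hm : 1 ≤ m) (θ : ℝ) (hθ : 1 < θ)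
    (f : EuclideanSpace ℝ (Fin m) → ℝ) (hf : LocallyLipschitz f)
    (lam₁ : ℝ) (hsub : ∃ φ, IsSubsolution θ f lam₁ φ) :
    (∀ lam₂ ≤ lam₁, ∃ φ, IsSolution θ f lam₂ φ) ∧
      {p : ℝ × (EuclideanSpace ℝ (Fin m) → ℝ) | IsSolution θ f p.1 p.2}.Infinite := by
  have main : ∀ lam₂ ≤ lam₁, ∃ φ, IsSolution θ f lam₂ φ := by
    intro lam₂ hlam
    obtain ⟨φ, hφ, hφs⟩ := hsub
    have hf2 : LocallyLipschitz fun y => f y - lam₂ := by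
      intro x
      obtain ⟨K, s, hs, hK⟩ := hf x
      refine ⟨K, s, hs, fun y hy z hz => ?_⟩
      simpa using hK hy hz
    obtain ⟨w, hw, hwe⟩ := limit_exists hθ hf2 (fun R ε hR hε =>
      approx hm hθ hf2 hφ (fun y => by
        have := hφs y
        rw [norm_grad_eq] at this
        linarith) hR hε)
    exact ⟨w, hw, fun y => by rw [norm_grad_eq]; exact hwe y⟩
  refine ⟨main, ?_⟩
  choose φ hφ using fun n : ℕ => main (lam₁ - n) (by
    have : (0:ℝ) ≤ n := Nat.cast_nonneg n
    linarith)
  refine Set.infinite_of_injective_forall_mem (f := fun n : ℕ => (lam₁ - (n : ℝ), φ n)) ?_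
    (fun n => hφ n)
  intro a b hab
  have h1 : lam₁ - (a : ℝ) = lam₁ - b := congrArg Prod.fst hab
  exact_mod_cast (by linarith : (a : ℝ) = b)
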